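/- Let P ⊆ ℝ³ be a maximal lattice-free integral polytope, i.e., P is a bounded integral polyhedron with int(P) ∩ ℤ³ = ∅ that is not properly contained in any convex set whose interior contains no point of ℤ³. Then there exist a matrix U ∈ ℤ^{3×3} with |det U| = 1 and a vector v ∈ ℤ³ such that P = U·M + v, where M is one of the following twelve polytopes: M₁ = conv{0, 2e₁, 3e₂, 6e₃}; M₂ = conv{0, 2e₁, 4e₂, 4e₃}; M₃ = conv{0, 3e₁, 3e₂, 3e₃}; M₄ = conv{0, e₁, 2e₁+4e₂, 3e₁+4e₃}; M₅ = conv{0, e₁, 2e₁+5e₂, 3e₁+5e₃}; M₆ = conv{0, 3e₁, e₁+3e₂, 2e₁+3e₃}; M₇ = conv{0, 4e₁, e₁+2e₂, 2e₁+4e₃}; M₈ = conv{(2,0,0), (−2,0,0), (0,2,0), (0,−2,0), (1,1,2)}; M₉ = conv{(−1,0,0), (0,−1,0), (2,0,0), (0,2,0), (1,1,3)}; M₁₀ = conv(B ∪ (B+(1,2,3))) with B = conv{(1,0,0), (0,1,0), (−1,−1,0)}; M₁₁ = conv(B ∪ (B+(1,0,2))) with B = conv{(1,0,0), (−1,0,0),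 (0,2,0)}; M₁₂ = {σ₁u₁ + σ₂u₂ + σ₃u₃ : σ₁, σ₂, σ₃ ∈ [0,1]} with u₁ = (−1,1,0), u₂ = (1,1,0), u₃ = (1,1,2). -/

import Mathlib

open Set

/-- The set of integer points `ℤ^d` inside `ℝ^d`. -/
def intPts (d : ℕ) : Set (Fin d → ℝ) := {x | ∀ i, ∃ z : ℤ, x i = (z : ℝ)}

/-- The lattice `Λ = s·ℤ^d` inside `ℝ^d`. -/
def sLat (d s : ℕ) : Set (Fin d → ℝ) := {x | ∀ i, ∃ z : ℤ, x i = (s : ℝ) * (z : ℝ)}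

/-- A polyhedron: a finite intersection of closed halfspaces. -/
def IsPolyhedron {d : ℕ} (P : Set (Fin d → ℝ)) : Prop :=
  ∃ (n : ℕ) (A : Fin n → Fin d → ℝ) (b : Fin n → ℝ),
    P = {x | ∀ i, (∑ j, A i j * x j) ≤ b i}

/-- An integral set: it equals the convex hull of its integer points. -/
def IsIntegralPoly {d : ℕ} (P : Set (Fin d → ℝ)) : Prop :=
  P = convexHull ℝ (P ∩ intPts d)

/-- The affine map `x ↦ U·x + t` with integer matrix `U` and translation `t : ℝ^d`. -/
noncomputable def affMap {d : ℕ} (U : Matrix (Fin d) (Fin d) ℤ) (t : Fin d → ℝ)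
    (x : Fin d → ℝ) : Fin d → ℝ := fun i => (∑ j, (U i j : ℝ) * x j) + t i

/-- Membership in `𝓜³`: a maximal lattice-free integral polytope in `ℝ³`, i.e. a bounded
integral polyhedron with nonempty interior, whose interior contains no integer point, and
which is not properly contained in any convex set whose interior contains no integer point. -/
def MemM3 (P : Set (Fin 3 → ℝ)) : Prop :=
  IsPolyhedron P ∧ Bornology.IsBounded P ∧ IsIntegralPoly P ∧ (interior P).Nonempty ∧
    interior P ∩ intPts 3 = ∅ ∧
    ∀ K : Set (Fin 3 → ℝ), Convex ℝ K → interior K ∩ intPts 3 = ∅ → P ⊆ K → P = K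

def M1 : Set (Fin 3 → ℝ) :=
  convexHull ℝ ({![0,0,0], ![2,0,0], ![0,3,0], ![0,0,6]} : Set (Fin 3 → ℝ))
def M2 : Set (Fin 3 → ℝ) :=
  convexHull ℝ ({![0,0,0], ![2,0,0], ![0,4,0], ![0,0,4]} : Set (Fin 3 → ℝ))
def M3 : Set (Fin 3 → ℝ) :=
  convexHull ℝ ({![0,0,0], ![3,0,0], ![0,3,0], ![0,0,3]} : Set (Fin 3 → ℝ))
def M4 : Set (Fin 3 → ℝ) :=
  convexHull ℝ ({![0,0,0], ![1,0,0], ![2,4,0], ![3,0,4]} : Set (Fin 3 → ℝ))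
def M5 : Set (Fin 3 → ℝ) :=
  convexHull ℝ ({![0,0,0], ![1,0,0], ![2,5,0], ![3,0,5]} : Set (Fin 3 → ℝ))
def M6 : Set (Fin 3 → ℝ) :=
  convexHull ℝ ({![0,0,0], ![3,0,0], ![1,3,0], ![2,0,3]} : Set (Fin 3 → ℝ))
def M7 : Set (Fin 3 → ℝ) :=
  convexHull ℝ ({![0,0,0], ![4,0,0], ![1,2,0], ![2,0,4]} : Set (Fin 3 → ℝ))
def M8 : Set (Fin 3 → ℝ) :=
  convexHull ℝ ({![2,0,0], ![-2,0,0], ![0,2,0], ![0,-2,0], ![1,1,2]} : Set (Fin 3 → ℝ))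
def M9 : Set (Fin 3 → ℝ) :=
  convexHull ℝ ({![-1,0,0], ![0,-1,0], ![2,0,0], ![0,2,0], ![1,1,3]} : Set (Fin 3 → ℝ))
def B10 : Set (Fin 3 → ℝ) :=
  convexHull ℝ ({![1,0,0], ![0,1,0], ![-1,-1,0]} : Set (Fin 3 → ℝ))
def M10 : Set (Fin 3 → ℝ) :=
  convexHull ℝ (B10 ∪ (fun x => x + ![1,2,3]) '' B10)
def B11 : Set (Fin 3 → ℝ) :=
  convexHull ℝ ({![1,0,0], ![-1,0,0], ![0,2,0]} : Set (Fin 3 → ℝ))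
def M11 : Set (Fin 3 → ℝ) :=
  convexHull ℝ (B11 ∪ (fun x => x + ![1,0,2]) '' B11)
def M12 : Set (Fin 3 → ℝ) :=
  {x | ∃ σ₁ σ₂ σ₃ : ℝ, σ₁ ∈ Icc (0:ℝ) 1 ∧ σ₂ ∈ Icc (0:ℝ) 1 ∧ σ₃ ∈ Icc (0:ℝ) 1 ∧
    x = σ₁ • ![(-1:ℝ),1,0] + σ₂ • ![(1:ℝ),1,0] + σ₃ • ![(1:ℝ),1,2]}

namespace LatticeFree

/-- Integer points of space. -/
abbrev Pt := ℤ × ℤ × ℤ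

/-- The scalar product. -/
def dot (a b : Pt) : ℤ := a.1 * b.1 + a.2.1 * b.2.1 + a.2.2 * b.2.2

/-- The cross product. -/
def cross (a b : Pt) : Pt :=
  (a.2.1 * b.2.2 - a.2.2 * b.2.1, a.2.2 * b.1 - a.1 * b.2.2, a.1 * b.2.1 - a.2.1 * b.1)

/-- The difference of two points. -/
def sub (a b : Pt) : Pt := (a.1 - b.1, a.2.1 - b.2.1, a.2.2 - b.2.2)

/-- The point `m a + n b`. -/
def comb (m : ℤ) (a : Pt) (n : ℤ) (b : Pt) : Pt :=
  (m * a.1 + n * b.1, m * a.2.1 + n * b.2.1, m * a.2.2 + n * b.2.2)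

lemma dot_comm (a b : Pt) : dot a b = dot b a := by simp only [dot]; ring

lemma dot_sub (u a b : Pt) : dot u (sub a b) = dot u a - dot u b := by
  simp only [dot, sub]; ring

lemma dot_comb (u : Pt) (m : ℤ) (a : Pt) (n : ℤ) (b : Pt) :
    dot u (comb m a n b) = m * dot u a + n * dot u b := by
  simp only [dot, comb]; ring

lemma comb_dot (u : Pt) (m : ℤ) (a : Pt) (n : ℤ) (b : Pt) :
    dot (comb m a n b) u = m * dot a u + n * dot b u := by
  simp only [dot, comb]; ring

lemma dot_self_pos {a : Pt} (h : a ≠ 0) : 0 < dot a a := by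
  obtain ⟨x, y, z⟩ := a
  simp only [dot]
  by_contra! hle
  apply h
  have hx : x * x = 0 := by nlinarith [mul_self_nonneg x, mul_self_nonneg y, mul_self_nonneg z]
  have hy : y * y = 0 := by nlinarith [mul_self_nonneg x, mul_self_nonneg y, mul_self_nonneg z]
  have hz : z * z = 0 := by nlinarith [mul_self_nonneg x, mul_self_nonneg y, mul_self_nonneg z]
  simp only [mul_self_eq_zero] at hx hy hz
  simp [hx, hy, hz]

lemma dot_cross_self_left (a b : Pt) : dot (cross a b) a = 0 := by
  simp only [dot, cross]; ring

lemma dot_cross_self_right (a b : Pt) : dot (cross a b) b = 0 := by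
  simp only [dot, cross]; ring

/-- Cramer's rule, tested against a functional. -/
lemma det_mul_dot (u d a₁ a₂ a₃ : Pt) :
    dot a₁ (cross a₂ a₃) * dot u d = dot d (cross a₂ a₃) * dot u a₁ +
      dot d (cross a₃ a₁) * dot u a₂ + dot d (cross a₁ a₂) * dot u a₃ := by
  simp only [dot, cross]; ring

/-- A functional that vanishes on three independent vectors is zero. -/
lemma dot_eq_zero_of_basis {u a₁ a₂ a₃ : Pt} (hD : dot a₁ (cross a₂ a₃) ≠ 0)
    (h₁ : dot u a₁ = 0) (h₂ : dot u a₂ = 0) (h₃ : dot u a₃ = 0) (d : Pt) : dot u d = 0 := by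
  have := det_mul_dot u d a₁ a₂ a₃
  rw [h₁, h₂, h₃] at this
  simpa [hD] using this

/-- The set `V` of lattice points of a maximal lattice-free integral polytope whose facets are
given by the primitive inequalities `f.1 · x ≤ f.2` with `f` in `F`. -/
structure IsBody (V : Set Pt) (F : Set (Pt × ℤ)) : Prop where
  finite_pts : V.Finite
  finite_facets : F.Finite
  mem_iff : ∀ x, x ∈ V ↔ ∀ f ∈ F, dot f.1 x ≤ f.2
  free : ∀ x, ∃ f ∈ F, f.2 ≤ dot f.1 x
  facet_pt : ∀ f ∈ F, ∃ y, dot f.1 y = f.2 ∧ ∀ g ∈ F, g ≠ f → dot g.1 y < g.2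
  prim : ∀ f ∈ F, ∃ x, dot f.1 x = 1
  support : ∀ (u : Pt) (b N : ℤ) (X : Pt), 0 < N → (∀ f ∈ F, dot f.1 X ≤ N * f.2) →
    (∀ v ∈ V, dot u v ≤ b) → dot u X ≤ N * b

namespace IsBody

variable {V : Set Pt} {F : Set (Pt × ℤ)}

/-- The lattice point `y` in the relative interior of a facet is not extreme in any direction
`d` of the facet plane. -/
lemma exists_tight_gt (B : IsBody V F) {f : Pt × ℤ} (hf : f ∈ F) {y : Pt} (hy : dot f.1 y = f.2)
    (hy' : ∀ g ∈ F, g ≠ f → dot g.1 y < g.2) {g d : Pt} (hd : dot f.1 d = 0) (hg : 0 < dot g d) :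
    ∃ v ∈ V, dot f.1 v = f.2 ∧ dot g y < dot g v := by
  by_contra! hcon
  obtain ⟨M, hM⟩ : ∃ M : ℤ, ∀ v ∈ V, dot g v - dot g y ≤ M := by
    obtain ⟨M, hM⟩ := (B.finite_pts.image fun v => dot g v - dot g y).bddAbove
    exact ⟨M, fun v hv => hM ⟨v, hv, rfl⟩⟩
  obtain ⟨N, hN⟩ : ∃ N : ℤ, ∀ f' ∈ F, dot f'.1 d ≤ N := by
    obtain ⟨M, hM⟩ := (B.finite_facets.image fun f' => dot f'.1 d).bddAbove
    exact ⟨M, fun v hv => hM ⟨v, hv, rfl⟩⟩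
  set N' := max N 1
  have hN1 : 1 ≤ N' := le_max_right _ _
  set M' := max M 0
  have hM0 : 0 ≤ M' := le_max_right _ _
  have key := B.support (comb 1 g M' f.1) (dot g y + M' * f.2) N' (comb N' y 1 d) (by omega)
    (fun f' hf' => by
      rw [dot_comb]
      by_cases h : f' = f
      · subst h; rw [hd, hy]; simp
      · have h1 := hy' f' hf' h
        have h2 := hN f' hf'
        have h3 : N ≤ N' := le_max_left _ _
        nlinarith)
    (fun v hv => by
      rw [comb_dot]
      have h1 := (B.mem_iff v).1 hv f hf
      have h2 := hM v hv
      have h3 : M ≤ M' := le_max_left _ _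
      rcases h1.lt_or_eq with h | h
      · nlinarith
      · have := hcon v hv h
        rw [h]; linarith)
  rw [comb_dot, dot_comb, dot_comb, hd, hy] at key
  nlinarith

/-- A plane that supports the body along a triangle is the plane of a facet. -/
lemma exists_facet (B : IsBody V F) {p₁ p₂ p₃ : Pt} (h₁ : p₁ ∈ V) (h₂ : p₂ ∈ V) (h₃ : p₃ ∈ V)
    {u : Pt} (hu : u = cross (sub p₂ p₁) (sub p₃ p₁)) (hu0 : u ≠ 0)
    (hV : ∀ v ∈ V, dot u v ≤ dot u p₁) :
    ∃ f ∈ F, ∃ c : ℤ, 0 < c ∧ u = comb c f.1 0 0 ∧ dot u p₁ = c * f.2 := by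
  have e₂ : dot u p₂ = dot u p₁ := by
    have := dot_cross_self_left (sub p₂ p₁) (sub p₃ p₁)
    rw [← hu, dot_sub] at this; omega
  have e₃ : dot u p₃ = dot u p₁ := by
    have := dot_cross_self_right (sub p₂ p₁) (sub p₃ p₁)
    rw [← hu, dot_sub] at this; omega
  have hpos := dot_self_pos hu0
  obtain ⟨f, hf, t₁, t₂, t₃⟩ : ∃ f ∈ F, dot f.1 p₁ = f.2 ∧ dot f.1 p₂ = f.2 ∧ dot f.1 p₃ = f.2 := by
    by_contra! hcon
    obtain ⟨M, hM⟩ : ∃ M : ℤ, ∀ f' ∈ F, dot f'.1 u ≤ M := by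
      obtain ⟨M, hM⟩ := (B.finite_facets.image fun f' => dot f'.1 u).bddAbove
      exact ⟨M, fun v hv => hM ⟨v, hv, rfl⟩⟩
    set M' := max M 1
    have hM1 : 1 ≤ M' := le_max_right _ _
    have hM2 : M ≤ M' := le_max_left _ _
    have key := B.support u (dot u p₁) (3 * M')
      (comb M' (comb 1 p₁ 1 (comb 1 p₂ 1 p₃)) 1 u) (by omega)
      (fun f' hf' => by
        simp only [dot_comb]
        have i₁ := (B.mem_iff _).1 h₁ f' hf'
        have i₂ := (B.mem_iff _).1 h₂ f' hf'
        have i₃ := (B.mem_iff _).1 h₃ f' hf'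
        have h4 := hM f' hf'
        have : dot f'.1 p₁ + dot f'.1 p₂ + dot f'.1 p₃ ≤ 3 * f'.2 - 1 := by
          by_contra! h5
          have q₁ : dot f'.1 p₁ = f'.2 := by omega
          have q₂ : dot f'.1 p₂ = f'.2 := by omega
          have q₃ : dot f'.1 p₃ = f'.2 := by omega
          exact hcon f' hf' q₁ q₂ q₃
        nlinarith) hV
    simp only [dot_comb, e₂, e₃] at key
    nlinarith
  obtain ⟨x, hx⟩ := B.prim f hf
  have hprop : u = comb (dot u x) f.1 0 0 := by
    have o₁ : dot f.1 (sub p₂ p₁) = 0 := by rw [dot_sub]; omega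
    have o₂ : dot f.1 (sub p₃ p₁) = 0 := by rw [dot_sub]; omega
    rw [hu]
    generalize sub p₂ p₁ = a at o₁ ⊢
    generalize sub p₃ p₁ = b at o₂ ⊢
    obtain ⟨⟨n₁, n₂, n₃⟩, c⟩ := f
    obtain ⟨a₁, a₂, a₃⟩ := a
    obtain ⟨b₁, b₂, b₃⟩ := b
    obtain ⟨x₁, x₂, x₃⟩ := x
    simp only [dot, cross, comb, Prod.mk.injEq, Prod.fst_zero, Prod.snd_zero] at *
    refine ⟨?_, ?_, ?_⟩
    · linear_combination (-(a₂ * b₃ - a₃ * b₂)) * hx + (x₂ * b₃ - x₃ * b₂) * o₁ +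
        (x₃ * a₂ - x₂ * a₃) * o₂
    · linear_combination (-(a₃ * b₁ - a₁ * b₃)) * hx + (x₃ * b₁ - x₁ * b₃) * o₁ +
        (x₁ * a₃ - x₃ * a₁) * o₂
    · linear_combination (-(a₁ * b₂ - a₂ * b₁)) * hx + (x₁ * b₂ - x₂ * b₁) * o₁ +
        (x₂ * a₁ - x₁ * a₂) * o₂
  refine ⟨f, hf, dot u x, ?_, hprop, ?_⟩
  · by_contra! hle
    have hall : ∀ v ∈ V, dot f.1 v = f.2 ∨ dot u x = 0 := by
      intro v hv
      by_contra! hne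
      have i := (B.mem_iff v).1 hv f hf
      have h1 := hV v hv
      rw [hprop, comb_dot, comb_dot, t₁] at h1
      have : dot f.1 v < f.2 := lt_of_le_of_ne i hne.1
      have : dot u x < 0 := lt_of_le_of_ne hle hne.2
      simp only [dot, Prod.fst_zero, Prod.snd_zero] at *
      nlinarith
    have hne : dot u x ≠ 0 := by
      intro h0
      apply hu0
      rw [hprop, h0]; simp [comb]
    obtain ⟨y, hy, hy'⟩ := B.facet_pt f hf
    obtain ⟨M, hM⟩ : ∃ M : ℤ, ∀ f' ∈ F, -dot f'.1 x ≤ M := by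
      obtain ⟨M, hM⟩ := (B.finite_facets.image fun f' => -dot f'.1 x).bddAbove
      exact ⟨M, fun v hv => hM ⟨v, hv, rfl⟩⟩
    have key := B.support (comb (-1) f.1 0 0) (-f.2) (max M 1) (comb (max M 1) y (-1) x)
      (by have := le_max_right M 1; omega)
      (fun f' hf' => by
        rw [dot_comb]
        by_cases h : f' = f
        · subst h; rw [hx, hy]; linarith
        · have h1 := hy' f' hf' h
          have h2 := hM f' hf'
          have h3 := le_max_left M 1
          have h4 := le_max_right M 1
          nlinarith)
      (fun v hv => by
        have := (hall v hv).resolve_right hne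
        rw [comb_dot, this]; simp [dot])
    simp only [comb_dot, dot_comb, hx, hy] at key
    simp only [dot, Prod.fst_zero, Prod.snd_zero] at key
    nlinarith
  · conv_lhs => rw [hprop]
    rw [comb_dot, t₁]; simp [dot]

end IsBody

/-- An integral affine map, given by the image of the origin and the images of the unit vectors
under its linear part. -/
structure Frame where
  o : Pt
  c₁ : Pt
  c₂ : Pt
  c₃ : Pt

namespace Frame

/-- The value of the affine map. -/
def app (φ : Frame) (p : Pt) : Pt :=
  (φ.o.1 + p.1 * φ.c₁.1 + p.2.1 * φ.c₂.1 + p.2.2 * φ.c₃.1,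
   φ.o.2.1 + p.1 * φ.c₁.2.1 + p.2.1 * φ.c₂.2.1 + p.2.2 * φ.c₃.2.1,
   φ.o.2.2 + p.1 * φ.c₁.2.2 + p.2.1 * φ.c₂.2.2 + p.2.2 * φ.c₃.2.2)

/-- The determinant of the linear part. -/
def det (φ : Frame) : ℤ := dot φ.c₁ (cross φ.c₂ φ.c₃)

end Frame

/-- The twelve polytopes: their vertices and their lattice points. -/
def models : List (List Pt × List Pt) := [
  ([(0, 0, 0), (2, 0, 0), (0, 3, 0), (0, 0, 6)], [(0, 0, 0), (0, 0, 1), (0, 0, 2), (0, 0, 3),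
   (0, 0, 4), (0, 0, 5), (0, 0, 6), (0, 1, 0), (0, 1, 1), (0, 1, 2), (0, 1, 3), (0, 1, 4), (0,
   2, 0), (0, 2, 1), (0, 2, 2), (0, 3, 0), (1, 0, 0), (1, 0, 1), (1, 0, 2), (1, 0, 3), (1, 1,
   0), (1, 1, 1), (2, 0, 0)]),
  ([(0, 0, 0), (2, 0, 0), (0, 4, 0), (0, 0, 4)], [(0, 0, 0), (0, 0, 1), (0, 0, 2), (0, 0, 3),
   (0, 0, 4), (0, 1, 0), (0, 1, 1), (0, 1, 2), (0, 1, 3), (0, 2, 0), (0, 2, 1), (0, 2, 2), (0,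
   3, 0), (0, 3, 1), (0, 4, 0), (1, 0, 0), (1, 0, 1), (1, 0, 2), (1, 1, 0), (1, 1, 1), (1, 2,
   0), (2, 0, 0)]),
  ([(0, 0, 0), (3, 0, 0), (0, 3, 0), (0, 0, 3)], [(0, 0, 0), (0, 0, 1), (0, 0, 2), (0, 0, 3),
   (0, 1, 0), (0, 1, 1), (0, 1, 2), (0, 2, 0), (0, 2, 1), (0, 3, 0), (1, 0, 0), (1, 0, 1), (1,
   0, 2), (1, 1, 0), (1, 1, 1), (1, 2, 0), (2, 0, 0), (2, 0, 1), (2, 1, 0), (3, 0, 0)]),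
  ([(0, 0, 0), (1, 0, 0), (2, 4, 0), (3, 0, 4)], [(0, 0, 0), (1, 0, 0), (1, 0, 1), (1, 1, 0),
   (1, 2, 0), (2, 0, 2), (2, 1, 2), (2, 2, 1), (2, 4, 0), (3, 0, 4)]),
  ([(0, 0, 0), (1, 0, 0), (2, 5, 0), (3, 0, 5)], [(0, 0, 0), (1, 0, 0), (1, 0, 1), (1, 1, 0),
   (1, 1, 1), (1, 2, 0), (2, 0, 3), (2, 1, 2), (2, 2, 2), (2, 3, 1), (2, 5, 0), (3, 0, 5)]),
  ([(0, 0, 0), (3, 0, 0), (1, 3, 0), (2, 0, 3)], [(0, 0, 0), (1, 0, 0), (1, 0, 1), (1, 1, 0),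
   (1, 1, 1), (1, 2, 0), (1, 3, 0), (2, 0, 0), (2, 0, 1), (2, 0, 2), (2, 0, 3), (2, 1, 0), (2,
   1, 1), (3, 0, 0)]),
  ([(0, 0, 0), (4, 0, 0), (1, 2, 0), (2, 0, 4)], [(0, 0, 0), (1, 0, 0), (1, 0, 1), (1, 0, 2),
   (1, 1, 0), (1, 1, 1), (1, 2, 0), (2, 0, 0), (2, 0, 1), (2, 0, 2), (2, 0, 3), (2, 0, 4), (2,
   1, 0), (2, 1, 1), (3, 0, 0), (3, 0, 1), (3, 0, 2), (4, 0, 0)]),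
  ([(2, 0, 0), (-2, 0, 0), (0, 2, 0), (0, -2, 0), (1, 1, 2)], [(-2, 0, 0), (-1, -1, 0), (-1, 0,
   0), (-1, 1, 0), (0, -2, 0), (0, -1, 0), (0, 0, 0), (0, 0, 1), (0, 1, 0), (0, 1, 1), (0, 2,
   0), (1, -1, 0), (1, 0, 0), (1, 0, 1), (1, 1, 0), (1, 1, 1), (1, 1, 2), (2, 0, 0)]),
  ([(-1, 0, 0), (0, -1, 0), (2, 0, 0), (0, 2, 0), (1, 1, 3)], [(-1, 0, 0), (0, -1, 0), (0, 0,
   0), (0, 0, 1), (0, 1, 0), (0, 1, 1), (0, 2, 0), (1, 0, 0), (1, 0, 1), (1, 1, 0), (1, 1, 1),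
   (1, 1, 2), (1, 1, 3), (2, 0, 0)]),
  ([(1, 0, 0), (0, 1, 0), (-1, -1, 0), (2, 2, 3), (1, 3, 3), (0, 1, 3)], [(-1, -1, 0), (0, 0,
   0), (0, 0, 1), (0, 1, 0), (0, 1, 1), (0, 1, 2), (0, 1, 3), (1, 0, 0), (1, 1, 1), (1, 1, 2),
   (1, 2, 2), (1, 2, 3), (1, 3, 3), (2, 2, 3)]),
  ([(1, 0, 0), (-1, 0, 0), (0, 2, 0), (2, 0, 2), (0, 0, 2), (1, 2, 2)], [(-1, 0, 0), (0, 0, 0),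
   (0, 0, 1), (0, 0, 2), (0, 1, 0), (0, 1, 1), (0, 2, 0), (1, 0, 0), (1, 0, 1), (1, 0, 2), (1,
   1, 1), (1, 1, 2), (1, 2, 2), (2, 0, 2)]),
  ([(0, 0, 0), (1, 1, 2), (1, 1, 0), (2, 2, 2), (-1, 1, 0), (0, 2, 2), (0, 2, 0), (1, 3, 2)],
   [(-1, 1, 0), (0, 0, 0), (0, 1, 0), (0, 1, 1), (0, 2, 0), (0, 2, 1), (0, 2, 2), (1, 1, 0), (1,
   1, 1), (1, 1, 2), (1, 2, 1), (1, 2, 2), (1, 3, 2), (2, 2, 2)])]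

/-- `V` consists of the lattice points of one of the twelve polytopes, up to a unimodular
transformation. -/
def IsModel (V : Set Pt) : Prop :=
  ∃ m ∈ models, ∃ φ : Frame, φ.det * φ.det = 1 ∧ (∀ p ∈ m.1, φ.app p ∈ V) ∧
    ∀ v ∈ V, ∃ p ∈ m.2, φ.app p = v

/-- Strict filtering with a continuation. -/
def sift (p : Pt → Bool) : List Pt → (List Pt → Bool) → Bool
  | [], k => k []
  | a :: l, k => cond (p a) (sift p l fun r => k (a :: r)) (sift p l k)

lemma sift_eq (p : Pt → Bool) (l : List Pt) (k : List Pt → Bool) :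
    sift p l k = k (l.filter p) := by
  induction l generalizing k with
  | nil => rfl
  | cons a l ih => by_cases h : p a <;> simp [sift, ih, h]

/-- A lattice point `q` and three points of the body. -/
structure Entry where
  q : Pt
  p₁ : Pt
  p₂ : Pt
  p₃ : Pt

/-- The three edge vectors at `q` form a positive basis. -/
def Entry.pos (e : Entry) : Bool :=
  decide (0 < dot (sub e.p₁ e.q) (cross (sub e.p₂ e.q) (sub e.p₃ e.q)))

/-- A natural number is evaluated before it is passed to a continuation. -/
def forceNat (n : ℕ) (k : ℕ → Bool) : Bool :=
  match n with
  | 0 => k 0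
  | m + 1 => k (Nat.succ m)

/-- An integer is evaluated before it is passed to a continuation. -/
def force (x : ℤ) (k : ℤ → Bool) : Bool :=
  match x with
  | Int.ofNat n => forceNat n fun n => k (Int.ofNat n)
  | Int.negSucc n => forceNat n fun n => k (Int.negSucc n)

lemma force_eq (x : ℤ) (k : ℤ → Bool) : force x k = k x := by
  rcases x with n | n <;> cases n <;> rfl

/-- A point is evaluated before it is passed to a continuation. -/
def forcePt (x : Pt) (k : Pt → Bool) : Bool :=
  force x.1 fun a => force x.2.1 fun b => force x.2.2 fun c => k (a, b, c)

lemma forcePt_eq (x : Pt) (k : Pt → Bool) : forcePt x k = k x := by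
  simp [forcePt, force_eq]

/-- Three open halfspaces. -/
structure Cone where
  n₁ : Pt
  k₁ : ℤ
  n₂ : Pt
  k₂ : ℤ
  n₃ : Pt
  k₃ : ℤ

/-- The point is in the three halfspaces. -/
def Cone.kills (e : Cone) (c : Pt) : Bool :=
  decide (dot c e.n₁ < e.k₁) && (decide (dot c e.n₂ < e.k₂) && decide (dot c e.n₃ < e.k₃))

/-- The cone of those points `c` such that the tetrahedron of `c` and the three points of the entry
has `q` in its interior. -/
def Entry.cone (e : Entry) : Cone where
  n₁ := cross (sub e.p₂ e.q) (sub e.p₃ e.q)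
  k₁ := dot e.q (cross (sub e.p₂ e.q) (sub e.p₃ e.q))
  n₂ := cross (sub e.p₃ e.q) (sub e.p₁ e.q)
  k₂ := dot e.q (cross (sub e.p₃ e.q) (sub e.p₁ e.q))
  n₃ := cross (sub e.p₁ e.q) (sub e.p₂ e.q)
  k₃ := dot e.q (cross (sub e.p₁ e.q) (sub e.p₂ e.q))

/-- A cone is evaluated before it is passed to a continuation. -/
def Cone.force (e : Cone) (k : Cone → Bool) : Bool :=
  forcePt e.n₁ fun n₁ => LatticeFree.force e.k₁ fun k₁ => forcePt e.n₂ fun n₂ =>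
    LatticeFree.force e.k₂ fun k₂ => forcePt e.n₃ fun n₃ => LatticeFree.force e.k₃ fun k₃ =>
      k ⟨n₁, k₁, n₂, k₂, n₃, k₃⟩

lemma Cone.force_eq (e : Cone) (k : Cone → Bool) : e.force k = k e := by
  simp [Cone.force, forcePt_eq, LatticeFree.force_eq]

/-- The sum of the weights and the weighted sum of the points. -/
def weigh (W : List Pt) : List (ℕ × ℕ) → ℤ × Pt
  | [] => (0, 0)
  | w :: l => (w.1 + (weigh W l).1, comb w.1 (W.getD w.2 0) 1 (weigh W l).2)

/-- Equality of points, as a Boolean. -/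
def eqb (a b : Pt) : Bool :=
  decide (a.1 = b.1) && (decide (a.2.1 = b.2.1) && decide (a.2.2 = b.2.2))

lemma eqb_iff {a b : Pt} : eqb a b = true ↔ a = b := by
  obtain ⟨a₁, a₂, a₃⟩ := a
  obtain ⟨b₁, b₂, b₃⟩ := b
  simp [eqb]

/-- The content of an integer vector. -/
def content (u : Pt) : ℤ := (Nat.gcd (Nat.gcd u.1.natAbs u.2.1.natAbs) u.2.2.natAbs : ℕ)

/-- The normal vector of the plane of a triangle. -/
def normal (p₁ p₂ p₃ : Pt) : Pt := cross (sub p₂ p₁) (sub p₃ p₁)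

/-- Case distinctions that determine the lattice points of a body. -/
inductive Plan where
  | halt
  | leaf (m : ℕ) (φ : Frame)
  | split (c : Pt) (s t : Plan)
  | prune (q : Pt) (i j k : ℕ) (t : Plan)
  | height (i j k : ℕ) (t : Plan)
  | conv (e : Pt) (l : List (ℕ × ℕ))
  | inside (q : Pt) (l : List (ℕ × ℕ))
  | facet (i j k : ℕ)

open Plan

/-- The points of `W` lie in the given list of points of a model. -/
def leafCheck (φ : Frame) (W C : List Pt) (m : List Pt × List Pt) : Bool :=
  decide (φ.det * φ.det = 1) &&
  ((m.1.all fun p => W.any (eqb (φ.app p))) &&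
  ((W.all fun w => m.2.any fun p => eqb (φ.app p) w) &&
  (C.all fun w => m.2.any fun p => eqb (φ.app p) w)))

/-- No point of the list `T` in a plane with normal `u` is in the relative interior. -/
def flat (u : Pt) (T : List Pt) : Bool :=
  T.all fun p => T.any fun r => !eqb r p &&
    T.all fun x => decide (dot (cross u (sub r p)) (sub x p) ≤ 0)

/-- The first four points with an index in the list are affinely independent. -/
def spans (W : List Pt) : List (ℕ × ℕ) → Bool
  | i :: j :: k :: m :: _ =>
    !decide (dot (sub (W.getD j.2 0) (W.getD i.2 0)) (cross (sub (W.getD k.2 0) (W.getD i.2 0))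
      (sub (W.getD m.2 0) (W.getD i.2 0))) = 0)
  | _ => false

/-- The checker for plans: `W` consists of points of the body, and all further points of the body
are in `C`; the number `K` bounds the lattice distances to the facets. -/
def check (K : ℤ) : Plan → List Pt → List Pt → Bool
  | halt, _, _ => false
  | leaf m φ, W, C => leafCheck φ W C (models.getD m ([], []))
  | split c s t, W, C => sift (fun x => !eqb x c) C fun C' =>
      check K t W C' && check K s (c :: W) C'
  | prune q i j k t, W, C =>
      Entry.pos ⟨q, W.getD i 0, W.getD j 0, W.getD k 0⟩ &&
      (Entry.cone ⟨q, W.getD i 0, W.getD j 0, W.getD k 0⟩).force fun e =>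
      sift (fun x => !e.kills x) C fun C' => check K t W C'
  | height i j k t, W, C =>
      forcePt (normal (W.getD i 0) (W.getD j 0) (W.getD k 0)) fun u =>
      force (dot u (W.getD i 0)) fun b => force (b - content u * K) fun b' =>
      !eqb u 0 && ((W.all fun x => decide (dot u x ≤ b)) && ((C.all fun x => decide (dot u x ≤ b))
        &&
      ((W.any fun x => decide (dot u x < b')) ||
      sift (fun x => decide (b' ≤ dot u x)) C fun C' => check K t W C')))
  | conv e l, W, C =>
      (!W.any (eqb e)) && ((!C.any (eqb e)) &&
      (decide (0 < (weigh W l).1) && eqb (weigh W l).2 (comb (weigh W l).1 e 0 0)))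
  | inside q l, W, _ =>
      eqb (weigh W l).2 (comb (weigh W l).1 q 0 0) &&
      ((l.all fun w => decide (0 < w.1)) &&
      spans W l)
  | facet i j k, W, C =>
      forcePt (normal (W.getD i 0) (W.getD j 0) (W.getD k 0)) fun u =>
      force (dot u (W.getD i 0)) fun b =>
      !eqb u 0 && ((W.all fun x => decide (dot u x ≤ b)) && ((C.all fun x => decide (dot u x < b))
        &&
      sift (fun x => decide (dot u x = b)) W (flat u)))

namespace IsBody

variable {V : Set Pt} {F : Set (Pt × ℤ)}

/-- The normal vector of a facet is not zero. -/
lemma normal_ne (B : IsBody V F) {f : Pt × ℤ} (hf : f ∈ F) (h : ∀ d, dot f.1 d = 0) : False := by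
  obtain ⟨x, hx⟩ := B.prim f hf
  rw [h x] at hx
  exact zero_ne_one hx

lemma not_mem_of_kills (B : IsBody V F) {e : Entry} (h₁ : e.p₁ ∈ V) (h₂ : e.p₂ ∈ V)
    (h₃ : e.p₃ ∈ V) (hp : e.pos = true) {c : Pt} (hk : e.cone.kills c = true) : c ∉ V := by
  intro hc
  simp only [Entry.pos, Cone.kills, Bool.and_eq_true, decide_eq_true_eq] at hp hk
  simp only [Entry.cone] at hk
  have conv : ∀ n : Pt, dot c n < dot e.q n → dot (sub c e.q) n < 0 := by
    intro n hn
    rw [dot_comm, dot_sub, dot_comm n, dot_comm n]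
    omega
  obtain ⟨k₁, k₂, k₃⟩ := hk
  replace k₁ := conv _ k₁
  replace k₂ := conv _ k₂
  replace k₃ := conv _ k₃
  obtain ⟨f, hf, hq⟩ := B.free e.q
  have i₁ := (B.mem_iff _).1 h₁ f hf
  have i₂ := (B.mem_iff _).1 h₂ f hf
  have i₃ := (B.mem_iff _).1 h₃ f hf
  have ic := (B.mem_iff _).1 hc f hf
  have hC := det_mul_dot f.1 (sub c e.q) (sub e.p₁ e.q) (sub e.p₂ e.q) (sub e.p₃ e.q)
  have j₁ : dot f.1 (sub e.p₁ e.q) ≤ 0 := by rw [dot_sub]; omega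
  have j₂ : dot f.1 (sub e.p₂ e.q) ≤ 0 := by rw [dot_sub]; omega
  have j₃ : dot f.1 (sub e.p₃ e.q) ≤ 0 := by rw [dot_sub]; omega
  have jc : dot f.1 (sub c e.q) ≤ 0 := by rw [dot_sub]; omega
  have m₁ := mul_nonneg_of_nonpos_of_nonpos k₁.le j₁
  have m₂ := mul_nonneg_of_nonpos_of_nonpos k₂.le j₂
  have m₃ := mul_nonneg_of_nonpos_of_nonpos k₃.le j₃
  have mc := mul_nonpos_of_nonneg_of_nonpos hp.le jc
  refine B.normal_ne hf (dot_eq_zero_of_basis hp.ne' ?_ ?_ ?_)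
  · exact (mul_eq_zero.1 (by linarith : _ * _ = (0 : ℤ))).resolve_left k₁.ne
  · exact (mul_eq_zero.1 (by linarith : _ * _ = (0 : ℤ))).resolve_left k₂.ne
  · exact (mul_eq_zero.1 (by linarith : _ * _ = (0 : ℤ))).resolve_left k₃.ne

lemma getD_mem {W : List Pt} (hW : ∀ w ∈ W, w ∈ V) (h0 : (0 : Pt) ∈ V) (i : ℕ) :
    W.getD i 0 ∈ V := by
  rw [List.getD_eq_getElem?_getD]
  rcases h : W[i]? with _ | a
  · simpa using h0
  · exact hW a (List.mem_of_getElem? h)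

lemma weigh_le {W : List Pt} (hW : ∀ w ∈ W, w ∈ V) (h0 : (0 : Pt) ∈ V) {u : Pt} {b : ℤ}
    (hu : ∀ v ∈ V, dot u v ≤ b) (l : List (ℕ × ℕ)) :
    dot u (weigh W l).2 ≤ (weigh W l).1 * b := by
  induction l with
  | nil => simp [weigh, dot]
  | cons w l ih =>
    simp only [weigh, dot_comb]
    have := hu _ (getD_mem hW h0 w.2)
    nlinarith [Int.natCast_nonneg w.1]

lemma tight_of_weigh {W : List Pt} (hW : ∀ w ∈ W, w ∈ V) (h0 : (0 : Pt) ∈ V) {u : Pt} {b : ℤ}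
    (hu : ∀ v ∈ V, dot u v ≤ b) (l : List (ℕ × ℕ)) (hl : ∀ w ∈ l, 0 < w.1)
    (h : (weigh W l).1 * b ≤ dot u (weigh W l).2) : ∀ w ∈ l, dot u (W.getD w.2 0) = b := by
  induction l with
  | nil => simp
  | cons w l ih =>
    simp only [weigh, dot_comb] at h
    have h1 := hu _ (getD_mem hW h0 w.2)
    have h2 := weigh_le hW h0 hu l
    have h3 : (0 : ℤ) < w.1 := by exact_mod_cast hl w (by simp)
    have h4 : dot u (W.getD w.2 0) = b := by
      apply le_antisymm h1
      by_contra! h5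
      nlinarith
    rw [h4] at h
    intro w' hw'
    rcases List.mem_cons.1 hw' with rfl | hw'
    · exact h4
    · exact ih (fun x hx => hl x (by simp [hx])) (by linarith) w' hw'

lemma le_content {c : ℤ} {u f : Pt} (h : u = comb c f 0 0) (hu : u ≠ 0) : c ≤ content u := by
  obtain ⟨a, b, d⟩ := f
  simp only [comb, Prod.fst_zero, Prod.snd_zero, mul_zero, add_zero] at h
  have hdvd : c ∣ content u := by
    rw [content, Int.dvd_natCast, h]
    exact Nat.dvd_gcd (Nat.dvd_gcd (by simp [Int.natAbs_mul]) (by simp [Int.natAbs_mul]))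
      (by simp [Int.natAbs_mul])
  refine Int.le_of_dvd ?_ hdvd
  have : content u ≠ 0 := by
    intro h0
    apply hu
    simp only [content, Nat.cast_eq_zero, Nat.gcd_eq_zero_iff, Int.natAbs_eq_zero] at h0
    ext <;> simp [h0]
  exact lt_of_le_of_ne (Int.natCast_nonneg _) this.symm

/-- A successful check determines the body. -/
theorem isModel_of_check (B : IsBody V F) {K : ℤ} (hK : ∀ f ∈ F, ∀ v ∈ V, f.2 - dot f.1 v ≤ K)
    (h0 : (0 : Pt) ∈ V) (t : Plan) (W C : List Pt) (hW : ∀ w ∈ W, w ∈ V)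
    (hC : ∀ v ∈ V, v ∈ W ∨ v ∈ C) (h : check K t W C = true) : IsModel V := by
  induction t generalizing W C with
  | halt => simp [check] at h
  | leaf m φ =>
    rw [check, leafCheck] at h
    simp only [Bool.and_eq_true, decide_eq_true_eq, List.all_eq_true, List.any_eq_true,
      eqb_iff] at h
    obtain ⟨hd, hv, hw, hc⟩ := h
    have hm : models.getD m ([], []) ∈ models ∨ models.getD m ([], []) = ([], []) := by
      rw [List.getD_eq_getElem?_getD]
      rcases h : models[m]? with _ | a
      · exact .inr rfl
      · exact .inl (List.mem_of_getElem? h)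
    rcases hm with hm | hm
    · refine ⟨_, hm, φ, hd, fun p hp => ?_, fun v hv => ?_⟩
      · obtain ⟨x, hx, rfl⟩ := hv p hp
        exact hW _ hx
      · rcases hC v hv with h | h
        · exact hw v h
        · exact hc v h
    · rw [hm] at hw hc
      rcases hC 0 h0 with h | h
      · simpa using hw 0 h
      · simpa using hc 0 h
  | split c s t ihs iht =>
    rw [check, sift_eq, Bool.and_eq_true] at h
    by_cases hc : c ∈ V
    · refine ihs _ _ ?_ ?_ h.2
      · intro w hw
        rcases List.mem_cons.1 hw with rfl | hw
        · exact hc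
        · exact hW w hw
      · intro v hv
        by_cases e : v = c
        · simp [e]
        · rcases hC v hv with h | h
          · simp [h]
          · refine .inr (List.mem_filter.2 ⟨h, ?_⟩)
            simp [← Bool.not_eq_true, eqb_iff, e]
    · refine iht _ _ hW ?_ h.1
      intro v hv
      have e : v ≠ c := by rintro rfl; exact hc hv
      rcases hC v hv with h | h
      · simp [h]
      · refine .inr (List.mem_filter.2 ⟨h, ?_⟩)
        simp [← Bool.not_eq_true, eqb_iff, e]
  | prune q i j k t ih =>
    rw [check, Cone.force_eq, sift_eq, Bool.and_eq_true] at h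
    refine ih _ _ hW ?_ h.2
    intro v hv
    rcases hC v hv with hv' | hv'
    · exact .inl hv'
    · refine .inr (List.mem_filter.2 ⟨hv', ?_⟩)
      by_contra hk
      rw [Bool.not_eq_true, Bool.not_eq_false'] at hk
      exact B.not_mem_of_kills (getD_mem hW h0 i) (getD_mem hW h0 j) (getD_mem hW h0 k) h.1 hk hv
  | height i j k t ih =>
    rw [check, forcePt_eq, force_eq, force_eq, sift_eq] at h
    simp only [Bool.and_eq_true, List.all_eq_true, decide_eq_true_eq, Bool.or_eq_true,
      List.any_eq_true] at h
    generalize hu : normal (W.getD i 0) (W.getD j 0) (W.getD k 0) = u at h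
    obtain ⟨hu0, hWu, hCu, h⟩ := h
    have hu0 : u ≠ 0 := by simpa [← Bool.not_eq_true, eqb_iff] using hu0
    have hVu : ∀ v ∈ V, dot u v ≤ dot u (W.getD i 0) := fun v hv =>
      (hC v hv).elim (hWu v) (hCu v)
    obtain ⟨f, hf, c, hc, huf, hb⟩ := B.exists_facet (getD_mem hW h0 i) (getD_mem hW h0 j)
      (getD_mem hW h0 k) hu.symm hu0 hVu
    have key : ∀ v ∈ V, dot u (W.getD i 0) - content u * K ≤ dot u v := by
      intro v hv
      have h1 := hK f hf v hv
      have h2 := (B.mem_iff v).1 hv f hf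
      have h3 := le_content huf hu0
      have h4 : dot u v = c * dot f.1 v := by
        conv_lhs => rw [huf]
        rw [comb_dot]; simp
      rw [hb, h4]
      nlinarith
    rcases h with ⟨x, hx, hlt⟩ | h
    · exact absurd (key x (hW x hx)) (by omega)
    · refine ih _ _ hW ?_ h
      intro v hv
      rcases hC v hv with hv' | hv'
      · exact .inl hv'
      · exact .inr (List.mem_filter.2 ⟨hv', by simpa using key v hv⟩)
  | conv e l =>
    rw [check] at h
    simp only [Bool.and_eq_true, decide_eq_true_eq, eqb_iff] at h
    obtain ⟨hw, hc, hpos, heq⟩ := h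
    have he : e ∉ V := by
      intro he
      rcases hC e he with h | h
      · rw [Bool.not_eq_true', ← Bool.not_eq_true, List.any_eq_true] at hw
        exact hw ⟨e, h, eqb_iff.2 rfl⟩
      · rw [Bool.not_eq_true', ← Bool.not_eq_true, List.any_eq_true] at hc
        exact hc ⟨e, h, eqb_iff.2 rfl⟩
    refine absurd ((B.mem_iff e).2 fun f hf => ?_) he
    have := weigh_le hW h0 (fun v hv => (B.mem_iff v).1 hv f hf) l
    rw [heq, dot_comb] at this
    nlinarith
  | inside q l =>
    rw [check] at h
    simp only [Bool.and_eq_true, decide_eq_true_eq, eqb_iff, List.all_eq_true] at h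
    obtain ⟨heq, hl, hdet⟩ := h
    obtain ⟨f, hf, hq⟩ := B.free q
    have hw : 0 ≤ (weigh W l).1 := by
      clear * -
      induction l with
      | nil => simp [weigh]
      | cons w l ih => simp only [weigh]; omega
    have ht := tight_of_weigh hW h0 (fun v hv => (B.mem_iff v).1 hv f hf) l hl (by
      rw [heq, dot_comb]; nlinarith)
    rcases l with _ | ⟨i, _ | ⟨j, _ | ⟨k, _ | ⟨m, l⟩⟩⟩⟩
    iterate 4 exact absurd hdet (by simp [spans])
    simp only [spans, Bool.not_eq_true', decide_eq_false_iff_not] at hdet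
    refine absurd (dot_eq_zero_of_basis (u := f.1) hdet ?_ ?_ ?_) (fun h => B.normal_ne hf h)
    all_goals
      rw [dot_sub, ht _ (by simp), ht _ (by simp)]
      simp
  | facet i j k =>
    rw [check, forcePt_eq, force_eq, sift_eq] at h
    simp only [Bool.and_eq_true, List.all_eq_true, decide_eq_true_eq] at h
    generalize hu : normal (W.getD i 0) (W.getD j 0) (W.getD k 0) = u at h
    obtain ⟨hu0, hWu, hCu, h⟩ := h
    have hu0 : u ≠ 0 := by simpa [← Bool.not_eq_true, eqb_iff] using hu0
    have hVu : ∀ v ∈ V, dot u v ≤ dot u (W.getD i 0) := fun v hv =>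
      (hC v hv).elim (hWu v) (fun h => (hCu v h).le)
    obtain ⟨f, hf, c, hc, huf, hb⟩ := B.exists_facet (getD_mem hW h0 i) (getD_mem hW h0 j)
      (getD_mem hW h0 k) hu.symm hu0 hVu
    have hdot : ∀ v, dot u v = c * dot f.1 v := by
      intro v
      conv_lhs => rw [huf]
      rw [comb_dot]; simp
    have htight : ∀ v ∈ V, dot f.1 v = f.2 → v ∈ W.filter fun x =>
        decide (dot u x = dot u (W.getD i 0)) := by
      intro v hv hvf
      have h1 : dot u v = dot u (W.getD i 0) := by rw [hdot, hvf, hb]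
      rcases hC v hv with h | h
      · exact List.mem_filter.2 ⟨h, by simpa using h1⟩
      · exact absurd (hCu v h) (by omega)
    obtain ⟨y, hy, hy'⟩ := B.facet_pt f hf
    have hyV : y ∈ V := (B.mem_iff y).2 fun g hg => by
      by_cases e : g = f
      · rw [e, hy]
      · exact (hy' g hg e).le
    simp only [flat, List.all_eq_true, List.any_eq_true, Bool.and_eq_true,
      decide_eq_true_eq] at h
    obtain ⟨r, hr, hry, hx⟩ := h y (htight y hyV hy)
    have hry : r ≠ y := by simpa [← Bool.not_eq_true, eqb_iff] using hry
    have hfr : dot u (sub r y) = 0 := by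
      have := (List.mem_filter.1 hr).2
      rw [decide_eq_true_eq] at this
      rw [dot_sub, this, hdot y, hy, hb]; simp
    have hgd : cross u (sub r y) ≠ 0 := by
      intro h0
      have h1 : dot (cross u (sub r y)) (cross u (sub r y)) =
          dot u u * dot (sub r y) (sub r y) - dot u (sub r y) * dot u (sub r y) := by
        simp only [dot, cross]; ring
      have h2 : sub r y ≠ 0 := by
        intro h3
        apply hry
        simp only [sub, Prod.mk_eq_zero] at h3
        ext <;> omega
      have h3 := mul_pos (dot_self_pos hu0) (dot_self_pos h2)
      rw [h0, hfr] at h1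
      simp only [dot, Prod.fst_zero, Prod.snd_zero] at h1 h3
      linarith
    obtain ⟨v, hv, hvf, hlt⟩ := B.exists_tight_gt hf hy hy' (d := cross u (sub r y))
      (g := cross u (sub r y)) (by
        have := dot_cross_self_left u (sub r y)
        rw [dot_comm, hdot] at this
        exact (mul_eq_zero.1 this).resolve_left hc.ne') (dot_self_pos hgd)
    have := hx v (htight v hv hvf)
    rw [dot_sub] at this
    omega

end IsBody

/-- The integers of absolute value at most ten. -/
def ints : List ℤ :=
  [-10, -9, -8, -7, -6, -5, -4, -3, -2, -1, 0, 1, 2, 3, 4, 5, 6, 7, 8, 9, 10]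

/-- The integers between zero and nine. -/
def heights : List ℤ := [0, 1, 2, 3, 4, 5, 6, 7, 8, 9]

lemma mem_ints {a : ℤ} (h₁ : -10 ≤ a) (h₂ : a ≤ 10) : a ∈ ints := by
  rw [ints]
  interval_cases a <;> simp

lemma mem_heights {a : ℤ} (h₁ : 0 ≤ a) (h₂ : a ≤ 9) : a ∈ heights := by
  rw [heights]
  interval_cases a <;> simp

/-- The cone contains the endpoints of a segment at some height and all points beyond it. -/
def Cone.killsFar (e : Cone) (p r : Pt) : Bool :=
  (e.kills p && e.kills r) && [e.n₁, e.n₂, e.n₃].all fun n =>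
    decide (n.1 * p.1 + n.2.1 * p.2.1 ≤ 0) && decide (n.1 * r.1 + n.2.1 * r.2.1 ≤ 0)

lemma neg_of_segment {M α β n₁ n₂ E p₁ p₂ r₁ r₂ x y : ℤ} (hM : 0 < M) (hα : 0 ≤ α) (hβ : 0 ≤ β)
    (hs : M ≤ α + β) (hx : M * x = α * p₁ + β * r₁) (hy : M * y = α * p₂ + β * r₂)
    (hp : n₁ * p₁ + n₂ * p₂ ≤ 0) (hr : n₁ * r₁ + n₂ * r₂ ≤ 0)
    (hp' : n₁ * p₁ + n₂ * p₂ + E < 0) (hr' : n₁ * r₁ + n₂ * r₂ + E < 0) :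
    n₁ * x + n₂ * y + E < 0 := by
  have key : M * (n₁ * x + n₂ * y + E) < 0 := by
    have e : M * (n₁ * x + n₂ * y + E) =
        α * (n₁ * p₁ + n₂ * p₂) + β * (n₁ * r₁ + n₂ * r₂) + M * E := by
      linear_combination n₁ * hx + n₂ * hy
    rw [e]
    generalize n₁ * p₁ + n₂ * p₂ = A at *
    generalize n₁ * r₁ + n₂ * r₂ = B at *
    rcases le_or_gt 0 E with h | h
    · have h1 : 0 ≤ α * (-(A + E) - 1) := mul_nonneg hα (by omega)
      have h2 : 0 ≤ β * (-(B + E) - 1) := mul_nonneg hβ (by omega)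
      have h3 : 0 ≤ (α + β - M) * E := mul_nonneg (by omega) h
      nlinarith
    · have h1 := mul_nonneg hα (by omega : 0 ≤ -A)
      have h2 := mul_nonneg hβ (by omega : 0 ≤ -B)
      have h3 := mul_pos hM (by omega : 0 < -E)
      nlinarith
  by_contra! h
  nlinarith [mul_nonneg hM.le h]

lemma Cone.kills_of_killsFar {e : Cone} {M α β h p₁ p₂ r₁ r₂ x y : ℤ}
    (hk : e.killsFar (p₁, p₂, h) (r₁, r₂, h) = true) (hM : 0 < M) (hα : 0 ≤ α) (hβ : 0 ≤ β)
    (hs : M ≤ α + β) (hx : M * x = α * p₁ + β * r₁) (hy : M * y = α * p₂ + β * r₂) :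
    e.kills (x, y, h) = true := by
  simp only [killsFar, kills, Bool.and_eq_true, decide_eq_true_eq, List.all_cons, List.all_nil,
    Bool.and_true] at hk ⊢
  obtain ⟨⟨⟨a₁, a₂, a₃⟩, b₁, b₂, b₃⟩, ⟨c₁, d₁⟩, ⟨c₂, d₂⟩, c₃, d₃⟩ := hk
  have aux : ∀ (n : Pt) (k : ℤ), n.1 * p₁ + n.2.1 * p₂ ≤ 0 → n.1 * r₁ + n.2.1 * r₂ ≤ 0 →
      dot (p₁, p₂, h) n < k → dot (r₁, r₂, h) n < k → dot (x, y, h) n < k := by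
    intro n k k₁ k₂ k₃ k₄
    have e : ∀ s t : ℤ, dot (s, t, h) n < k ↔ n.1 * s + n.2.1 * t + (n.2.2 * h - k) < 0 := by
      intro s t
      simp only [dot]
      constructor <;> intro h <;> linarith
    rw [e] at *
    exact neg_of_segment hM hα hβ hs hx hy k₁ k₂ k₃ k₄
  exact ⟨aux _ _ c₁ d₁ a₁ b₁, aux _ _ c₂ d₂ a₂ b₂, aux _ _ c₃ d₃ a₃ b₃⟩

/-- Cones are evaluated before they are passed to a continuation. -/
def forceCones : List Cone → (List Cone → Bool) → Bool
  | [], k => k []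
  | e :: l, k => e.force fun e => forceCones l fun l => k (e :: l)

lemma forceCones_eq (l : List Cone) (k : List Cone → Bool) : forceCones l k = k l := by
  induction l generalizing k with
  | nil => rfl
  | cons e l ih => simp [forceCones, Cone.force_eq, ih]

/-- Integers are evaluated and filtered before they are passed to a continuation. -/
def siftInts (p : ℤ → Bool) : List ℤ → (List ℤ → Bool) → Bool
  | [], k => k []
  | a :: l, k => force a fun a => cond (p a) (siftInts p l fun l => k (a :: l)) (siftInts p l k)

lemma siftInts_eq (p : ℤ → Bool) (l : List ℤ) (k : List ℤ → Bool) :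
    siftInts p l k = k (l.filter p) := by
  induction l generalizing k with
  | nil => rfl
  | cons a l ih => by_cases h : p a <;> simp [siftInts, force_eq, ih, h]

/-- A configuration of points of a body from which all possible bodies are determined: points of
a base facet in the plane of height zero, a point of maximal height `z.2.2`, lattice points that
bound the body to a box of radius `M`, and a plan. -/
structure Seed where
  base : List Pt
  z : Pt
  M : ℤ
  far : List (Pt × ℕ × ℕ × ℕ)
  plan : Plan

namespace Seed

/-- The points that are known at the beginning. -/
def pts (s : Seed) : List Pt := s.base ++ [0, s.z]

/-- The entries that bound the body. -/
def entries (s : Seed) : List Entry := s.far.map fun e =>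
  ⟨e.1, s.pts.getD e.2.1 0, s.pts.getD e.2.2.1 0, s.pts.getD e.2.2.2 0⟩

/-- All points outside of the box of radius `M` are excluded. -/
def farCheck (M : ℤ) (ts hs : List ℤ) (es : List Cone) : Bool :=
  hs.all fun h => ts.all fun t => decide (t = M) || force (t + 1) fun t' =>
    (es.any (fun e => e.killsFar (M, t, h) (M, t', h)) &&
    (es.any (fun e => e.killsFar (-M, t, h) (-M, t', h)) &&
    (es.any (fun e => e.killsFar (t, M, h) (t', M, h)) &&
    es.any (fun e => e.killsFar (t, -M, h) (t', -M, h)))))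

/-- The points of a box. -/
def box (ts hs : List ℤ) : List Pt :=
  ts.flatMap fun a => ts.flatMap fun b => hs.map fun h => (a, b, h)

/-- The seed leads to the models only. -/
def check (s : Seed) : Bool :=
  (decide (0 < s.M) && (decide (s.M ≤ 10) && decide (s.z.2.2 ≤ 9))) &&
  (s.entries.all Entry.pos &&
  forceCones (s.entries.map Entry.cone) fun es =>
  siftInts (fun a => decide (a ≤ s.z.2.2)) heights fun hs =>
  siftInts (fun a => decide (-s.M ≤ a) && decide (a ≤ s.M)) ints fun ts => farCheck s.M ts hs es &&
  siftInts (fun a => !decide (a = -s.M) && !decide (a = s.M)) ts fun ts =>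
  sift (fun c => !(es.any fun e => e.kills c) && !(s.pts.any (eqb c))) (box ts hs) fun C =>
    LatticeFree.check s.z.2.2 s.plan s.pts C)

lemma exists_sector {M a b : ℤ} (hM : 0 < M) (ha : M ≤ a) (hb₁ : -a ≤ b) (hb₂ : b ≤ a) :
    ∃ t, -M ≤ t ∧ t < M ∧ t * a ≤ M * b ∧ M * b ≤ (t + 1) * a := by
  have ha0 : 0 < a := by omega
  by_cases h : b = a
  · exact ⟨M - 1, by omega, by omega, by subst h; nlinarith, by subst h; nlinarith⟩
  · have hlt : b < a := lt_of_le_of_ne hb₂ h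
    refine ⟨M * b / a, ?_, ?_, ?_, ?_⟩
    · rw [Int.le_ediv_iff_mul_le ha0]; nlinarith
    · rw [Int.ediv_lt_iff_lt_mul ha0]; nlinarith
    · exact Int.ediv_mul_le _ ha0.ne'
    · exact (Int.lt_ediv_add_one_mul_self _ ha0).le

lemma exists_kills {M : ℤ} {ts hs : List ℤ} {es : List Cone} (h : farCheck M ts hs es = true)
    (hM : 0 < M) (hts : ∀ t, -M ≤ t → t ≤ M → t ∈ ts) {x y z : ℤ}
    (hz : z ∈ hs) (hxy : ¬ ((-M < x ∧ x < M) ∧ (-M < y ∧ y < M))) :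
    ∃ e ∈ es, e.kills (x, y, z) = true := by
  simp only [farCheck, force_eq, Bool.and_eq_true, decide_eq_true_eq, List.all_eq_true,
    List.any_eq_true, Bool.or_eq_true] at h
  replace h := h z hz
  have main : ∀ a b : ℤ, M ≤ a → -a ≤ b → b ≤ a → ∃ t ∈ ts, t ≠ M ∧
      0 ≤ (t + 1) * a - M * b ∧ 0 ≤ M * b - t * a := by
    intro a b h₁ h₂ h₃
    obtain ⟨t, t₁, t₂, t₃, t₄⟩ := exists_sector hM h₁ h₂ h₃
    exact ⟨t, hts t t₁ t₂.le, t₂.ne, by omega, by omega⟩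
  have cases : (M ≤ x ∧ -x ≤ y ∧ y ≤ x) ∨ (M ≤ -x ∧ -(-x) ≤ y ∧ y ≤ -x) ∨
      (M ≤ y ∧ -y ≤ x ∧ x ≤ y) ∨ (M ≤ -y ∧ -(-y) ≤ x ∧ x ≤ -y) := by omega
  rcases cases with ⟨c₁, c₂, c₃⟩ | ⟨c₁, c₂, c₃⟩ | ⟨c₁, c₂, c₃⟩ | ⟨c₁, c₂, c₃⟩
  all_goals
    obtain ⟨t, t₁, t₂, t₃, t₄⟩ := main _ _ c₁ c₂ c₃
    obtain ⟨⟨e₁, m₁, k₁⟩, ⟨e₂, m₂, k₂⟩, ⟨e₃, m₃, k₃⟩, e₄, m₄, k₄⟩ := (h t t₁).resolve_left t₂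
  · exact ⟨e₁, m₁, Cone.kills_of_killsFar k₁ hM t₃ t₄ (by linarith) (by ring) (by ring)⟩
  · exact ⟨e₂, m₂, Cone.kills_of_killsFar k₂ hM t₃ t₄ (by linarith) (by ring) (by ring)⟩
  · exact ⟨e₃, m₃, Cone.kills_of_killsFar k₃ hM t₃ t₄ (by linarith) (by ring) (by ring)⟩
  · exact ⟨e₄, m₄, Cone.kills_of_killsFar k₄ hM t₃ t₄ (by linarith) (by ring) (by ring)⟩

/-- Every body that contains the points of a seed is one of the models. -/
theorem isModel {V : Set Pt} {F : Set (Pt × ℤ)} (B : IsBody V F) {s : Seed}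
    (hs : s.check = true) (hK : ∀ f ∈ F, ∀ v ∈ V, f.2 - dot f.1 v ≤ s.z.2.2)
    (hV : ∀ v ∈ V, 0 ≤ v.2.2 ∧ v.2.2 ≤ s.z.2.2) (hp : ∀ p ∈ s.pts, p ∈ V) : IsModel V := by
  simp only [check, forceCones_eq, siftInts_eq, sift_eq, Bool.and_eq_true] at hs
  obtain ⟨⟨hM, hM10, hz9⟩, hpos, hfar, hs⟩ := hs
  rw [decide_eq_true_eq] at hM hM10 hz9
  have h0 : (0 : Pt) ∈ V := hp 0 (by simp [pts])
  have hkill : ∀ e ∈ s.entries.map Entry.cone, ∀ v ∈ V, ¬ e.kills v = true := by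
    intro e he v hv hk
    obtain ⟨a, ha, rfl⟩ := List.mem_map.1 he
    have hpos : a.pos = true := List.all_eq_true.1 hpos a ha
    obtain ⟨b, -, rfl⟩ := List.mem_map.1 ha
    exact B.not_mem_of_kills (IsBody.getD_mem hp h0 _) (IsBody.getD_mem hp h0 _)
      (IsBody.getD_mem hp h0 _) hpos hk hv
  refine B.isModel_of_check hK h0 s.plan s.pts _ hp (fun v hv => ?_) hs
  by_cases hmem : v ∈ s.pts
  · exact .inl hmem
  refine .inr (List.mem_filter.2 ⟨?_, ?_⟩)
  · obtain ⟨x, y, z⟩ := v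
    obtain ⟨hz, hzK⟩ := hV _ hv
    have hzm : z ∈ heights.filter fun a => decide (a ≤ s.z.2.2) :=
      List.mem_filter.2 ⟨mem_heights hz (hzK.trans hz9), by simpa using hzK⟩
    have hts : ∀ t, -s.M ≤ t → t ≤ s.M →
        t ∈ ints.filter fun a => decide (-s.M ≤ a) && decide (a ≤ s.M) := fun t h₁ h₂ =>
      List.mem_filter.2 ⟨mem_ints (by omega) (by omega), by simp [h₁, h₂]⟩
    by_cases hxy : (-s.M < x ∧ x < s.M) ∧ (-s.M < y ∧ y < s.M)
    · simp only [box, List.mem_flatMap, List.mem_map]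
      exact ⟨x, List.mem_filter.2 ⟨hts x hxy.1.1.le hxy.1.2.le, by simp; omega⟩, y,
        List.mem_filter.2 ⟨hts y hxy.2.1.le hxy.2.2.le, by simp; omega⟩, z, hzm, rfl⟩
    · obtain ⟨e, he, hk⟩ := exists_kills hfar hM hts hzm hxy
      exact absurd hk (hkill e he _ hv)
  · rw [Bool.and_eq_true, Bool.not_eq_true', Bool.not_eq_true', ← Bool.not_eq_true,
      ← Bool.not_eq_true, List.any_eq_true, List.any_eq_true]
    refine ⟨?_, ?_⟩
    · rintro ⟨e, he, hk⟩
      exact hkill e he v hv hk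
    · rintro ⟨p, hpm, hk⟩
      rw [eqb_iff] at hk
      exact hmem (hk ▸ hpm)

end Seed

/-- A seed with base a square and top `(1, 1, 3)`. -/
def square113 : Seed := ⟨[(1, 0, 0), (0, 1, 0), (-1, 0, 0), (0, -1, 0)], (1, 1, 3), 7,
  [((0, 0, 1), 0, 2, 5), ((0, 1, 1), 1, 5, 2), ((1, 0, 1), 0, 3, 5), ((1, 1, 1), 0, 5, 1), ((0, 0,
    1), 1, 5, 3)],
  split (0, 0, 1) (prune (0, 0, 1) 1 4 3 <| prune (0, 0, 1) 2 4 3 <| prune (0, 0, 2) 3 6 4 <| prune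
    (1, 1, 2) 1 6 2 <| split (0, 0, 2) (inside (0, 0, 1) [(1, 0), (1, 6), (1, 4), (1, 5), (1, 7)])
    <|
   height 0 3 4 <| split (-2, 1, 0) (split (-1, 1, 0) (split (-1, 1, 1) (split (0, 1, 1) (split (0,
     1, 2) (prune (0, 1, 1) 0 3 6 <| split (1, -2, 0) (split (1, -1, 0) (split (1, -1, 1) (split (1,
     0, 2) (prune (1, 0, 1) 0 11 2 <| split (1, 1, 0) (leaf 2 ⟨(1, 1, 0), (0, -1, 0), (-1, 0, 0),
     (0, 0, 1)⟩) <|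
            split (1, 1, 1) (facet 0 11 12) <|
            split (1, 1, 2) (height 0 11 12 halt) <|
            facet 10 11 15) <|
           conv (1, 0, 2) [(1, 0), (1, 14)]) <|
          conv (1, -1, 1) [(2, 1), (1, 13)]) <|
         conv (1, -1, 0) [(1, 0), (1, 7)]) <|
        split (1, -1, 0) (prune (1, 0, 1) 0 12 8 <| split (1, -1, 1) (facet 0 11 1) <|
         split (1, 0, 2) (height 0 11 1 halt) <|
         facet 0 12 10) <|
        split (1, -1, 1) (split (1, 0, 2) (prune (1, 0, 1) 0 3 1 <| height 1 11 8 halt) <|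
         conv (1, 0, 2) [(1, 0), (1, 12)]) <|
        split (1, 0, 1) (split (1, 0, 2) (prune (1, 0, 1) 0 2 11 <| height 0 11 1 halt) <|
         split (2, 0, 0) (prune (1, 0, 1) 0 11 2 <| height 0 1 11 halt) <|
         split (2, 1, 2) (height 0 1 8 halt) <|
         split (2, 1, 3) (height 0 13 11 halt) <|
         facet 0 12 10) <|
        split (1, 0, 2) (conv (1, 0, 1) [(1, 0), (1, 7)]) <|
        split (2, 0, 0) (conv (1, 0, 1) [(1, 0), (1, 10), (1, 12)]) <|
        split (2, 1, 1) (height 0 10 7 halt) <|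
        split (2, 1, 2) (conv (1, 0, 1) [(1, 0), (1, 10)]) <|
        split (2, 1, 3) (conv (1, 0, 1) [(1, 0), (1, 7), (1, 10)]) <|
        facet 6 11 9) <|
       conv (0, 1, 2) [(1, 1), (1, 10)]) <|
      conv (0, 1, 1) [(1, 0), (2, 5), (1, 9)]) <|
     conv (-1, 1, 1) [(2, 1), (1, 8)]) <|
    conv (-1, 1, 0) [(1, 0), (1, 3)]) <|
   split (-1, 1, 0) (prune (0, 1, 1) 0 2 7 <| split (-1, 1, 1) (facet 0 1 5) <|
    split (0, 1, 2) (height 0 1 5 halt) <|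
    facet 0 4 7) <|
   split (-1, 1, 1) (split (0, 1, 2) (prune (0, 1, 1) 0 1 3 <| height 1 4 5 halt) <|
    conv (0, 1, 2) [(1, 0), (1, 7)]) <|
   split (0, 1, 1) (split (0, 1, 2) (prune (0, 1, 1) 0 5 3 <| split (1, 2, 1) (prune (1, 1, 2) 0 3 9
     <| split (1, 1, 0) (facet 0 6 1) <|
      facet 0 4 5) <|
     split (1, 2, 2) (split (1, 2, 3) (facet 0 2 10) <|
      facet 0 1 9) <|
     split (1, 2, 3) (facet 0 1 9) <|
     facet 0 1 5) <|
    split (0, 2, 0) (prune (0, 1, 1) 0 2 5 <| height 0 1 8 halt) <|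
    split (1, 2, 2) (split (1, 2, 3) (height 0 6 9 halt) <|
     facet 0 1 8) <|
    split (1, 2, 3) (height 0 5 8 halt) <|
    facet 0 4 7) <|
   split (0, 1, 2) (conv (0, 1, 1) [(1, 0), (1, 3)]) <|
   split (0, 2, 0) (conv (0, 1, 1) [(1, 0), (1, 4), (1, 7)]) <|
   split (1, 2, 1) (prune (1, 1, 2) 0 1 7 <| split (1, 1, 0) (facet 0 4 1) <|
    facet 0 2 3) <|
   split (1, 2, 2) (conv (0, 1, 1) [(1, 0), (1, 4)]) <|
   split (1, 2, 3) (conv (0, 1, 1) [(1, 0), (1, 3), (1, 4)]) <|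
   facet 2 3 6) <|
  conv (0, 0, 1) [(1, 2), (1, 3), (1, 5)]⟩

lemma square113_check : square113.check = true := by decide +kernel

/-- A seed with base a square and top `(1, 2, 4)`. -/
def square124 : Seed := ⟨[(1, 0, 0), (0, 1, 0), (-1, 0, 0), (0, -1, 0)], (1, 2, 4), 5,
  [((0, 0, 1), 1, 5, 3), ((1, 0, 1), 0, 3, 5), ((0, 1, 1), 0, 5, 2), ((1, 1, 1), 0, 5, 1), ((0, 0,
    1), 0, 2, 5), ((0, 1, 1), 1, 5, 3)],
  split (0, 0, 1) (split (0, 1, 1) (split (0, 1, 2) (split (1, 1, 2) (prune (0, 0, 1) 0 7 6 <| prune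
    (0, 1, 1) 0 6 5 <| prune (1, 1, 2) 5 7 9 <| prune (1, 1, 2) 2 4 3 <| split (1, -2, 0) (split (1,
    -1, 0) (split (1, -1, 1) (split (1, 0, 1) (split (1, 0, 2) (prune (1, 0, 1) 2 6 9 <| split (1,
    1, 0) (split (1, 2, 0) (split (1, 2, 1) (leaf 1 ⟨(1, 2, 0), (-1, -1, 0), (0, -1, 0), (0, 0, 1)⟩)
    <|
             conv (1, 2, 1) [(3, 0), (1, 16)]) <|
            split (1, 2, 1) (facet 0 1 12) <|
            split (1, 2, 2) (height 0 1 12 halt) <|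
            split (1, 2, 3) (height 0 1 12 halt) <|
            facet 0 11 15) <|
           split (1, 1, 1) (split (1, 2, 0) (conv (1, 1, 0) [(2, 0), (1, 5)]) <|
            split (1, 2, 1) (height 0 11 12 halt) <|
            split (1, 2, 2) (facet 0 1 12) <|
            facet 0 10 11) <|
           split (1, 2, 0) (conv (1, 1, 0) [(2, 0), (1, 4)]) <|
           split (1, 2, 1) (conv (1, 1, 1) [(1, 0), (1, 2)]) <|
           split (1, 2, 2) (conv (1, 1, 1) [(1, 0), (1, 10)]) <|
           split (1, 2, 3) (height 0 10 11 halt) <|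
           facet 5 9 10) <|
          conv (1, 0, 2) [(2, 1), (1, 13)]) <|
         conv (1, 0, 1) [(1, 1), (1, 3)]) <|
        conv (1, -1, 1) [(3, 1), (1, 11)]) <|
       conv (1, -1, 0) [(1, 0), (1, 5)]) <|
      split (1, -1, 0) (prune (1, 0, 1) 0 2 5 <| split (1, -1, 1) (facet 0 9 1) <|
       split (1, 0, 2) (facet 0 9 1) <|
       split (1, 1, 3) (height 0 9 1 halt) <|
       facet 0 10 8) <|
      split (1, -1, 1) (height 0 8 5 halt) <|
      split (1, 0, 1) (split (1, 0, 2) (split (2, 1, 4) (prune (1, 1, 2) 0 4 7 <| prune (1, 1, 2) 0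
        12 6 <| leaf 10 ⟨(1, 0, 2), (1, 1, 2), (0, 0, -1), (-1, 0, -1)⟩) <|
        facet 0 9 1) <|
       split (2, 1, 4) (conv (1, 0, 2) [(1, 0), (1, 9)]) <|
       facet 0 8 5) <|
      split (1, 0, 2) (conv (1, 0, 1) [(1, 0), (1, 5)]) <|
      split (1, 1, 3) (split (2, 1, 4) (conv (1, 0, 1) [(1, 0), (2, 6), (1, 9)]) <|
       facet 0 8 5) <|
      split (2, 1, 4) (conv (1, 0, 1) [(1, 0), (2, 5), (1, 8)]) <|
      split (2, 3, 4) (prune (1, 1, 1) 0 2 5 <| leaf 10 ⟨(1, 2, 2), (1, 1, 2), (0, -1, -1), (-1, -1,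
        -1)⟩) <|
      facet 0 7 4) <|
     conv (1, 1, 2) [(1, 3), (1, 8)]) <|
    conv (0, 1, 2) [(1, 4), (1, 7)]) <|
   conv (0, 1, 1) [(2, 2), (1, 3), (1, 6)]) <|
  conv (0, 0, 1) [(1, 2), (2, 3), (1, 5)]⟩

lemma square124_check : square124.check = true := by decide +kernel

/-- A seed with base a triangle with three boundary points and a median point and top `(1, 0, 3)`.
-/
def kite103 : Seed := ⟨[(1, -1, 0), (-1, -1, 0), (0, 1, 0)], (1, 0, 3), 6,
  [((1, 0, 1), 0, 4, 2), ((0, -1, 1), 0, 1, 4), ((0, 0, 1), 1, 3, 4), ((0, 0, 1), 0, 2, 4), ((1, -1,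
    1), 0, 1, 4)],
  split (0, -1, 0) (split (0, 0, 1) (prune (0, 0, 1) 2 3 4 <| prune (0, 0, 1) 1 4 6 <| height 0 3 6
    halt) <|
   conv (0, 0, 1) [(1, 2), (1, 3), (1, 5)]) <|
  conv (0, -1, 0) [(1, 0), (1, 1)]⟩

lemma kite103_check : kite103.check = true := by decide +kernel

/-- A seed with base a triangle with three boundary points and a median point and top `(1, 2, 3)`.
-/
def kite123 : Seed := ⟨[(1, -1, 0), (-1, -1, 0), (0, 1, 0)], (1, 2, 3), 9,
  [((0, 1, 1), 1, 2, 4), ((0, 0, 1), 1, 4, 3), ((1, 1, 1), 0, 4, 2), ((0, 0, 1), 0, 2, 4)],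
  split (0, -1, 0) (split (0, 0, 1) (split (1, 0, 1) (split (1, 1, 2) (prune (0, 0, 1) 1 5 6 <|
    height 0 2 1 <| split (-2, -1, 0) (split (-1, 0, 0) (split (-1, 0, 1) (split (0, 1, 1) (split
    (0, 1, 2) (prune (0, 1, 1) 0 3 6 <| prune (0, 1, 1) 2 11 5 <| height 0 1 2 <| split (1, 0, 0)
    (prune (1, 1, 1) 0 1 12 <| split (1, 1, 0) (prune (1, 1, 1) 0 10 15 <| split (1, 2, 0) (leaf 2
    ⟨(1, 2, 0), (-1, -1, 0), (0, -1, 0), (0, 0, 1)⟩) <|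
             split (1, 2, 1) (facet 0 1 14) <|
             split (1, 2, 2) (height 0 1 14 halt) <|
             facet 0 13 15) <|
            split (1, 1, 1) (split (1, 2, 0) (conv (1, 1, 0) [(1, 0), (1, 2)]) <|
             split (1, 2, 1) (split (1, 2, 2) (prune (1, 1, 1) 0 1 6 <| height 1 3 15 halt) <|
              conv (1, 2, 2) [(1, 0), (1, 16)]) <|
             split (1, 2, 2) (prune (1, 1, 1) 0 14 3 <| height 0 1 14 halt) <|
             split (2, 0, 0) (prune (1, 1, 1) 0 3 14 <| height 0 1 16 halt) <|
             split (2, 1, 2) (height 0 2 1 halt) <|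
             split (2, 2, 3) (height 0 14 16 halt) <|
             facet 0 13 15) <|
            split (1, 2, 0) (conv (1, 1, 0) [(1, 0), (1, 1)]) <|
            split (1, 2, 1) (conv (1, 1, 1) [(1, 0), (1, 8)]) <|
            split (1, 2, 2) (conv (1, 1, 1) [(1, 0), (1, 1)]) <|
            split (2, 0, 0) (conv (1, 1, 1) [(1, 0), (1, 13), (1, 15)]) <|
            split (2, 0, 1) (height 0 1 13 halt) <|
            split (2, 1, 2) (conv (1, 1, 1) [(1, 0), (1, 13)]) <|
            split (2, 2, 3) (conv (1, 1, 1) [(1, 0), (1, 1), (1, 13)]) <|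
            facet 0 6 7) <|
           split (1, 1, 0) (conv (1, 0, 0) [(1, 0), (1, 10)]) <|
           split (1, 1, 1) (split (1, 2, 0) (conv (1, 0, 0) [(1, 0), (2, 11)]) <|
            split (1, 2, 1) (split (1, 2, 2) (prune (1, 1, 1) 0 1 5 <| height 1 12 14 halt) <|
             conv (1, 2, 2) [(1, 0), (1, 15)]) <|
            split (2, 0, 0) (conv (1, 0, 0) [(2, 0), (1, 5)]) <|
            split (2, 0, 1) (prune (1, 1, 1) 0 2 13 <| height 0 13 1 halt) <|
            split (2, 1, 2) (height 0 11 1 halt) <|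
            split (2, 3, 3) (height 0 1 13 halt) <|
            facet 0 10 12) <|
           split (1, 2, 0) (conv (1, 0, 0) [(1, 0), (2, 10)]) <|
           split (1, 2, 1) (conv (1, 1, 1) [(1, 0), (1, 7)]) <|
           split (1, 2, 2) (prune (1, 1, 1) 0 12 1 <| split (2, 0, 1) (conv (1, 1, 1) [(1, 0), (1,
             1), (1, 13)]) <|
            split (2, 1, 2) (conv (1, 1, 1) [(1, 0), (1, 13)]) <|
            split (2, 2, 3) (split (2, 3, 3) (conv (1, 1, 1) [(1, 0), (1, 12), (1, 14)]) <|
             facet 0 1 15) <|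
            split (2, 3, 3) (conv (1, 1, 1) [(1, 0), (1, 11), (1, 13)]) <|
            facet 0 6 7) <|
           split (2, 0, 0) (conv (1, 0, 0) [(2, 0), (1, 4)]) <|
           split (2, 0, 1) (height 0 10 12 halt) <|
           split (2, 1, 2) (conv (1, 1, 1) [(1, 0), (1, 12)]) <|
           split (2, 2, 3) (split (2, 3, 3) (conv (1, 1, 1) [(1, 0), (1, 11), (1, 13)]) <|
            facet 0 12 14) <|
           split (2, 3, 3) (conv (1, 1, 1) [(1, 0), (1, 10), (1, 12)]) <|
           facet 5 6 11) <|
          conv (0, 1, 2) [(1, 1), (1, 12)]) <|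
         conv (0, 1, 1) [(1, 0), (2, 9), (1, 11)]) <|
        conv (-1, 0, 1) [(2, 1), (1, 10)]) <|
       conv (-1, 0, 0) [(1, 0), (1, 7)]) <|
      split (-1, 0, 0) (prune (0, 1, 1) 0 7 1 <| split (-1, 0, 1) (facet 0 1 7) <|
       split (0, 1, 2) (height 0 1 7 halt) <|
       facet 0 6 9) <|
      split (-1, 0, 1) (split (0, 1, 2) (prune (0, 1, 1) 0 1 3 <| height 1 8 7 halt) <|
       conv (0, 1, 2) [(1, 0), (1, 9)]) <|
      split (0, 1, 1) (split (0, 1, 2) (prune (0, 1, 1) 0 7 2 <| height 0 1 7 halt) <|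
       split (0, 2, 0) (prune (0, 1, 1) 0 2 7 <| height 0 1 10 halt) <|
       split (1, 3, 2) (height 0 8 1 halt) <|
       split (1, 3, 3) (height 0 7 10 halt) <|
       facet 0 6 9) <|
      split (0, 1, 2) (conv (0, 1, 1) [(1, 0), (1, 7)]) <|
      split (0, 2, 0) (conv (0, 1, 1) [(1, 0), (1, 6), (1, 9)]) <|
      split (1, 3, 1) (split (1, 1, 1) (height 1 8 7 halt) <|
       conv (1, 1, 1) [(1, 0), (2, 2)]) <|
      split (1, 3, 2) (conv (0, 1, 1) [(1, 0), (1, 6)]) <|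
      split (1, 3, 3) (conv (0, 1, 1) [(1, 0), (1, 6), (1, 7)]) <|
      facet 5 8 6) <|
     conv (1, 1, 2) [(1, 0), (1, 7)]) <|
    conv (1, 0, 1) [(2, 2), (1, 6)]) <|
   conv (0, 0, 1) [(1, 0), (1, 2), (1, 5)]) <|
  conv (0, -1, 0) [(1, 0), (1, 1)]⟩

lemma kite123_check : kite123.check = true := by decide +kernel

/-- A seed with base a triangle with three boundary points and a median point and top `(1, 3, 4)`.
-/
def kite134 : Seed := ⟨[(1, -1, 0), (-1, -1, 0), (0, 1, 0)], (1, 3, 4), 7,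
  [((0, 1, 1), 0, 2, 4), ((0, 0, 1), 1, 4, 3), ((1, 1, 1), 0, 4, 2), ((0, 2, 2), 1, 2, 4), ((0, 0,
    1), 0, 2, 4), ((0, 1, 1), 1, 3, 4)],
  split (0, -1, 0) (split (0, 1, 1) (split (0, 1, 2) (split (1, 0, 1) (split (1, 1, 2) (split (1, 2,
    3) (prune (0, 0, 1) 2 7 4 <| prune (0, 1, 1) 0 7 8 <| prune (1, 2, 2) 2 10 8 <| height 3 4 7 <|
    split (1, 0, 0) (prune (1, 1, 1) 0 1 9 <| split (1, 1, 0) (split (1, 1, 1) (split (1, 2, 2)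
    (prune (1, 1, 1) 0 2 9 <| prune (1, 1, 1) 2 3 7 <| split (1, 2, 0) (split (1, 3, 0) (split (1,
    3, 1) (leaf 1 ⟨(1, 3, 0), (-1, -2, 0), (0, -1, 0), (0, 0, 1)⟩) <|
              conv (1, 3, 1) [(3, 0), (1, 16)]) <|
             split (1, 3, 1) (facet 0 1 14) <|
             split (1, 3, 2) (height 0 1 14 halt) <|
             split (1, 3, 3) (height 0 1 14 halt) <|
             facet 0 13 15) <|
            split (1, 2, 1) (split (1, 3, 0) (conv (1, 2, 0) [(1, 0), (1, 4)]) <|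
             split (1, 3, 1) (height 0 4 14 halt) <|
             split (1, 3, 2) (facet 0 1 14) <|
             facet 0 3 13) <|
            split (1, 3, 0) (conv (1, 2, 0) [(1, 0), (1, 3)]) <|
            split (1, 3, 1) (conv (1, 2, 1) [(1, 0), (1, 2)]) <|
            split (1, 3, 2) (conv (1, 2, 1) [(1, 0), (1, 3)]) <|
            split (1, 3, 3) (height 0 3 13 halt) <|
            facet 0 2 12) <|
           conv (1, 2, 2) [(1, 1), (1, 13)]) <|
          conv (1, 1, 1) [(1, 0), (1, 3)]) <|
         split (1, 1, 1) (split (1, 2, 0) (conv (1, 1, 0) [(1, 0), (1, 2)]) <|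
          split (1, 2, 1) (split (1, 3, 0) (conv (1, 1, 0) [(1, 0), (2, 3)]) <|
           split (1, 3, 1) (height 0 3 12 halt) <|
           facet 0 2 11) <|
          split (1, 2, 2) (split (1, 3, 0) (conv (1, 1, 0) [(1, 0), (2, 3)]) <|
           split (1, 3, 1) (conv (1, 2, 1) [(1, 0), (1, 2)]) <|
           split (1, 3, 2) (height 0 3 12 halt) <|
           split (1, 3, 3) (split (2, 1, 2) (facet 0 11 4) <|
            split (2, 2, 3) (height 0 11 4 halt) <|
            split (2, 3, 4) (height 0 11 4 halt) <|
            facet 0 4 1) <|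
           split (2, 3, 4) (facet 0 1 14) <|
           facet 0 11 13) <|
          split (1, 3, 0) (conv (1, 1, 0) [(1, 0), (2, 2)]) <|
          split (1, 3, 1) (conv (1, 2, 1) [(1, 0), (1, 1)]) <|
          split (1, 3, 2) (conv (1, 2, 2) [(1, 0), (1, 4)]) <|
          split (1, 3, 3) (conv (1, 2, 2) [(1, 0), (1, 1)]) <|
          split (2, 1, 2) (facet 0 9 2) <|
          split (2, 2, 3) (height 0 9 2 halt) <|
          split (2, 3, 4) (conv (1, 2, 2) [(1, 0), (1, 11)]) <|
          facet 0 2 1) <|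
         split (1, 2, 0) (conv (1, 1, 0) [(1, 0), (1, 1)]) <|
         split (1, 2, 1) (conv (1, 1, 1) [(1, 0), (1, 4)]) <|
         split (1, 2, 2) (conv (1, 1, 1) [(1, 0), (1, 1)]) <|
         split (1, 3, 0) (conv (1, 1, 0) [(1, 0), (2, 1)]) <|
         split (1, 3, 1) (conv (1, 1, 1) [(1, 0), (2, 4)]) <|
         split (1, 3, 2) (conv (1, 1, 1) [(1, 0), (1, 8)]) <|
         split (1, 3, 3) (conv (1, 1, 1) [(1, 0), (2, 1)]) <|
         split (2, 1, 2) (conv (1, 1, 1) [(1, 0), (1, 10)]) <|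
         split (2, 2, 3) (conv (1, 1, 1) [(1, 0), (1, 1), (1, 10)]) <|
         split (2, 3, 4) (conv (1, 1, 1) [(1, 0), (2, 1), (1, 10)]) <|
         facet 0 1 2) <|
        split (1, 1, 0) (conv (1, 0, 0) [(1, 0), (1, 7)]) <|
        split (1, 1, 1) (split (1, 2, 0) (conv (1, 0, 0) [(1, 0), (2, 8)]) <|
         split (1, 2, 1) (split (1, 3, 0) (conv (1, 0, 0) [(1, 0), (3, 9)]) <|
          split (1, 3, 1) (height 0 9 11 halt) <|
          facet 0 8 10) <|
         split (1, 3, 0) (conv (1, 0, 0) [(1, 0), (3, 8)]) <|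
         split (1, 3, 1) (conv (1, 2, 1) [(1, 0), (1, 1)]) <|
         split (1, 3, 2) (split (1, 3, 3) (prune (1, 2, 2) 0 1 8 <| facet 1 2 11) <|
          conv (1, 3, 3) [(1, 0), (1, 12)]) <|
         split (2, 1, 2) (split (3, 3, 4) (prune (1, 2, 2) 0 3 11 <| leaf 7 ⟨(1, 1, 2), (1, 1, 1),
           (0, -1, -1), (-1, 0, -1)⟩) <|
          facet 0 8 1) <|
         split (3, 3, 4) (conv (2, 1, 2) [(1, 0), (1, 8)]) <|
         facet 0 7 9) <|
        split (1, 2, 0) (conv (1, 0, 0) [(1, 0), (2, 7)]) <|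
        split (1, 2, 1) (conv (1, 1, 1) [(1, 0), (1, 3)]) <|
        split (1, 2, 2) (split (1, 3, 0) (conv (1, 0, 0) [(1, 0), (3, 8)]) <|
         split (1, 3, 1) (conv (1, 1, 1) [(1, 0), (2, 4)]) <|
         split (1, 3, 2) (conv (1, 1, 1) [(1, 0), (1, 8)]) <|
         split (2, 1, 2) (conv (1, 1, 1) [(1, 0), (1, 10)]) <|
         split (2, 2, 3) (split (3, 3, 4) (conv (1, 1, 1) [(1, 0), (1, 9), (2, 11)]) <|
          facet 0 8 10) <|
         split (2, 3, 4) (split (3, 3, 4) (conv (1, 1, 1) [(1, 0), (1, 9), (2, 11)]) <|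
          facet 0 8 1) <|
         split (3, 3, 4) (conv (1, 1, 1) [(1, 0), (1, 8), (2, 10)]) <|
         facet 0 7 9) <|
        split (1, 3, 0) (conv (1, 0, 0) [(1, 0), (3, 7)]) <|
        split (1, 3, 1) (conv (1, 1, 1) [(1, 0), (2, 3)]) <|
        split (1, 3, 2) (conv (1, 1, 1) [(1, 0), (1, 7)]) <|
        split (1, 3, 3) (prune (1, 2, 2) 0 9 1 <| split (2, 1, 2) (conv (1, 1, 1) [(1, 0), (1, 10)])
          <|
         split (2, 2, 3) (conv (1, 2, 2) [(1, 0), (1, 1), (1, 10)]) <|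
         split (2, 3, 4) (conv (1, 2, 2) [(1, 0), (1, 10)]) <|
         facet 0 1 2) <|
        split (2, 1, 2) (conv (1, 1, 1) [(1, 0), (1, 9)]) <|
        split (2, 2, 3) (split (3, 3, 4) (conv (1, 1, 1) [(1, 0), (1, 8), (2, 10)]) <|
         facet 0 7 9) <|
        split (2, 3, 4) (conv (1, 2, 2) [(1, 0), (1, 9)]) <|
        split (3, 3, 4) (conv (1, 1, 1) [(1, 0), (1, 7), (2, 9)]) <|
        facet 0 1 8) <|
       conv (1, 2, 3) [(1, 0), (1, 9)]) <|
      conv (1, 1, 2) [(2, 0), (1, 8)]) <|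
     conv (1, 0, 1) [(3, 3), (1, 7)]) <|
    conv (0, 1, 2) [(1, 3), (1, 6)]) <|
   conv (0, 1, 1) [(1, 2), (2, 3), (1, 5)]) <|
  conv (0, -1, 0) [(1, 0), (1, 1)]⟩

lemma kite134_check : kite134.check = true := by decide +kernel

/-- A seed with base a triangle with three boundary points and a median point and top `(2, 1, 4)`.
-/
def kite214 : Seed := ⟨[(1, -1, 0), (-1, -1, 0), (0, 1, 0)], (2, 1, 4), 5,
  [((0, 0, 1), 1, 3, 4), ((1, 0, 1), 0, 4, 3), ((0, -1, 1), 0, 1, 4), ((1, 0, 2), 1, 4, 2), ((0, 0,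
    1), 0, 2, 4), ((1, -1, 1), 0, 1, 4)],
  split (0, -1, 0) (split (0, 0, 1) (split (1, 0, 2) (split (1, 1, 2) (prune (1, 0, 2) 2 8 4 <|
    prune (0, 0, 1) 1 5 6 <| prune (1, 0, 1) 1 6 4 <| prune (1, 0, 1) 0 7 1 <| leaf 3 ⟨(1, -1, 0),
    (-1, 2, 0), (0, -1, 0), (1, -1, 1)⟩) <|
     conv (1, 1, 2) [(1, 5), (1, 7)]) <|
    conv (1, 0, 2) [(1, 1), (1, 6)]) <|
   conv (0, 0, 1) [(2, 2), (1, 3), (1, 5)]) <|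
  conv (0, -1, 0) [(1, 0), (1, 1)]⟩

lemma kite214_check : kite214.check = true := by decide +kernel

/-- A seed with base a triangle with three boundary points and a median point and top `(2, 3, 4)`.
-/
def kite234 : Seed := ⟨[(1, -1, 0), (-1, -1, 0), (0, 1, 0)], (2, 3, 4), 6,
  [((0, 1, 1), 1, 2, 4), ((0, 0, 1), 1, 4, 3), ((1, 1, 1), 0, 4, 2), ((0, 0, 1), 0, 2, 4), ((1, 2,
    2), 0, 4, 1)],
  split (0, -1, 0) (split (0, 0, 1) (split (1, 0, 1) (split (1, 1, 2) (split (1, 2, 2) (prune (0, 0,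
    1) 0 2 6 <| prune (1, 2, 2) 2 3 7 <| split (1, 0, 0) (prune (1, 1, 1) 0 2 8 <| split (2, -1, 0)
    (split (2, 0, 1) (split (2, 1, 2) (split (2, 2, 3) (split (-2, -1, 0) (split (-1, 0, 1) (prune
    (0, 1, 1) 0 14 2 <| leaf 1 ⟨(-2, -1, 0), (1, 1, 0), (1, 0, 0), (1, 1, 1)⟩) <|
             conv (-1, 0, 1) [(3, 0), (1, 15)]) <|
            split (-1, 0, 0) (prune (0, 1, 1) 0 13 1 <| split (-1, 0, 1) (facet 0 1 13) <|
             split (0, 1, 2) (height 0 1 13 halt) <|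
             split (1, 2, 3) (height 0 1 13 halt) <|
             facet 0 12 15) <|
            split (-1, 0, 1) (height 0 13 12 halt) <|
            split (0, 1, 1) (height 0 13 12 halt) <|
            split (0, 1, 2) (conv (0, 1, 1) [(1, 0), (1, 13)]) <|
            split (1, 2, 3) (split (1, 3, 3) (conv (0, 1, 1) [(1, 0), (1, 13), (1, 14)]) <|
             split (1, 3, 4) (conv (0, 1, 1) [(1, 0), (1, 13), (2, 14)]) <|
             facet 0 13 12) <|
            split (1, 3, 3) (conv (0, 1, 1) [(1, 0), (1, 12), (1, 13)]) <|
            split (1, 3, 4) (conv (0, 1, 1) [(1, 0), (1, 12), (2, 13)]) <|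
            facet 5 11 14) <|
           conv (2, 2, 3) [(1, 0), (1, 13)]) <|
          conv (2, 1, 2) [(2, 0), (1, 12)]) <|
         conv (2, 0, 1) [(3, 0), (1, 11)]) <|
        split (2, 0, 1) (facet 0 7 1) <|
        split (2, 1, 2) (facet 0 7 1) <|
        split (2, 2, 3) (height 0 7 1 halt) <|
        facet 0 10 6) <|
       split (1, 1, 1) (split (2, -1, 0) (conv (1, 0, 0) [(1, 0), (1, 9)]) <|
        split (2, 0, 1) (height 0 7 9 halt) <|
        split (2, 1, 2) (split (2, 2, 3) (split (2, 3, 3) (prune (1, 2, 2) 0 5 11 <| split (3, 3, 4)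
          (facet 0 1 14) <|
           facet 0 1 2) <|
          split (3, 3, 4) (prune (1, 2, 2) 0 5 11 <| split (1, 3, 4) (prune (0, 1, 1) 0 1 12 <| leaf
            7 ⟨(1, 1, 2), (0, 1, 1), (1, 1, 1), (-1, -1, -2)⟩) <|
           facet 0 4 13) <|
          facet 1 8 2) <|
         conv (2, 2, 3) [(1, 0), (1, 11)]) <|
        split (2, 3, 3) (split (2, 2, 3) (split (3, 3, 4) (conv (2, 1, 2) [(1, 0), (1, 9)]) <|
          facet 0 1 12) <|
         split (3, 3, 4) (conv (2, 1, 2) [(1, 0), (1, 8)]) <|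
         facet 0 11 7) <|
        split (3, 3, 4) (conv (2, 1, 2) [(1, 0), (1, 7)]) <|
        facet 0 6 8) <|
       split (2, -1, 0) (conv (1, 0, 0) [(1, 0), (1, 8)]) <|
       split (2, 0, 1) (conv (1, 1, 1) [(1, 0), (1, 1), (1, 8)]) <|
       split (2, 1, 2) (conv (1, 1, 1) [(1, 0), (1, 8)]) <|
       split (2, 2, 3) (split (2, 3, 3) (conv (1, 1, 1) [(1, 0), (1, 7), (1, 9)]) <|
        split (3, 3, 4) (conv (1, 1, 1) [(1, 0), (1, 7), (2, 9)]) <|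
        facet 0 6 8) <|
       split (2, 3, 3) (conv (1, 1, 1) [(1, 0), (1, 6), (1, 8)]) <|
       split (3, 3, 4) (conv (1, 1, 1) [(1, 0), (1, 6), (2, 8)]) <|
       facet 0 5 7) <|
      conv (1, 2, 2) [(1, 6), (1, 8)]) <|
     conv (1, 1, 2) [(1, 2), (1, 7)]) <|
    conv (1, 0, 1) [(1, 0), (3, 2), (1, 6)]) <|
   conv (0, 0, 1) [(1, 0), (2, 2), (1, 5)]) <|
  conv (0, -1, 0) [(1, 0), (1, 1)]⟩

lemma kite234_check : kite234.check = true := by decide +kernel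

/-- A seed with base a triangle with three boundary points and a median point and top `(2, 4, 5)`.
-/
def kite245 : Seed := ⟨[(1, -1, 0), (-1, -1, 0), (0, 1, 0)], (2, 4, 5), 7,
  [((0, 1, 1), 1, 2, 4), ((0, 0, 1), 1, 4, 3), ((1, 2, 2), 0, 4, 2), ((0, -1, 1), 0, 1, 4)],
  split (0, -1, 0) (split (0, 0, 1) (prune (1, 0, 1) 2 5 6 <| split (0, 1, 1) (split (0, 1, 2)
    (split (1, 3, 3) (split (1, 3, 4) (facet 0 10 1) <|
       facet 0 1 9) <|
      split (1, 3, 4) (height 0 9 7 halt) <|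
      facet 0 8 1) <|
     split (1, 3, 3) (split (1, 3, 4) (conv (0, 1, 2) [(1, 0), (1, 6)]) <|
      facet 0 5 8) <|
     split (1, 3, 4) (conv (0, 1, 2) [(1, 0), (1, 5)]) <|
     facet 0 4 7) <|
    split (0, 1, 2) (conv (0, 1, 1) [(1, 0), (1, 5)]) <|
    split (1, 3, 3) (conv (0, 1, 1) [(1, 0), (1, 4), (1, 5)]) <|
    split (1, 3, 4) (conv (0, 1, 1) [(1, 0), (1, 4), (2, 5)]) <|
    facet 3 6 4) <|
   conv (0, 0, 1) [(2, 0), (2, 2), (1, 5)]) <|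
  conv (0, -1, 0) [(1, 0), (1, 1)]⟩

lemma kite245_check : kite245.check = true := by decide +kernel

/-- A seed with base a triangle with three boundary points and a median point and top `(2, 5, 6)`.
-/
def kite256 : Seed := ⟨[(1, -1, 0), (-1, -1, 0), (0, 1, 0)], (2, 5, 6), 8,
  [((1, 0, 1), 0, 3, 4), ((1, 2, 2), 0, 4, 2), ((0, 2, 2), 1, 2, 4), ((0, 0, 1), 1, 4, 2), ((0, 1,
    1), 1, 3, 4), ((0, 1, 1), 0, 2, 4), ((1, 3, 3), 0, 4, 1)],
  split (0, -1, 0) (split (0, 1, 2) (split (1, 0, 1) (split (1, 2, 3) (split (1, 3, 3) (prune (0, 1,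
    1) 1 6 7 <| prune (0, 0, 1) 0 2 6 <| split (1, 0, 0) (split (2, -1, 0) (split (2, 0, 1) (split
    (2, 1, 2) (split (2, 2, 3) (leaf 0 ⟨(2, -1, 0), (-1, 1, 0), (-1, 0, 0), (0, 1, 1)⟩) <|
           conv (2, 2, 3) [(3, 0), (1, 13)]) <|
          conv (2, 1, 2) [(4, 0), (1, 12)]) <|
         conv (2, 0, 1) [(5, 0), (1, 11)]) <|
        split (2, 0, 1) (split (2, 1, 2) (split (2, 2, 3) (facet 2 9 3) <|
          conv (2, 2, 3) [(3, 0), (1, 12)]) <|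
         conv (2, 1, 2) [(4, 0), (1, 11)]) <|
        split (2, 1, 2) (split (2, 2, 3) (facet 1 8 2) <|
         conv (2, 2, 3) [(3, 0), (1, 11)]) <|
        split (2, 2, 3) (facet 0 7 1) <|
        split (2, 3, 4) (height 0 7 1 halt) <|
        split (2, 4, 5) (height 0 7 1 halt) <|
        facet 0 10 6) <|
       split (1, 1, 1) (split (2, -1, 0) (conv (1, 0, 0) [(1, 0), (1, 9)]) <|
        split (2, 0, 1) (split (2, 1, 2) (split (2, 2, 3) (height 2 9 11 halt) <|
          conv (2, 2, 3) [(3, 0), (1, 12)]) <|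
         conv (2, 1, 2) [(4, 0), (1, 11)]) <|
        split (2, 1, 2) (split (2, 2, 3) (facet 1 8 2) <|
         conv (2, 2, 3) [(3, 0), (1, 11)]) <|
        facet 0 6 8) <|
       split (1, 2, 2) (split (2, -1, 0) (conv (1, 0, 0) [(1, 0), (1, 9)]) <|
        split (2, 0, 1) (conv (1, 1, 1) [(1, 0), (1, 1), (1, 9)]) <|
        split (2, 1, 2) (conv (1, 1, 1) [(1, 0), (1, 9)]) <|
        split (2, 2, 3) (height 0 7 9 halt) <|
        split (2, 3, 4) (height 0 7 1 halt) <|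
        facet 0 6 8) <|
       split (2, -1, 0) (conv (1, 0, 0) [(1, 0), (1, 8)]) <|
       split (2, 0, 1) (conv (1, 1, 1) [(2, 0), (1, 1), (2, 8)]) <|
       split (2, 1, 2) (conv (1, 1, 1) [(1, 0), (1, 8)]) <|
       split (2, 2, 3) (conv (1, 2, 2) [(1, 0), (1, 1), (1, 8)]) <|
       split (2, 3, 4) (conv (1, 2, 2) [(1, 0), (1, 8)]) <|
       split (2, 4, 5) (height 0 6 8 halt) <|
       facet 0 5 7) <|
      conv (1, 3, 3) [(1, 6), (1, 8)]) <|
     conv (1, 2, 3) [(1, 2), (1, 7)]) <|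
    conv (1, 0, 1) [(1, 0), (6, 2), (1, 6)]) <|
   conv (0, 1, 2) [(2, 2), (1, 5)]) <|
  conv (0, -1, 0) [(1, 0), (1, 1)]⟩

lemma kite256_check : kite256.check = true := by decide +kernel

/-- A seed with base a triangle with three boundary points and a median point and top `(3, 7, 8)`.
-/
def kite378 : Seed := ⟨[(1, -1, 0), (-1, -1, 0), (0, 1, 0)], (3, 7, 8), 10,
  [((1, 3, 3), 2, 4, 3), ((1, 1, 1), 0, 4, 2), ((0, 0, 1), 1, 4, 3), ((0, 1, 1), 1, 3, 4), ((-1, -2,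
    1), 0, 1, 4), ((1, 3, 3), 0, 4, 1)],
  split (0, 1, 2) (split (1, 0, 1) (split (1, 1, 2) (split (1, 3, 3) (split (1, 3, 4) (split (2, 4,
    5) (split (2, 5, 6) (prune (0, 0, 1) 3 5 8 <| prune (1, 2, 2) 0 9 7 <| prune (1, 2, 2) 2 11 9 <|
    prune (0, 1, 1) 1 8 9 <| leaf 6 ⟨(-1, -1, 0), (1, 2, 2), (0, 0, -1), (0, -1, -1)⟩) <|
        conv (2, 5, 6) [(1, 1), (1, 10)]) <|
       conv (2, 4, 5) [(1, 2), (1, 9)]) <|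
      conv (1, 3, 4) [(2, 3), (1, 8)]) <|
     conv (1, 3, 3) [(1, 2), (3, 5), (2, 7)]) <|
    conv (1, 1, 2) [(6, 0), (2, 1), (1, 6)]) <|
   conv (1, 0, 1) [(2, 0), (9, 1), (1, 5)]) <|
  conv (0, 1, 2) [(3, 1), (1, 4)]⟩

lemma kite378_check : kite378.check = true := by decide +kernel

/-- A seed with base a unimodular triangle around the origin and top `(1, 0, 3)`. -/
def simplex103 : Seed := ⟨[(1, 0, 0), (0, 1, 0), (-1, -1, 0)], (1, 0, 3), 8,
  [((0, 0, 1), 0, 4, 2), ((0, -1, 1), 0, 2, 4), ((0, 0, 1), 0, 1, 4), ((1, 0, 1), 1, 2, 4), ((1, 1,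
    1), 0, 4, 1), ((1, -1, 1), 0, 2, 4), ((-2, 0, 1), 1, 4, 2), ((2, 1, 1), 0, 4, 1)],
  split (0, 0, 1) (split (1, 0, 1) (split (1, 0, 2) (prune (0, 0, 1) 0 5 4 <| prune (1, 0, 2) 4 5 7
    <| split (-1, 0, 0) (inside (0, 0, 1) [(1, 0), (1, 1), (1, 5), (1, 6), (1, 8)]) <|
     height 2 4 5 <| split (1, 1, 0) (prune (1, 1, 1) 0 1 5 <| split (1, 1, 1) (split (1, 1, 2)
       (prune (1, 1, 1) 0 7 3 <| split (1, 2, 0) (prune (1, 1, 1) 0 9 1 <| prune (1, 1, 1) 0 3 6 <|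
       split (1, 2, 1) (split (1, 3, 0) (split (-2, -3, 0) (split (-1, -2, 0) (split (-1, -2, 1)
       (split (0, -1, 0) (split (0, -1, 2) (prune (0, -1, 1) 0 10 3 <| prune (0, -1, 1) 1 2 5 <|
       leaf 2 ⟨(-2, -3, 0), (1, 2, 0), (1, 1, 0), (1, 1, 1)⟩) <|
               conv (0, -1, 2) [(1, 1), (1, 17)]) <|
              conv (0, -1, 0) [(1, 1), (1, 12)]) <|
             conv (-1, -2, 1) [(2, 1), (1, 15)]) <|
            conv (-1, -2, 0) [(2, 0), (1, 10)]) <|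
           split (-1, -2, 0) (split (0, -1, 0) (prune (0, -1, 1) 0 1 2 <| split (-1, -2, 1) (facet 0
             14 2) <|
             split (0, -1, 2) (height 0 14 2 halt) <|
             facet 1 15 13) <|
            conv (0, -1, 0) [(1, 0), (1, 10)]) <|
           split (-1, -2, 1) (split (0, -1, 2) (prune (0, -1, 1) 0 2 1 <| split (0, -1, 0) (height 0
             2 14 halt) <|
             facet 1 13 11) <|
            conv (0, -1, 2) [(1, 0), (1, 14)]) <|
           split (0, -2, 0) (split (0, -1, 1) (prune (0, -1, 1) 1 13 2 <| height 0 1 15 halt) <|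
            conv (0, -1, 1) [(1, 0), (1, 12), (1, 14)]) <|
           split (0, -2, 3) (split (0, -1, 1) (prune (0, -1, 1) 1 2 13 <| height 0 1 13 halt) <|
            conv (0, -1, 1) [(1, 0), (1, 10), (1, 12)]) <|
           split (0, -1, 0) (split (0, -1, 1) (height 0 13 1 halt) <|
            split (0, -1, 2) (conv (0, -1, 1) [(1, 0), (1, 1)]) <|
            split (1, -1, 1) (height 0 13 1 halt) <|
            split (1, -1, 2) (conv (0, -1, 1) [(1, 0), (1, 13)]) <|
            split (1, -1, 3) (conv (0, -1, 1) [(1, 0), (1, 1), (1, 13)]) <|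
            facet 0 14 12) <|
           split (0, -1, 1) (split (1, -1, 1) (height 0 1 13 halt) <|
            split (1, -1, 2) (height 0 1 11 halt) <|
            facet 0 12 10) <|
           split (0, -1, 2) (split (1, -1, 1) (conv (0, -1, 1) [(1, 0), (1, 1), (1, 13)]) <|
            split (1, -1, 2) (conv (0, -1, 1) [(1, 0), (1, 13)]) <|
            split (1, -1, 3) (height 0 1 13 halt) <|
            facet 0 7 14) <|
           split (1, -1, 1) (height 0 12 10 halt) <|
           split (1, -1, 2) (conv (0, -1, 1) [(1, 0), (1, 12)]) <|
           split (1, -1, 3) (height 0 14 12 halt) <|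
           facet 6 11 7) <|
          facet 0 1 9) <|
         split (1, 3, 0) (conv (1, 2, 1) [(1, 0), (1, 2)]) <|
         facet 0 8 1) <|
        split (1, 2, 1) (split (1, 3, 0) (conv (1, 2, 0) [(1, 0), (1, 4)]) <|
         facet 0 3 8) <|
        split (1, 3, 0) (conv (1, 2, 0) [(1, 0), (1, 3)]) <|
        split (2, 1, 1) (facet 0 7 3) <|
        split (2, 1, 2) (split (3, 1, 3) (height 0 8 4 halt) <|
         facet 0 7 3) <|
        split (2, 1, 3) (facet 0 1 11) <|
        split (3, 1, 3) (conv (2, 1, 2) [(1, 0), (1, 2)]) <|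
        facet 0 1 7) <|
       split (1, 2, 0) (prune (1, 1, 1) 0 2 5 <| split (1, 2, 1) (conv (1, 1, 2) [(1, 0), (1, 11)])
         <|
        split (1, 3, 0) (conv (1, 1, 2) [(1, 0), (2, 11)]) <|
        facet 0 7 10) <|
       split (1, 2, 1) (conv (1, 1, 2) [(1, 0), (1, 10)]) <|
       split (1, 3, 0) (conv (1, 1, 2) [(1, 0), (2, 10)]) <|
       split (2, 1, 2) (prune (1, 0, 1) 0 6 5 <| split (2, 1, 3) (height 0 8 11 halt) <|
        split (2, 2, 0) (height 0 2 1 <| split (2, 1, 1) (split (3, 1, 3) (prune (1, 0, 1) 0 9 2 <|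
          leaf 9 ⟨(2, 1, 1), (1, 0, 2), (0, 1, -1), (-1, -1, 0)⟩) <|
          facet 0 1 2) <|
         split (3, 1, 3) (conv (2, 1, 1) [(1, 0), (1, 1), (1, 8)]) <|
         facet 0 1 7) <|
        split (3, 1, 3) (facet 0 1 11) <|
        facet 0 1 10) <|
       split (2, 1, 3) (height 0 7 10 halt) <|
       split (2, 2, 0) (prune (1, 0, 2) 0 5 10 <| height 0 1 10 <| split (0, -2, 3) (prune (1, 0, 1)
         0 2 7 <| leaf 9 ⟨(0, -1, 1), (0, -1, 2), (-1, 0, -1), (1, 1, 0)⟩) <|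
        split (2, 1, 1) (split (3, 1, 3) (conv (2, 1, 2) [(1, 0), (1, 3)]) <|
         facet 0 1 11) <|
        split (3, 1, 3) (conv (2, 1, 1) [(1, 0), (1, 1), (1, 7)]) <|
        facet 0 3 4) <|
       split (3, 1, 3) (conv (2, 1, 2) [(1, 0), (1, 1)]) <|
       facet 0 6 9) <|
      split (1, 1, 2) (conv (1, 1, 1) [(1, 0), (1, 1)]) <|
      split (1, 2, 0) (conv (1, 1, 1) [(1, 0), (1, 2)]) <|
      split (1, 2, 1) (conv (1, 1, 1) [(1, 0), (1, 3)]) <|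
      split (1, 3, 0) (conv (1, 1, 1) [(1, 0), (1, 1), (2, 2)]) <|
      split (2, 1, 1) (split (2, 2, 0) (conv (1, 1, 1) [(1, 0), (1, 7), (1, 10)]) <|
       facet 0 5 1) <|
      split (2, 1, 2) (conv (1, 1, 1) [(1, 0), (1, 6)]) <|
      split (2, 1, 3) (conv (1, 1, 1) [(1, 0), (1, 1), (1, 6)]) <|
      split (2, 2, 0) (conv (1, 1, 1) [(1, 0), (1, 6), (1, 9)]) <|
      split (3, 1, 3) (conv (1, 1, 1) [(1, 0), (2, 6)]) <|
      facet 0 5 8) <|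
     split (1, 1, 1) (split (1, 2, 0) (conv (1, 1, 0) [(1, 0), (1, 5)]) <|
      split (1, 2, 1) (prune (1, 1, 1) 0 6 2 <| split (1, 3, 0) (conv (1, 1, 0) [(1, 0), (2, 6)]) <|
       facet 0 5 6) <|
      split (1, 3, 0) (conv (1, 1, 0) [(1, 0), (2, 5)]) <|
      split (2, 1, 1) (split (2, 2, 0) (conv (1, 1, 0) [(2, 0), (1, 8)]) <|
       facet 0 5 6) <|
      split (2, 1, 2) (prune (1, 0, 1) 0 5 4 <| split (2, 2, 0) (conv (1, 1, 0) [(2, 0), (1, 8)]) <|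
       split (2, 2, 3) (split (1, 1, 2) (split (2, 1, 3) (split (3, 1, 3) (prune (1, 0, 1) 0 9 2 <|
         leaf 9 ⟨(2, 1, 3), (1, 0, 0), (0, 1, 0), (-1, -1, -1)⟩) <|
          facet 0 2 12) <|
         split (3, 1, 3) (conv (2, 1, 3) [(1, 0), (1, 2), (1, 12)]) <|
         facet 1 11 2) <|
        conv (1, 1, 2) [(1, 0), (1, 5)]) <|
       split (3, 1, 3) (facet 0 6 1) <|
       facet 0 5 1) <|
      split (2, 2, 0) (conv (1, 1, 0) [(2, 0), (1, 7)]) <|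
      split (2, 2, 3) (split (1, 1, 2) (prune (1, 0, 1) 1 6 5 <| height 1 2 7 <| split (0, -2, 0)
        (prune (1, 0, 1) 0 1 7 <| leaf 9 ⟨(0, -1, 1), (0, -1, -1), (-1, 0, -1), (1, 1, 1)⟩) <|
        split (2, 1, 3) (split (3, 1, 3) (conv (2, 1, 2) [(1, 0), (1, 4)]) <|
         facet 0 2 11) <|
        split (3, 1, 3) (conv (2, 1, 2) [(1, 0), (1, 3)]) <|
        facet 1 3 4) <|
       conv (1, 1, 2) [(1, 0), (1, 4)]) <|
      split (3, 1, 3) (conv (2, 1, 2) [(1, 0), (1, 1)]) <|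
      facet 0 4 5) <|
     split (1, 1, 2) (prune (1, 1, 1) 0 5 1 <| split (1, 2, 0) (conv (1, 1, 0) [(1, 0), (1, 5)]) <|
      split (1, 2, 1) (conv (1, 1, 1) [(1, 0), (1, 3)]) <|
      split (1, 3, 0) (conv (1, 1, 0) [(1, 0), (2, 5)]) <|
      split (2, 1, 1) (conv (1, 1, 1) [(1, 0), (1, 1), (1, 6)]) <|
      split (2, 1, 2) (conv (1, 1, 1) [(1, 0), (1, 6)]) <|
      split (2, 1, 3) (split (2, 2, 3) (conv (1, 1, 1) [(1, 0), (1, 6), (1, 7)]) <|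
       facet 0 1 9) <|
      split (2, 2, 3) (conv (1, 1, 1) [(1, 0), (1, 5), (1, 6)]) <|
      split (3, 1, 3) (conv (1, 1, 1) [(1, 0), (2, 6)]) <|
      facet 0 4 5) <|
     split (1, 2, 0) (conv (1, 1, 0) [(1, 0), (1, 4)]) <|
     split (1, 2, 1) (conv (1, 1, 1) [(1, 0), (1, 2)]) <|
     split (1, 3, 0) (conv (1, 1, 0) [(1, 0), (2, 4)]) <|
     split (2, -1, 3) (split (0, -1, 1) (split (1, -1, 2) (prune (1, 0, 1) 0 5 6 <| prune (1, -1, 2)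
       2 6 10 <| split (0, -2, 0) (prune (0, -1, 1) 0 9 4 <| leaf 9 ⟨(1, -1, 1), (-1, -1, -1), (0,
       1, -1), (0, 0, 1)⟩) <|
        split (0, -2, 3) (prune (0, -1, 1) 0 4 9 <| leaf 9 ⟨(1, -1, 3), (-1, -1, 0), (0, 1, 0), (0,
          0, -1)⟩) <|
        split (0, -1, 2) (split (1, -1, 3) (facet 0 12 1) <|
         facet 0 3 11) <|
        split (1, -1, 3) (height 0 11 9 halt) <|
        facet 0 2 10) <|
       conv (1, -1, 2) [(1, 0), (1, 1)]) <|
      conv (0, -1, 1) [(1, 0), (2, 6)]) <|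
     split (2, 1, 1) (split (2, 2, 0) (conv (1, 1, 0) [(2, 0), (1, 7)]) <|
      facet 0 4 5) <|
     split (2, 1, 2) (conv (1, 1, 1) [(1, 0), (1, 5)]) <|
     split (2, 1, 3) (split (2, 2, 3) (conv (1, 1, 1) [(1, 0), (1, 5), (1, 6)]) <|
      facet 0 5 8) <|
     split (2, 2, 0) (conv (1, 1, 0) [(2, 0), (1, 6)]) <|
     split (2, 2, 3) (conv (1, 1, 1) [(1, 0), (1, 4), (1, 5)]) <|
     split (3, 1, 3) (conv (1, 1, 1) [(1, 0), (2, 5)]) <|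
     facet 0 1 4) <|
    conv (1, 0, 2) [(1, 0), (1, 6)]) <|
   conv (1, 0, 1) [(2, 1), (1, 5)]) <|
  conv (0, 0, 1) [(1, 1), (1, 2), (1, 4)]⟩

lemma simplex103_check : simplex103.check = true := by decide +kernel

/-- A seed with base a unimodular triangle around the origin and top `(1, 2, 3)`. -/
def simplex123 : Seed := ⟨[(1, 0, 0), (0, 1, 0), (-1, -1, 0)], (1, 2, 3), 9,
  [((0, 0, 1), 0, 2, 4), ((0, 1, 1), 1, 4, 2), ((1, 1, 1), 0, 4, 1)],
  split (0, 2, 0) (split (0, 1, 1) (prune (0, 1, 1) 1 6 2 <| prune (0, 1, 1) 1 2 4 <| height 0 1 4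
    halt) <|
   conv (0, 1, 1) [(1, 0), (1, 3), (1, 5)]) <|
  split (1, 1, 0) (split (1, 1, 1) (prune (1, 1, 1) 1 4 6 <| split (2, 2, 3) (inside (1, 1, 1) [(3,
    0), (1, 3), (1, 4), (3, 2), (1, 5)]) <|
    height 0 1 6 <| split (-2, -2, 0) (split (0, 0, 1) (prune (0, 0, 1) 1 8 2 <| prune (0, 0, 1) 1 5
      4 <| height 0 1 4 halt) <|
     conv (0, 0, 1) [(1, 0), (1, 3), (1, 7)]) <|
    split (-2, -1, 1) (prune (0, 0, 1) 0 7 2 <| height 0 5 3 <| split (-2, -1, 0) (facet 0 6 1) <|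
     split (-1, 0, 0) (height 0 6 1 halt) <|
     facet 0 4 5) <|
    split (-1, 0, 2) (split (0, 0, 1) (split (0, 1, 1) (prune (0, 1, 1) 2 6 3 <| prune (0, 0, 1) 2 3
      7 <| prune (0, 0, 1) 0 2 9 <| height 1 2 7 <| split (1, 2, 1) (facet 0 5 7) <|
       split (1, 2, 2) (height 0 5 7 halt) <|
       facet 4 6 9) <|
      conv (0, 1, 1) [(1, 1), (3, 5), (1, 8)]) <|
     conv (0, 0, 1) [(1, 0), (1, 3)]) <|
    split (0, -1, 0) (split (0, 0, 1) (prune (0, 0, 1) 1 6 2 <| height 0 1 8 <| split (1, -1, 0)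
      (split (1, 0, 1) (split (-2, -1, 0) (split (-1, 0, 0) (split (-1, 0, 1) (split (0, 1, 2)
      (prune (0, 1, 1) 0 2 9 <| split (1, 2, 0) (leaf 2 ⟨(1, 2, 0), (-1, -1, 0), (0, -1, 0), (0, 0,
      1)⟩) <|
            split (1, 2, 1) (facet 0 10 12) <|
            split (1, 2, 2) (height 0 10 12 halt) <|
            facet 9 11 14) <|
           conv (0, 1, 2) [(1, 0), (1, 13)]) <|
          conv (-1, 0, 1) [(2, 1), (1, 12)]) <|
         conv (-1, 0, 0) [(1, 0), (1, 8)]) <|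
        split (-1, 0, 0) (prune (0, 1, 1) 0 6 11 <| split (-1, 0, 1) (facet 0 1 10) <|
         split (0, 1, 2) (height 0 1 10 halt) <|
         facet 0 9 11) <|
        split (-1, 0, 1) (height 0 8 9 halt) <|
        split (0, 1, 1) (height 0 8 9 halt) <|
        split (0, 1, 2) (conv (0, 1, 1) [(1, 0), (1, 8)]) <|
        split (1, 3, 1) (height 0 8 9 halt) <|
        split (1, 3, 2) (conv (0, 1, 1) [(1, 0), (1, 9)]) <|
        split (1, 3, 3) (conv (0, 1, 1) [(1, 0), (1, 8), (1, 9)]) <|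
        facet 7 8 10) <|
       conv (1, 0, 1) [(2, 0), (1, 9)]) <|
      split (1, 0, 1) (facet 0 2 5) <|
      split (1, 1, 2) (height 0 2 5 halt) <|
      facet 1 4 8) <|
     conv (0, 0, 1) [(1, 0), (1, 5), (1, 7)]) <|
    split (0, 0, 1) (split (0, 1, 3) (split (0, 1, 1) (prune (0, 0, 1) 0 7 1 <| split (1, 1, 2)
      (facet 0 10 2) <|
       facet 1 5 9) <|
      conv (0, 1, 1) [(1, 0), (2, 5)]) <|
     split (1, -1, 0) (conv (0, -1, 0) [(1, 0), (1, 6)]) <|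
     split (1, 0, 1) (height 0 6 4 halt) <|
     split (1, 1, 2) (facet 0 1 4) <|
     facet 0 5 3) <|
    split (0, 1, 3) (conv (0, 0, 1) [(1, 0), (1, 3), (1, 5)]) <|
    split (1, -1, 0) (conv (0, -1, 0) [(1, 0), (1, 5)]) <|
    split (1, 0, 1) (conv (0, 0, 1) [(1, 0), (2, 5), (1, 7)]) <|
    split (1, 1, 2) (conv (0, 0, 1) [(1, 0), (1, 5)]) <|
    facet 2 6 4) <|
   conv (1, 1, 1) [(1, 0), (1, 1), (1, 5)]) <|
  split (1, 1, 1) (split (1, 2, 0) (conv (1, 1, 0) [(1, 0), (1, 2)]) <|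
   split (1, 2, 1) (split (1, 2, 2) (prune (1, 1, 1) 0 1 5 <| split (1, 3, 0) (conv (1, 1, 0) [(1,
     0), (2, 4)]) <|
     split (1, 3, 1) (prune (0, 1, 1) 0 8 6 <| split (1, 4, 0) (conv (1, 1, 0) [(1, 0), (3, 5)]) <|
      split (1, 4, 1) (split (0, 1, 1) (split (1, 3, 2) (prune (0, 1, 1) 2 4 9 <| height 0 1 11
        halt) <|
        conv (1, 3, 2) [(1, 1), (1, 10)]) <|
       conv (0, 1, 1) [(1, 0), (2, 7), (1, 9)]) <|
      split (1, 5, 0) (conv (0, 2, 0) [(1, 0), (1, 7)]) <|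
      facet 0 4 5) <|
     split (1, 4, 0) (conv (1, 1, 0) [(1, 0), (3, 4)]) <|
     split (1, 4, 1) (conv (1, 3, 1) [(1, 0), (1, 2)]) <|
     split (1, 5, 0) (conv (0, 2, 0) [(1, 0), (1, 6)]) <|
     facet 1 3 4) <|
    conv (1, 2, 2) [(1, 0), (1, 6)]) <|
   split (1, 2, 2) (prune (1, 1, 1) 0 3 4 <| split (1, 3, 0) (conv (1, 1, 0) [(1, 0), (2, 3)]) <|
    split (1, 3, 1) (conv (1, 2, 1) [(1, 0), (1, 2)]) <|
    split (1, 3, 2) (prune (1, 2, 2) 0 4 7 <| split (1, 4, 0) (conv (1, 1, 0) [(1, 0), (3, 4)]) <|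
     split (1, 4, 1) (conv (1, 2, 1) [(1, 0), (2, 3)]) <|
     split (1, 5, 0) (conv (0, 2, 0) [(1, 0), (1, 6)]) <|
     facet 0 3 4) <|
    split (1, 3, 3) (split (0, 1, 1) (prune (0, 1, 1) 1 3 5 <| prune (0, 1, 1) 1 6 2 <| split (-1,
      0, 0) (inside (0, 1, 1) [(1, 0), (1, 3), (1, 2), (1, 6), (1, 7)]) <|
      height 0 1 5 <| split (2, 2, 3) (split (0, 1, 3) (prune (0, 0, 1) 0 3 8 <| leaf 9 ⟨(1, 2, 3),
        (-1, -1, 0), (0, 1, 0), (0, -1, -1)⟩) <|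
       facet 0 2 9) <|
      facet 1 2 5) <|
     conv (0, 1, 1) [(1, 0), (1, 4), (1, 5)]) <|
    split (1, 4, 0) (conv (1, 1, 0) [(1, 0), (3, 3)]) <|
    split (1, 4, 1) (conv (1, 2, 1) [(1, 0), (2, 2)]) <|
    split (1, 5, 0) (conv (0, 2, 0) [(1, 0), (1, 5)]) <|
    split (2, -1, 0) (split (0, -1, 0) (split (1, -1, 0) (split (1, 0, 1) (height 4 7 10 halt) <|
       conv (1, 0, 1) [(2, 0), (1, 9)]) <|
      conv (1, -1, 0) [(1, 0), (1, 1)]) <|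
     conv (0, -1, 0) [(1, 0), (2, 5)]) <|
    split (2, 0, 1) (split (0, 0, 1) (height 1 3 2 <| split (0, -1, 0) (split (1, -1, 0) (facet 0 6
      3) <|
       facet 0 5 2) <|
      split (1, -1, 0) (conv (0, -1, 0) [(1, 0), (1, 7)]) <|
      facet 1 6 4) <|
     conv (0, 0, 1) [(1, 0), (4, 5), (2, 7)]) <|
    split (2, 1, 2) (split (2, 2, 3) (facet 0 2 8) <|
     facet 0 1 7) <|
    split (2, 2, 3) (split (0, 0, 1) (facet 1 2 8) <|
     conv (0, 0, 1) [(1, 0), (2, 5)]) <|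
    facet 0 1 3) <|
   split (1, 3, 0) (conv (1, 1, 0) [(1, 0), (2, 2)]) <|
   split (1, 3, 1) (conv (1, 2, 1) [(1, 0), (1, 1)]) <|
   split (1, 3, 2) (conv (1, 2, 2) [(1, 0), (1, 1), (1, 6)]) <|
   split (1, 3, 3) (conv (1, 2, 2) [(1, 0), (1, 1)]) <|
   split (1, 4, 0) (conv (1, 1, 0) [(1, 0), (3, 2)]) <|
   split (1, 4, 1) (conv (1, 2, 1) [(1, 0), (2, 1)]) <|
   split (1, 5, 0) (conv (0, 2, 0) [(1, 0), (1, 4)]) <|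
   split (2, 0, 0) (prune (1, 1, 1) 0 4 3 <| height 0 1 6 halt) <|
   split (2, 1, 2) (split (0, 0, 1) (split (2, 2, 3) (height 0 5 8 halt) <|
     split (3, 0, 1) (height 0 3 2 halt) <|
     split (4, -1, 0) (split (0, -1, 0) (conv (2, 0, 0) [(1, 1), (1, 6)]) <|
      conv (0, -1, 0) [(1, 0), (4, 6)]) <|
     facet 1 2 7) <|
    conv (0, 0, 1) [(1, 0), (3, 4), (1, 6)]) <|
   split (2, 2, 3) (split (0, 0, 1) (height 1 4 7 halt) <|
    conv (0, 0, 1) [(1, 0), (2, 4)]) <|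
   split (3, 0, 1) (split (0, 0, 1) (conv (2, 1, 2) [(1, 1), (1, 7)]) <|
    conv (0, 0, 1) [(1, 0), (6, 4), (3, 6)]) <|
   split (4, -1, 0) (split (0, -1, 0) (split (1, -1, 0) (conv (2, 0, 0) [(1, 2), (1, 5)]) <|
     conv (1, -1, 0) [(3, 0), (1, 1)]) <|
    conv (0, -1, 0) [(1, 0), (4, 4)]) <|
   facet 0 2 5) <|
  split (1, 2, 0) (conv (1, 1, 0) [(1, 0), (1, 1)]) <|
  split (1, 2, 1) (conv (1, 1, 1) [(1, 0), (2, 1), (1, 5)]) <|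
  split (1, 2, 2) (conv (1, 1, 1) [(1, 0), (1, 1)]) <|
  split (1, 3, 0) (conv (1, 1, 0) [(1, 0), (2, 1)]) <|
  split (1, 3, 1) (conv (1, 1, 1) [(1, 0), (4, 1), (2, 5)]) <|
  split (1, 3, 2) (conv (1, 1, 1) [(1, 0), (3, 1), (1, 5)]) <|
  split (1, 3, 3) (conv (1, 1, 1) [(1, 0), (2, 1)]) <|
  split (1, 4, 0) (conv (1, 1, 0) [(1, 0), (3, 1)]) <|
  split (1, 4, 1) (conv (1, 1, 1) [(1, 0), (6, 1), (3, 5)]) <|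
  split (1, 5, 0) (conv (0, 2, 0) [(1, 0), (1, 3)]) <|
  split (2, -1, 0) (split (0, -1, 0) (split (1, -1, 0) (split (1, 0, 1) (split (1, 1, 2) (prune (1,
    0, 1) 0 4 8 <| split (-2, -1, 0) (split (-1, 0, 1) (split (0, 1, 1) (split (0, 1, 2) (height 0 1
    2 halt) <|
          conv (0, 1, 2) [(1, 1), (1, 12)]) <|
         conv (0, 1, 1) [(1, 0), (2, 8), (1, 11)]) <|
        conv (-1, 0, 1) [(2, 0), (1, 10)]) <|
       split (-1, 0, 0) (split (0, 1, 1) (height 0 1 11 halt) <|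
        conv (0, 1, 1) [(1, 0), (1, 7), (1, 10)]) <|
       split (-1, 0, 1) (height 0 7 8 halt) <|
       split (0, 1, 1) (height 0 7 8 halt) <|
       split (0, 1, 2) (conv (0, 1, 1) [(1, 0), (1, 7)]) <|
       facet 6 7 9) <|
      conv (1, 1, 2) [(1, 0), (1, 8)]) <|
     conv (1, 0, 1) [(2, 0), (1, 7)]) <|
    conv (1, -1, 0) [(1, 0), (1, 1)]) <|
   conv (0, -1, 0) [(1, 0), (2, 3)]) <|
  split (2, 0, 0) (conv (1, 1, 1) [(1, 0), (1, 2), (1, 5)]) <|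
  split (2, 0, 1) (split (0, 0, 1) (split (2, 1, 2) (conv (1, 1, 1) [(1, 0), (1, 4)]) <|
    split (2, 2, 3) (conv (1, 1, 1) [(1, 0), (1, 2), (2, 4)]) <|
    split (3, -1, 0) (split (0, -1, 0) (split (1, -1, 0) (conv (2, -1, 0) [(1, 0), (1, 2)]) <|
      conv (1, -1, 0) [(2, 0), (1, 1)]) <|
     conv (0, -1, 0) [(1, 0), (3, 5)]) <|
    split (3, 0, 1) (conv (1, 1, 1) [(1, 0), (2, 4), (1, 7)]) <|
    split (4, -1, 0) (conv (1, 1, 1) [(1, 0), (3, 4), (2, 7)]) <|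
    facet 1 2 3) <|
   conv (0, 0, 1) [(1, 0), (4, 3), (2, 5)]) <|
  split (2, 1, 2) (conv (1, 1, 1) [(1, 0), (1, 2)]) <|
  split (2, 2, 3) (conv (1, 1, 1) [(1, 0), (1, 1), (1, 2)]) <|
  split (3, -1, 0) (split (0, -1, 0) (split (1, -1, 0) (conv (2, -1, 0) [(1, 0), (1, 2)]) <|
    conv (1, -1, 0) [(2, 0), (1, 1)]) <|
   conv (0, -1, 0) [(1, 0), (3, 3)]) <|
  split (3, 0, 1) (conv (1, 1, 1) [(1, 0), (2, 2), (1, 5)]) <|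
  split (4, -1, 0) (split (0, -1, 0) (conv (1, 1, 1) [(1, 1), (3, 3), (2, 6)]) <|
   conv (0, -1, 0) [(1, 0), (4, 3)]) <|
  facet 0 1 4⟩

lemma simplex123_check : simplex123.check = true := by decide +kernel

/-- A seed with base a unimodular triangle around the origin and top `(1, 2, 4)`. -/
def simplex124 : Seed := ⟨[(1, 0, 0), (0, 1, 0), (-1, -1, 0)], (1, 2, 4), 7,
  [((0, 1, 1), 1, 4, 2), ((0, 0, 1), 2, 4, 3), ((1, 1, 1), 0, 4, 1), ((0, 0, 1), 0, 1, 4)],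
  split (0, 0, 1) (split (1, 1, 2) (prune (0, 0, 1) 2 4 3 <| prune (0, 0, 1) 2 5 6 <| prune (0, 0,
    1) 0 5 3 <| height 0 1 2 <| split (-3, -2, 0) (split (-2, -1, 0) (split (-2, -1, 1) (split (-1,
    0, 2) (split (0, 1, 3) (prune (-1, 0, 1) 0 3 7 <| split (1, 1, 0) (prune (1, 1, 1) 0 8 1 <|
    split (1, 2, 0) (split (1, 2, 1) (leaf 1 ⟨(1, 2, 0), (0, -1, 0), (-1, -1, 0), (0, 0, 1)⟩) <|
           conv (1, 2, 1) [(3, 0), (1, 13)]) <|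
          split (1, 2, 1) (facet 0 1 10) <|
          split (1, 2, 2) (height 0 1 10 halt) <|
          split (1, 2, 3) (height 0 1 10 halt) <|
          facet 0 9 12) <|
         split (1, 1, 1) (split (1, 2, 0) (conv (1, 1, 0) [(1, 0), (1, 9)]) <|
          split (1, 2, 1) (height 0 9 10 halt) <|
          split (1, 2, 2) (height 0 1 10 halt) <|
          split (2, 2, 3) (height 0 1 10 halt) <|
          split (2, 3, 4) (conv (1, 2, 2) [(1, 0), (1, 10)]) <|
          facet 0 8 9) <|
         split (1, 2, 0) (conv (1, 1, 0) [(1, 0), (1, 8)]) <|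
         split (1, 2, 1) (conv (1, 1, 1) [(1, 0), (1, 6), (1, 8)]) <|
         split (1, 2, 2) (conv (1, 1, 1) [(1, 0), (1, 8)]) <|
         split (1, 2, 3) (split (2, 2, 3) (conv (1, 1, 1) [(1, 0), (1, 9), (1, 10)]) <|
          split (2, 3, 4) (conv (1, 1, 1) [(1, 0), (2, 9), (1, 10)]) <|
          facet 0 6 8) <|
         split (2, 2, 3) (conv (1, 1, 1) [(1, 0), (1, 8), (1, 9)]) <|
         split (2, 3, 4) (conv (1, 1, 1) [(1, 0), (2, 8), (1, 9)]) <|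
         facet 5 7 8) <|
        conv (0, 1, 3) [(1, 0), (1, 10)]) <|
       conv (-1, 0, 2) [(2, 0), (1, 9)]) <|
      conv (-2, -1, 1) [(3, 1), (1, 8)]) <|
     conv (-2, -1, 0) [(2, 0), (1, 4)]) <|
    split (-2, -1, 0) (split (-1, 0, 0) (split (-2, -1, 1) (facet 0 2 7) <|
      split (-1, 0, 2) (facet 0 2 7) <|
      split (0, 1, 3) (height 0 2 7 halt) <|
      facet 1 6 8) <|
     conv (-1, 0, 0) [(1, 0), (1, 4)]) <|
    split (-2, -1, 1) (split (-1, 0, 2) (split (-1, 0, 0) (height 0 7 2 halt) <|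
      facet 1 5 6) <|
     conv (-1, 0, 2) [(2, 0), (1, 7)]) <|
    split (-1, 0, 0) (split (0, 1, 2) (prune (0, 1, 1) 1 5 2 <| split (-1, 0, 1) (split (-1, 0, 2)
      (facet 0 1 8) <|
       facet 0 2 7) <|
      split (-1, 0, 2) (conv (-1, 0, 1) [(1, 0), (1, 2)]) <|
      split (0, 1, 3) (height 0 2 7 halt) <|
      facet 0 1 6) <|
     conv (0, 1, 2) [(1, 0), (1, 7)]) <|
    split (-1, 0, 1) (height 0 4 5 halt) <|
    split (-1, 0, 2) (height 0 4 5 halt) <|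
    split (0, 1, 1) (split (0, 1, 2) (split (0, 1, 3) (split (1, 3, 2) (split (1, 3, 3) (split (1,
      3, 4) (facet 0 3 12) <|
         facet 0 2 11) <|
        split (1, 3, 4) (conv (1, 3, 3) [(1, 0), (1, 1)]) <|
        facet 0 1 10) <|
       split (1, 3, 3) (split (1, 1, 1) (split (1, 3, 4) (facet 0 3 12) <|
         facet 1 2 11) <|
        conv (1, 1, 1) [(1, 0), (2, 6)]) <|
       split (1, 3, 4) (facet 0 1 10) <|
       facet 0 1 7) <|
      split (1, 3, 4) (facet 0 1 9) <|
      facet 0 6 8) <|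
     split (0, 1, 3) (conv (0, 1, 2) [(1, 0), (1, 1)]) <|
     split (1, 3, 2) (split (1, 3, 3) (split (1, 3, 4) (conv (0, 1, 2) [(1, 0), (1, 8)]) <|
       facet 0 7 9) <|
      split (1, 3, 4) (conv (0, 1, 2) [(1, 0), (1, 7)]) <|
      facet 0 1 8) <|
     split (1, 3, 3) (split (1, 1, 1) (split (1, 3, 4) (conv (0, 1, 2) [(1, 0), (1, 8)]) <|
       facet 1 7 9) <|
      conv (1, 1, 1) [(1, 0), (2, 4)]) <|
     split (1, 3, 4) (conv (0, 1, 2) [(1, 0), (1, 6)]) <|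
     facet 0 5 7) <|
    split (0, 1, 2) (conv (0, 1, 1) [(1, 0), (1, 4)]) <|
    split (0, 1, 3) (conv (0, 1, 1) [(1, 0), (2, 4)]) <|
    split (1, 3, 2) (conv (0, 1, 1) [(1, 0), (1, 5)]) <|
    split (1, 3, 3) (conv (0, 1, 1) [(1, 0), (1, 4), (1, 5)]) <|
    split (1, 3, 4) (conv (0, 1, 1) [(1, 0), (2, 4), (1, 5)]) <|
    facet 3 4 6) <|
   conv (1, 1, 2) [(1, 1), (1, 5)]) <|
  conv (0, 0, 1) [(1, 0), (2, 2), (1, 4)]⟩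

lemma simplex124_check : simplex124.check = true := by decide +kernel

/-- A seed with base a unimodular triangle around the origin and top `(1, 3, 5)`. -/
def simplex135 : Seed := ⟨[(1, 0, 0), (0, 1, 0), (-1, -1, 0)], (1, 3, 5), 6,
  [((0, 0, 1), 0, 2, 4), ((0, 1, 2), 2, 3, 4), ((1, 1, 1), 0, 4, 1), ((-1, 0, 1), 1, 4, 2)],
  split (0, 1, 1) (split (0, 1, 2) (prune (0, 1, 1) 3 6 5 <| prune (1, 2, 3) 2 6 3 <| prune (0, 1,
    1) 2 4 3 <| split (0, 0, 1) (split (0, 1, 3) (prune (0, 0, 1) 0 2 6 <| split (1, 1, 2) (split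
    (1, 2, 4) (facet 0 10 2) <|
       facet 0 9 1) <|
      split (1, 2, 4) (conv (1, 1, 2) [(1, 0), (1, 5)]) <|
      facet 0 4 8) <|
     split (1, 1, 2) (split (1, 2, 4) (facet 0 9 7) <|
      split (2, 0, 0) (prune (1, 2, 3) 0 9 2 <| leaf 4 ⟨(2, 0, 0), (-1, 3, 5), (0, -1, -2), (0, -2,
        -3)⟩) <|
      facet 0 8 1) <|
     split (1, 2, 4) (conv (1, 1, 2) [(1, 0), (1, 4)]) <|
     split (2, 0, 0) (conv (1, 1, 2) [(1, 0), (1, 1), (1, 8)]) <|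
     facet 0 7 5) <|
    split (0, 1, 3) (conv (0, 0, 1) [(1, 0), (1, 3), (1, 5)]) <|
    split (1, 1, 2) (conv (0, 0, 1) [(1, 0), (1, 5)]) <|
    split (1, 2, 4) (conv (0, 0, 1) [(1, 0), (1, 3), (2, 5)]) <|
    split (2, 0, 0) (conv (0, 0, 1) [(1, 0), (3, 5), (1, 7)]) <|
    facet 2 6 4) <|
   conv (0, 1, 2) [(1, 0), (1, 3), (1, 5)]) <|
  conv (0, 1, 1) [(3, 1), (1, 2), (1, 4)]⟩

lemma simplex135_check : simplex135.check = true := by decide +kernel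

/-- A seed with base a unimodular triangle around the origin and top `(1, 3, 6)`. -/
def simplex136 : Seed := ⟨[(1, 0, 0), (0, 1, 0), (-1, -1, 0)], (1, 3, 6), 6,
  [((0, 1, 1), 1, 4, 3), ((0, 0, 1), 2, 4, 3), ((1, 1, 1), 0, 4, 1), ((0, 1, 2), 0, 4, 2), ((0, 0,
    1), 0, 1, 4)],
  split (0, 1, 1) (split (0, 1, 2) (split (0, 1, 3) (split (1, 1, 2) (split (1, 2, 4) (prune (0, 0,
    1) 3 5 7 <| prune (0, 1, 1) 0 7 6 <| prune (1, 2, 3) 1 9 6 <| split (1, 1, 0) (split (1, 1, 1)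
    (split (1, 2, 3) (prune (1, 1, 1) 2 8 5 <| split (1, 2, 0) (split (1, 3, 0) (split (1, 3, 1)
    (split (1, 3, 2) (split (1, 3, 3) (leaf 0 ⟨(1, 3, 0), (-1, -2, 0), (0, -1, 0), (0, 0, 1)⟩) <|
              conv (1, 3, 3) [(3, 0), (1, 16)]) <|
             conv (1, 3, 2) [(4, 0), (1, 15)]) <|
            conv (1, 3, 1) [(5, 0), (1, 14)]) <|
           split (1, 3, 1) (split (1, 3, 2) (split (1, 3, 3) (facet 2 3 13) <|
             conv (1, 3, 3) [(3, 0), (1, 15)]) <|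
            conv (1, 3, 2) [(4, 0), (1, 14)]) <|
           split (1, 3, 2) (split (1, 3, 3) (facet 1 2 12) <|
            conv (1, 3, 3) [(3, 0), (1, 14)]) <|
           split (1, 3, 3) (facet 0 1 11) <|
           split (1, 3, 4) (height 0 1 11 halt) <|
           split (1, 3, 5) (height 0 1 11 halt) <|
           facet 0 10 13) <|
          split (1, 2, 1) (split (1, 3, 0) (conv (1, 2, 0) [(1, 0), (1, 4)]) <|
           split (1, 3, 1) (split (1, 3, 2) (split (1, 3, 3) (height 2 6 13 halt) <|
             conv (1, 3, 3) [(3, 0), (1, 15)]) <|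
            conv (1, 3, 2) [(4, 0), (1, 14)]) <|
           split (1, 3, 2) (split (1, 3, 3) (facet 1 2 12) <|
            conv (1, 3, 3) [(3, 0), (1, 14)]) <|
           facet 0 3 10) <|
          split (1, 2, 2) (split (1, 3, 0) (conv (1, 2, 0) [(1, 0), (1, 4)]) <|
           split (1, 3, 1) (conv (1, 2, 1) [(1, 0), (1, 3)]) <|
           split (1, 3, 2) (conv (1, 2, 1) [(1, 0), (1, 4)]) <|
           split (1, 3, 3) (facet 0 4 11) <|
           split (1, 3, 4) (facet 0 1 11) <|
           facet 0 3 10) <|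
          split (1, 3, 0) (conv (1, 2, 0) [(1, 0), (1, 3)]) <|
          split (1, 3, 1) (conv (1, 2, 1) [(1, 0), (1, 2)]) <|
          split (1, 3, 2) (conv (1, 2, 1) [(1, 0), (1, 3)]) <|
          split (1, 3, 3) (conv (1, 2, 2) [(1, 0), (1, 2)]) <|
          split (1, 3, 4) (conv (1, 2, 2) [(1, 0), (1, 3)]) <|
          split (1, 3, 5) (height 0 3 10 halt) <|
          facet 0 2 9) <|
         conv (1, 2, 3) [(1, 1), (1, 11)]) <|
        conv (1, 1, 1) [(1, 0), (1, 2)]) <|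
       split (1, 1, 1) (split (1, 2, 0) (conv (1, 1, 0) [(1, 0), (1, 7)]) <|
        split (1, 2, 1) (split (1, 3, 0) (conv (1, 1, 0) [(1, 0), (2, 8)]) <|
         split (1, 3, 1) (split (1, 3, 2) (split (1, 3, 3) (height 2 10 11 halt) <|
           conv (1, 3, 3) [(3, 0), (1, 13)]) <|
          conv (1, 3, 2) [(4, 0), (1, 12)]) <|
         facet 0 7 8) <|
        split (1, 2, 2) (prune (1, 2, 3) 0 4 11 <| split (1, 3, 0) (conv (1, 1, 0) [(1, 0), (2, 8)])
          <|
         split (1, 3, 1) (conv (1, 2, 1) [(1, 0), (1, 2)]) <|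
         split (1, 3, 2) (split (1, 3, 3) (height 1 9 10 halt) <|
          conv (1, 3, 3) [(3, 0), (1, 12)]) <|
         split (1, 3, 3) (facet 0 1 9) <|
         facet 0 1 8) <|
        split (1, 3, 0) (conv (1, 1, 0) [(1, 0), (2, 7)]) <|
        split (1, 3, 1) (conv (1, 2, 1) [(1, 0), (1, 1)]) <|
        split (1, 3, 2) (conv (1, 2, 2) [(1, 0), (1, 3)]) <|
        split (1, 3, 3) (conv (1, 2, 2) [(1, 0), (1, 1)]) <|
        split (2, 2, 3) (prune (1, 2, 3) 0 2 8 <| leaf 8 ⟨(1, 1, 2), (-1, -1, -1), (0, 1, 2), (0, 0,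
          -1)⟩) <|
        facet 0 6 7) <|
       split (1, 2, 0) (conv (1, 1, 0) [(1, 0), (1, 6)]) <|
       split (1, 2, 1) (conv (1, 1, 1) [(2, 0), (1, 1), (3, 6)]) <|
       split (1, 2, 2) (conv (1, 1, 1) [(1, 0), (1, 6)]) <|
       split (1, 2, 3) (split (1, 3, 0) (conv (1, 1, 0) [(1, 0), (2, 7)]) <|
        split (1, 3, 1) (conv (1, 1, 1) [(1, 0), (2, 1), (4, 7)]) <|
        split (1, 3, 2) (conv (1, 1, 1) [(1, 0), (1, 1), (3, 7)]) <|
        split (1, 3, 3) (conv (1, 1, 1) [(1, 0), (2, 7)]) <|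
        split (1, 3, 4) (split (1, 3, 5) (prune (1, 2, 3) 0 1 11 <| height 1 8 9 halt) <|
         conv (1, 3, 5) [(1, 0), (1, 11)]) <|
        split (2, 2, 3) (conv (1, 1, 1) [(1, 0), (1, 7), (1, 8)]) <|
        facet 0 6 7) <|
       split (1, 3, 0) (conv (1, 1, 0) [(1, 0), (2, 6)]) <|
       split (1, 3, 1) (conv (1, 1, 1) [(1, 0), (1, 1), (3, 6)]) <|
       split (1, 3, 2) (conv (1, 1, 1) [(2, 0), (1, 1), (5, 6)]) <|
       split (1, 3, 3) (conv (1, 1, 1) [(1, 0), (2, 6)]) <|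
       split (1, 3, 4) (conv (1, 2, 3) [(1, 0), (1, 2)]) <|
       split (1, 3, 5) (prune (1, 2, 3) 0 7 1 <| height 0 6 7 halt) <|
       split (2, 2, 3) (conv (1, 1, 1) [(1, 0), (1, 6), (1, 7)]) <|
       facet 0 1 6) <|
      conv (1, 2, 4) [(1, 0), (1, 8)]) <|
     conv (1, 1, 2) [(2, 3), (1, 7)]) <|
    conv (0, 1, 3) [(1, 4), (1, 6)]) <|
   conv (0, 1, 2) [(2, 0), (1, 3), (1, 5)]) <|
  conv (0, 1, 1) [(4, 1), (1, 2), (1, 4)]⟩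

lemma simplex136_check : simplex136.check = true := by decide +kernel

/-- A seed with base a unimodular triangle around the origin and top `(2, 5, 9)`. -/
def simplex259 : Seed := ⟨[(1, 0, 0), (0, 1, 0), (-1, -1, 0)], (2, 5, 9), 8,
  [((1, 1, 2), 0, 3, 4), ((0, 1, 2), 2, 3, 4), ((1, 1, 1), 0, 4, 1), ((-1, 0, 1), 1, 4, 2), ((0, 0,
    1), 1, 2, 4)],
  split (0, 1, 1) (split (0, 1, 3) (split (1, 1, 2) (split (1, 2, 4) (split (1, 3, 5) (split (1, 3,
    6) (prune (0, 1, 1) 2 8 7 <| prune (1, 2, 3) 3 10 7 <| prune (0, 0, 1) 1 6 8 <| prune (0, 1, 1)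
    0 3 7 <| prune (1, 2, 3) 0 7 6 <| prune (1, 2, 3) 4 6 10 <| leaf 5 ⟨(-1, -1, 0), (1, 2, 3), (0,
    0, -1), (0, -1, -2)⟩) <|
       conv (1, 3, 6) [(1, 3), (1, 9)]) <|
      conv (1, 3, 5) [(1, 3), (1, 8)]) <|
     conv (1, 2, 4) [(2, 0), (1, 1), (1, 7)]) <|
    conv (1, 1, 2) [(1, 0), (4, 2), (1, 6)]) <|
   conv (0, 1, 3) [(2, 3), (1, 5)]) <|
  conv (0, 1, 1) [(6, 1), (2, 2), (1, 4)]⟩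

lemma simplex259_check : simplex259.check = true := by decide +kernel

namespace Frame

/-- The linear part of an affine map. -/
def lin (φ : Frame) (p : Pt) : Pt :=
  (p.1 * φ.c₁.1 + p.2.1 * φ.c₂.1 + p.2.2 * φ.c₃.1,
   p.1 * φ.c₁.2.1 + p.2.1 * φ.c₂.2.1 + p.2.2 * φ.c₃.2.1,
   p.1 * φ.c₁.2.2 + p.2.1 * φ.c₂.2.2 + p.2.2 * φ.c₃.2.2)

/-- The composition of affine maps. -/
def comp (φ ψ : Frame) : Frame := ⟨φ.app ψ.o, φ.lin ψ.c₁, φ.lin ψ.c₂, φ.lin ψ.c₃⟩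

lemma app_comp (φ ψ : Frame) (p : Pt) : (φ.comp ψ).app p = φ.app (ψ.app p) := by
  simp only [app, comp, lin, Prod.mk.injEq]
  refine ⟨?_, ?_, ?_⟩ <;> ring

lemma det_comp (φ ψ : Frame) : (φ.comp ψ).det = φ.det * ψ.det := by
  simp only [det, comp, lin, dot, cross]; ring

/-- The inverse of a unimodular affine map. -/
def back (φ : Frame) (y : Pt) : Pt :=
  (φ.det * dot (cross φ.c₂ φ.c₃) (sub y φ.o), φ.det * dot (cross φ.c₃ φ.c₁) (sub y φ.o),
    φ.det * dot (cross φ.c₁ φ.c₂) (sub y φ.o))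

lemma app_back {φ : Frame} (h : φ.det * φ.det = 1) (y : Pt) : φ.app (φ.back y) = y := by
  obtain ⟨⟨o₁, o₂, o₃⟩, ⟨a₁, a₂, a₃⟩, ⟨b₁, b₂, b₃⟩, c₁, c₂, c₃⟩ := φ
  obtain ⟨y₁, y₂, y₃⟩ := y
  simp only [app, back, det, dot, cross, sub, Prod.mk.injEq] at *
  refine ⟨?_, ?_, ?_⟩
  · linear_combination (y₁ - o₁) * h
  · linear_combination (y₂ - o₂) * h
  · linear_combination (y₃ - o₃) * h

lemma back_app {φ : Frame} (h : φ.det * φ.det = 1) (x : Pt) : φ.back (φ.app x) = x := by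
  obtain ⟨⟨o₁, o₂, o₃⟩, ⟨a₁, a₂, a₃⟩, ⟨b₁, b₂, b₃⟩, c₁, c₂, c₃⟩ := φ
  obtain ⟨x₁, x₂, x₃⟩ := x
  simp only [app, back, det, dot, cross, sub, Prod.mk.injEq] at *
  refine ⟨?_, ?_, ?_⟩
  · linear_combination x₁ * h
  · linear_combination x₂ * h
  · linear_combination x₃ * h

/-- The inequality in the new coordinates. -/
def pull (φ : Frame) (f : Pt × ℤ) : Pt × ℤ :=
  ((dot f.1 φ.c₁, dot f.1 φ.c₂, dot f.1 φ.c₃), f.2 - dot f.1 φ.o)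

lemma dot_pull (φ : Frame) (f : Pt × ℤ) (x : Pt) :
    dot (φ.pull f).1 x = dot f.1 (φ.app x) - dot f.1 φ.o := by
  simp only [dot, pull, app]; ring

lemma slack_pull (φ : Frame) (f : Pt × ℤ) (x : Pt) :
    (φ.pull f).2 - dot (φ.pull f).1 x = f.2 - dot f.1 (φ.app x) := by
  rw [dot_pull]; simp [pull]

end Frame

/-- The image of a body in new coordinates is a body. -/
lemma IsBody.comap {V : Set Pt} {F : Set (Pt × ℤ)} (B : IsBody V F) {φ : Frame}
    (h : φ.det * φ.det = 1) : IsBody {x | φ.app x ∈ V} (φ.pull '' F) where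
  finite_pts := B.finite_pts.preimage fun x _ y _ e => by
    rw [← Frame.back_app h x, ← Frame.back_app h y, e]
  finite_facets := B.finite_facets.image _
  mem_iff x := by
    rw [mem_ofPred_eq, B.mem_iff, forall_mem_image]
    refine forall₂_congr fun f _ => ?_
    have := φ.slack_pull f x
    omega
  free x := by
    obtain ⟨f, hf, hx⟩ := B.free (φ.app x)
    refine ⟨_, mem_image_of_mem _ hf, ?_⟩
    have := φ.slack_pull f x
    omega
  facet_pt := by
    rw [forall_mem_image]
    intro f hf
    obtain ⟨y, hy, hy'⟩ := B.facet_pt f hf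
    refine ⟨φ.back y, ?_, ?_⟩
    · have := φ.slack_pull f (φ.back y)
      rw [Frame.app_back h] at this
      omega
    · rw [forall_mem_image]
      intro g hg hgf
      have := φ.slack_pull g (φ.back y)
      rw [Frame.app_back h] at this
      have := hy' g hg fun e => hgf (by rw [e])
      omega
  prim := by
    rw [forall_mem_image]
    intro f hf
    obtain ⟨x, hx⟩ := B.prim f hf
    refine ⟨φ.back (comb 1 φ.o 1 x), ?_⟩
    rw [Frame.dot_pull, Frame.app_back h, dot_comb, hx]
    ring
  support u b N X hN hX hu := by
    set U : Pt := comb 1 (comb (φ.det * u.1) (cross φ.c₂ φ.c₃) (φ.det * u.2.1)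
      (cross φ.c₃ φ.c₁)) (φ.det * u.2.2) (cross φ.c₁ φ.c₂) with hU
    have e : ∀ y, dot u (φ.back y) = dot U y - dot U φ.o := by
      intro y
      rw [hU]
      simp only [comb, dot, sub, Frame.back]; ring
    have eX : ∀ w : Pt, dot w (comb N φ.o 1 (φ.lin X)) =
        N * dot w φ.o + (dot w (φ.app X) - dot w φ.o) := by
      intro w
      rw [dot_comb]
      simp only [dot, Frame.lin, Frame.app]; ring
    have key := B.support U (b + dot U φ.o) N (comb N φ.o 1 (φ.lin X)) hN (fun f hf => by
        have h1 := hX _ (mem_image_of_mem _ hf)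
        rw [Frame.dot_pull] at h1
        simp only [Frame.pull] at h1
        rw [eX]
        linarith)
      (fun v hv => by
        have h1 := hu (φ.back v) (by rwa [mem_ofPred_eq, Frame.app_back h])
        rw [e] at h1
        linarith)
    rw [eX] at key
    have h1 := e (φ.app X)
    rw [Frame.back_app h] at h1
    linarith

/-- Being one of the models does not depend on the coordinates. -/
lemma IsModel.of_comap {V : Set Pt} {φ : Frame} (h : φ.det * φ.det = 1)
    (hV : IsModel {x | φ.app x ∈ V}) : IsModel V := by
  obtain ⟨m, hm, ψ, hψ, h₁, h₂⟩ := hV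
  refine ⟨m, hm, φ.comp ψ, ?_, fun p hp => ?_, fun v hv => ?_⟩
  · rw [Frame.det_comp]
    linear_combination (ψ.det * ψ.det) * h + hψ
  · rw [Frame.app_comp]; exact h₁ p hp
  · obtain ⟨p, hp, e⟩ := h₂ (φ.back v) (by rwa [mem_ofPred_eq, Frame.app_back h])
    exact ⟨p, hp, by rw [Frame.app_comp, e, Frame.app_back h]⟩

lemma eq_of_dot {a b : Pt} (h : ∀ w, dot w a = dot w b) : a = b := by
  obtain ⟨a₁, a₂, a₃⟩ := a
  obtain ⟨b₁, b₂, b₃⟩ := b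
  have h₁ := h (1, 0, 0)
  have h₂ := h (0, 1, 0)
  have h₃ := h (0, 0, 1)
  simp only [dot, one_mul, zero_mul, zero_add, add_zero] at h₁ h₂ h₃
  rw [h₁, h₂, h₃]

/-- Expansion of a vector in terms of a dual basis, up to a factor `c`. -/
lemma dual_basis {f₁ f₂ f₃ a₁ a₂ a₃ : Pt} {c : ℤ} (hc : c ≠ 0)
    (h₁₁ : dot f₁ a₁ = c) (h₁₂ : dot f₁ a₂ = 0) (h₁₃ : dot f₁ a₃ = 0)
    (h₂₁ : dot f₂ a₁ = 0) (h₂₂ : dot f₂ a₂ = c) (h₂₃ : dot f₂ a₃ = 0)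
    (h₃₁ : dot f₃ a₁ = 0) (h₃₂ : dot f₃ a₂ = 0) (h₃₃ : dot f₃ a₃ = c) (w d : Pt) :
    c * dot w d = dot f₁ d * dot w a₁ + dot f₂ d * dot w a₂ + dot f₃ d * dot w a₃ := by
  have hD : dot a₁ (cross a₂ a₃) ≠ 0 := by
    intro h0
    have e : dot f₁ (cross f₂ f₃) * dot a₁ (cross a₂ a₃) =
        dot f₁ a₁ * (dot f₂ a₂ * dot f₃ a₃ - dot f₂ a₃ * dot f₃ a₂) -
        dot f₁ a₂ * (dot f₂ a₁ * dot f₃ a₃ - dot f₂ a₃ * dot f₃ a₁) +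
        dot f₁ a₃ * (dot f₂ a₁ * dot f₃ a₂ - dot f₂ a₂ * dot f₃ a₁) := by
      simp only [dot, cross]; ring
    rw [h0, h₁₁, h₁₂, h₁₃, h₂₁, h₂₂, h₂₃, h₃₁, h₃₂, h₃₃] at e
    have : c * (c * c) = 0 := by linarith
    simp [hc] at this
  have e₀ := det_mul_dot w d a₁ a₂ a₃
  have e₁ := det_mul_dot f₁ d a₁ a₂ a₃
  have e₂ := det_mul_dot f₂ d a₁ a₂ a₃
  have e₃ := det_mul_dot f₃ d a₁ a₂ a₃
  rw [h₁₁, h₁₂, h₁₃] at e₁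
  rw [h₂₁, h₂₂, h₂₃] at e₂
  rw [h₃₁, h₃₂, h₃₃] at e₃
  apply mul_left_cancel₀ hD
  linear_combination c * e₀ - dot w a₁ * e₁ - dot w a₂ * e₂ - dot w a₃ * e₃

lemma Frame.det_mul_self_of_surjective {φ : Frame} (h : ∀ v, ∃ p, φ.app p = v) :
    φ.det * φ.det = 1 := by
  have hl : ∀ v : Pt, ∃ p, φ.lin p = v := by
    intro v
    obtain ⟨p, hp⟩ := h (comb 1 φ.o 1 v)
    refine ⟨p, ?_⟩
    simp only [app, comb, lin] at *
    ext <;> grind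
  obtain ⟨p, hp⟩ := hl (1, 0, 0)
  obtain ⟨q, hq⟩ := hl (0, 1, 0)
  obtain ⟨r, hr⟩ := hl (0, 0, 1)
  have e : φ.det * dot p (cross q r) = dot (φ.lin p) (cross (φ.lin q) (φ.lin r)) := by
    simp only [det, dot, cross, lin]; ring
  rw [hp, hq, hr] at e
  exact Int.isUnit_mul_self (IsUnit.of_mul_eq_one _ (by rw [e]; rfl))

namespace IsBody

variable {V : Set Pt} {F : Set (Pt × ℤ)}

lemma facet_pt_mem (B : IsBody V F) {f : Pt × ℤ} {y : Pt} (hy : dot f.1 y = f.2)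
    (hy' : ∀ g ∈ F, g ≠ f → dot g.1 y < g.2) : y ∈ V :=
  (B.mem_iff y).2 fun g hg => by
    by_cases e : g = f
    · rw [e, hy]
    · exact (hy' g hg e).le

lemma nonempty_facets (B : IsBody V F) : F.Nonempty :=
  let ⟨f, hf, _⟩ := B.free 0
  ⟨f, hf⟩

lemma nonempty_pts (B : IsBody V F) : V.Nonempty := by
  obtain ⟨f, hf⟩ := B.nonempty_facets
  obtain ⟨y, hy, hy'⟩ := B.facet_pt f hf
  exact ⟨y, B.facet_pt_mem hy hy'⟩

/-- A body is bounded in every direction. -/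
lemma exists_pos (B : IsBody V F) {d : Pt} (hd : d ≠ 0) : ∃ f ∈ F, 0 < dot f.1 d := by
  by_contra! hcon
  obtain ⟨y, hy⟩ := B.nonempty_pts
  obtain ⟨M, hM⟩ := (B.finite_pts.image fun v => dot d v).bddAbove
  have hd' := dot_self_pos hd
  have hmem : comb 1 y (max (M - dot d y + 1) 0) d ∈ V := (B.mem_iff _).2 fun f hf => by
    rw [dot_comb]
    have h1 := (B.mem_iff _).1 hy f hf
    have h2 := hcon f hf
    have h3 := le_max_right (M - dot d y + 1) 0
    nlinarith
  have h1 := hM (mem_image_of_mem _ hmem)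
  simp only [dot_comb] at h1
  have h2 := le_max_left (M - dot d y + 1) 0
  have h3 := le_max_right (M - dot d y + 1) 0
  nlinarith

/-- Two distinct facets with parallel normal vectors are opposite. -/
lemma opposite_of_cross (B : IsBody V F) {f g : Pt × ℤ} (hf : f ∈ F) (hg : g ∈ F) (hfg : f ≠ g)
    (h0 : cross f.1 g.1 = 0) (x : Pt) : dot f.1 x + dot g.1 x = 0 := by
  obtain ⟨p, hp⟩ := B.prim f hf
  obtain ⟨q, hq⟩ := B.prim g hg
  have key : ∀ x y, dot f.1 x * dot g.1 y = dot f.1 y * dot g.1 x := by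
    intro x y
    have : dot f.1 x * dot g.1 y - dot f.1 y * dot g.1 x = dot (cross f.1 g.1) (cross x y) := by
      simp only [dot, cross]; ring
    rw [h0] at this
    simp only [dot, Prod.fst_zero, Prod.snd_zero] at *
    linarith
  have h1 : dot g.1 p * dot f.1 q = 1 := by have := key p q; rw [hp, hq] at this; linarith
  have h2 : dot g.1 x = dot g.1 p * dot f.1 x := by have := key p x; rw [hp] at this; linarith
  rcases Int.eq_one_or_neg_one_of_mul_eq_one h1 with h | h
  · exfalso
    have h3 : ∀ x, dot g.1 x = dot f.1 x := fun x => by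
      have := key p x; rw [hp, h] at this; linarith
    obtain ⟨y, hy, hy'⟩ := B.facet_pt f hf
    obtain ⟨z, hz, hz'⟩ := B.facet_pt g hg
    have h4 := hy' g hg hfg.symm
    have h5 := hz' f hf hfg
    rw [h3] at h4 hz
    omega
  · rw [h2, h]; ring

/-- Two distinct facets of a body of width two: the distance of the distinguished point of one of
them from the other one is one, unless the facets are opposite. -/
lemma slack_eq (B : IsBody V F) (h2 : ∀ f ∈ F, ∀ v ∈ V, f.2 - dot f.1 v ≤ 2) {f g : Pt × ℤ}
    (hf : f ∈ F) (hg : g ∈ F) (hfg : f ≠ g) {y : Pt} (hy : dot f.1 y = f.2)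
    (hy' : ∀ g ∈ F, g ≠ f → dot g.1 y < g.2) :
    (g.2 - dot g.1 y = 1 ∧ cross f.1 g.1 ≠ 0) ∨
      ∀ x, (f.2 - dot f.1 x) + (g.2 - dot g.1 x) = 2 := by
  have i₁ := hy' g hg hfg.symm
  have i₂ := h2 g hg y (B.facet_pt_mem hy hy')
  by_cases h0 : cross f.1 g.1 = 0
  · right
    have hop := B.opposite_of_cross hf hg hfg h0
    suffices g.2 - dot g.1 y ≠ 1 by
      intro x
      have h3 := hop x
      have h4 := hop y
      omega
    intro h1
    obtain ⟨d, hd0, hd⟩ : ∃ d, d ≠ 0 ∧ dot f.1 d = 0 := by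
      obtain ⟨⟨a, b, c⟩, e⟩ := f
      by_cases hab : a = 0 ∧ b = 0
      · exact ⟨(1, 0, 0), by simp, by simp [dot, hab.1]⟩
      · refine ⟨(-b, a, 0), ?_, by simp only [dot]; ring⟩
        simp only [ne_eq, Prod.mk_eq_zero, neg_eq_zero]
        tauto
    obtain ⟨k, hk, hkd⟩ := B.exists_pos hd0
    have hkf : f ≠ k := by rintro rfl; omega
    have hkg : g ≠ k := by rintro rfl; have := hop d; omega
    obtain ⟨z, hz, hz'⟩ := B.facet_pt k hk
    have h3 := hz' f hf hkf
    have h4 := hz' g hg hkg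
    have h5 := hop z
    have h6 := hop y
    omega
  · left
    refine ⟨?_, h0⟩
    have hpos := dot_self_pos h0
    obtain ⟨v, hv, hvf, hlt⟩ := B.exists_tight_gt hf hy hy' (d := cross f.1 (cross f.1 g.1))
      (g := comb (-1) g.1 0 0) (by rw [dot_comm, dot_cross_self_left]) (by
        have : dot (comb (-1) g.1 0 0) (cross f.1 (cross f.1 g.1)) =
            dot (cross f.1 g.1) (cross f.1 g.1) := by
          simp only [dot, comb, cross, Prod.fst_zero, Prod.snd_zero]; ring
        rw [this]; exact hpos)
    have h3 := h2 g hg v hv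
    rw [comb_dot, comb_dot] at hlt
    simp only [dot, Prod.fst_zero, Prod.snd_zero] at *
    omega

/-- Among four facets of a body of width two, there are two opposite ones. -/
lemma four_facets (B : IsBody V F) (h2 : ∀ f ∈ F, ∀ v ∈ V, f.2 - dot f.1 v ≤ 2)
    {f₁ f₂ f₃ f₄ : Pt × ℤ} (h₁ : f₁ ∈ F) (h₂ : f₂ ∈ F) (h₃ : f₃ ∈ F) (h₄ : f₄ ∈ F)
    (c₁₂ : cross f₁.1 f₂.1 ≠ 0) (c₁₃ : cross f₁.1 f₃.1 ≠ 0) (c₁₄ : cross f₁.1 f₄.1 ≠ 0)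
    (c₂₃ : cross f₂.1 f₃.1 ≠ 0) (c₂₄ : cross f₂.1 f₄.1 ≠ 0) (c₃₄ : cross f₃.1 f₄.1 ≠ 0) :
    False := by
  have swap : ∀ {a b : Pt}, cross a b ≠ 0 → cross b a ≠ 0 := by
    intro a b h h'
    apply h
    simp only [cross, Prod.mk_eq_zero] at *
    refine ⟨?_, ?_, ?_⟩ <;> linarith
  choose! y hy hy' using B.facet_pt
  have val : ∀ f ∈ F, ∀ g ∈ F, cross f.1 g.1 ≠ 0 → g.2 - dot g.1 (y f) = 1 := by
    intro f hf g hg hc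
    have hfg : f ≠ g := by
      rintro rfl
      apply hc
      simp only [cross, Prod.mk_eq_zero]
      refine ⟨?_, ?_, ?_⟩ <;> ring
    rcases B.slack_eq h2 hf hg hfg (hy f hf) (hy' f hf) with h | h
    · exact h.1
    · exfalso
      apply hc
      have e : ∀ x, dot f.1 x = - dot g.1 x := by
        intro x
        have e₁ := h 0
        have e₂ := h x
        simp only [dot, Prod.fst_zero, Prod.snd_zero] at *
        omega
      have e₁ := e (1, 0, 0)
      have e₂ := e (0, 1, 0)
      have e₃ := e (0, 0, 1)
      simp only [dot, mul_one, mul_zero, zero_add, add_zero] at e₁ e₂ e₃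
      simp only [cross, e₁, e₂, e₃, Prod.mk_eq_zero]
      refine ⟨?_, ?_, ?_⟩ <;> ring
  have v₁₂ := val f₁ h₁ f₂ h₂ c₁₂
  have v₁₃ := val f₁ h₁ f₃ h₃ c₁₃
  have v₁₄ := val f₁ h₁ f₄ h₄ c₁₄
  have v₂₁ := val f₂ h₂ f₁ h₁ (swap c₁₂)
  have v₂₃ := val f₂ h₂ f₃ h₃ c₂₃
  have v₂₄ := val f₂ h₂ f₄ h₄ c₂₄
  have v₃₁ := val f₃ h₃ f₁ h₁ (swap c₁₃)
  have v₃₂ := val f₃ h₃ f₂ h₂ (swap c₂₃)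
  have v₃₄ := val f₃ h₃ f₄ h₄ c₃₄
  have v₄₁ := val f₄ h₄ f₁ h₁ (swap c₁₄)
  have v₄₂ := val f₄ h₄ f₂ h₂ (swap c₂₄)
  have v₄₃ := val f₄ h₄ f₃ h₃ (swap c₃₄)
  have v₁ := hy f₁ h₁
  have v₂ := hy f₂ h₂
  have v₃ := hy f₃ h₃
  have v₄ := hy f₄ h₄
  have key := fun w d => dual_basis (f₁ := f₁.1) (f₂ := f₂.1) (f₃ := f₃.1)
    (a₁ := sub (y f₁) (y f₄)) (a₂ := sub (y f₂) (y f₄)) (a₃ := sub (y f₃) (y f₄)) one_ne_zero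
    (by rw [dot_sub]; omega) (by rw [dot_sub]; omega) (by rw [dot_sub]; omega)
    (by rw [dot_sub]; omega) (by rw [dot_sub]; omega) (by rw [dot_sub]; omega)
    (by rw [dot_sub]; omega) (by rw [dot_sub]; omega) (by rw [dot_sub]; omega) w d
  have hall : ∀ g ∈ F, g = f₁ ∨ g = f₂ ∨ g = f₃ ∨ g = f₄ := by
    intro g hg
    by_contra! hne
    obtain ⟨n₁, n₂, n₃, n₄⟩ := hne
    have k := key f₄.1 (sub (y g) (y f₄))
    simp only [dot_sub] at k
    have l₁ := hy' g hg f₁ h₁ n₁.symm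
    have l₂ := hy' g hg f₂ h₂ n₂.symm
    have l₃ := hy' g hg f₃ h₃ n₃.symm
    have l₄ := hy' g hg f₄ h₄ n₄.symm
    have m₁ : dot f₄.1 (y f₁) - dot f₄.1 (y f₄) = -1 := by omega
    have m₂ : dot f₄.1 (y f₂) - dot f₄.1 (y f₄) = -1 := by omega
    have m₃ : dot f₄.1 (y f₃) - dot f₄.1 (y f₄) = -1 := by omega
    rw [m₁, m₂, m₃] at k
    omega
  set X := comb 1 (comb 1 (y f₁) 1 (y f₂)) 1 (comb 1 (y f₃) (-2) (y f₄)) with hX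
  have hXV : X ∈ V := (B.mem_iff X).2 fun g hg => by
    rw [hX]
    simp only [dot_comb]
    rcases hall g hg with rfl | rfl | rfl | rfl <;> omega
  have := h2 f₄ h₄ X hXV
  rw [hX] at this
  simp only [dot_comb] at this
  omega

end IsBody

namespace IsBody

variable {V : Set Pt} {F : Set (Pt × ℤ)}

/-- Among three independent facets of a body of width two, each has an opposite one. -/
lemma exists_opposite (B : IsBody V F) (h2 : ∀ f ∈ F, ∀ v ∈ V, f.2 - dot f.1 v ≤ 2)
    {f₁ f₂ f₃ : Pt × ℤ} (h₁ : f₁ ∈ F) (h₂ : f₂ ∈ F) (h₃ : f₃ ∈ F)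
    (hD : dot f₃.1 (cross f₁.1 f₂.1) ≠ 0) :
    ∃ g ∈ F, f₃ ≠ g ∧ ∀ x, (f₃.2 - dot f₃.1 x) + (g.2 - dot g.1 x) = 2 := by
  have aux : ∀ {a b x : Pt}, dot x (cross a b) ≠ 0 →
      cross a b ≠ 0 ∧ cross a x ≠ 0 ∧ cross b x ≠ 0 := by
    intro a b x h
    refine ⟨fun h0 => h (by rw [h0]; simp [dot]), fun h0 => h ?_, fun h0 => h ?_⟩
    · have : dot x (cross a b) = - dot b (cross a x) := by simp only [dot, cross]; ring
      rw [this, h0]; simp [dot]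
    · have : dot x (cross a b) = dot a (cross b x) := by simp only [dot, cross]; ring
      rw [this, h0]; simp [dot]
  obtain ⟨c₁, c₂, c₃⟩ := aux hD
  obtain ⟨s, hs, hs'⟩ : ∃ s : ℤ, dot f₃.1 (comb s (cross f₁.1 f₂.1) 0 0) < 0 ∧ s ≠ 0 := by
    refine ⟨-dot f₃.1 (cross f₁.1 f₂.1), ?_, by simpa using hD⟩
    rw [dot_comb]
    have := mul_self_pos.2 hD
    linarith
  have hd : comb s (cross f₁.1 f₂.1) 0 0 ≠ 0 := by
    intro h
    rw [h] at hs
    simp [dot] at hs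
  obtain ⟨g, hg, hgd⟩ := B.exists_pos hd
  have hfg : f₃ ≠ g := by rintro rfl; omega
  refine ⟨g, hg, hfg, ?_⟩
  obtain ⟨y, hy, hy'⟩ := B.facet_pt f₃ h₃
  refine (B.slack_eq h2 h₃ hg hfg hy hy').resolve_left ?_
  rintro ⟨-, h⟩
  have hDg : dot g.1 (cross f₁.1 f₂.1) ≠ 0 := by
    intro h0
    rw [dot_comb, h0] at hgd
    simp at hgd
  obtain ⟨-, d₂, d₃⟩ := aux hDg
  exact B.four_facets h2 h₁ h₂ h₃ hg c₁ c₂ d₂ c₃ d₃ h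

/-- The normal form of a body of width two. -/
lemma exists_octahedral (B : IsBody V F) (h2 : ∀ f ∈ F, ∀ v ∈ V, f.2 - dot f.1 v ≤ 2) :
    ∃ f₁ ∈ F, ∃ f₂ ∈ F, ∃ f₃ ∈ F, dot f₁.1 (cross f₂.1 f₃.1) ≠ 0 ∧
      ∀ g ∈ F, g = f₁ ∨ g = f₂ ∨ g = f₃ ∨ (∀ x, (f₁.2 - dot f₁.1 x) + (g.2 - dot g.1 x) = 2) ∨
        (∀ x, (f₂.2 - dot f₂.1 x) + (g.2 - dot g.1 x) = 2) ∨
        (∀ x, (f₃.2 - dot f₃.1 x) + (g.2 - dot g.1 x) = 2) := by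
  obtain ⟨f₁, h₁⟩ := B.nonempty_facets
  have hn : f₁.1 ≠ 0 := fun h => B.normal_ne h₁ fun d => by rw [h]; simp [dot]
  obtain ⟨e, he⟩ : ∃ e, cross f₁.1 e ≠ 0 := by
    by_contra! h
    have k₁ := h (1, 0, 0)
    have k₂ := h (0, 1, 0)
    simp only [cross, Prod.mk_eq_zero] at k₁ k₂
    apply hn
    ext <;> simp <;> omega
  obtain ⟨f₂, h₂, k₂⟩ := B.exists_pos he
  have hc : cross f₁.1 f₂.1 ≠ 0 := by
    intro h
    have : dot f₂.1 (cross f₁.1 e) = - dot e (cross f₁.1 f₂.1) := by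
      simp only [dot, cross]; ring
    rw [this, h] at k₂
    simp [dot] at k₂
  obtain ⟨f₃, h₃, k₃⟩ := B.exists_pos hc
  have hD : dot f₁.1 (cross f₂.1 f₃.1) ≠ 0 := by
    have : dot f₁.1 (cross f₂.1 f₃.1) = dot f₃.1 (cross f₁.1 f₂.1) := by
      simp only [dot, cross]; ring
    omega
  refine ⟨f₁, h₁, f₂, h₂, f₃, h₃, hD, fun g hg => ?_⟩
  by_contra! hcon
  obtain ⟨n₁, n₂, n₃, o₁, o₂, o₃⟩ := hcon
  have aux : ∀ f ∈ F, g ≠ f → (∃ x, (f.2 - dot f.1 x) + (g.2 - dot g.1 x) ≠ 2) →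
      cross f.1 g.1 ≠ 0 := by
    rintro f hf hne ⟨x, hx⟩
    obtain ⟨y, hy, hy'⟩ := B.facet_pt f hf
    exact ((B.slack_eq h2 hf hg hne.symm hy hy').resolve_right fun h => hx (h x)).2
  refine B.four_facets h2 h₁ h₂ h₃ hg hc ?_ (aux f₁ h₁ n₁ o₁) ?_ (aux f₂ h₂ n₂ o₂)
    (aux f₃ h₃ n₃ o₃)
  · intro h
    apply hD
    have : dot f₁.1 (cross f₂.1 f₃.1) = - dot f₂.1 (cross f₁.1 f₃.1) := by
      simp only [dot, cross]; ring
    rw [this, h]; simp [dot]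
  · intro h
    apply hD
    rw [h]; simp [dot]

/-- The distance of the distinguished point of a facet of a body of width two from a facet that is
not parallel. -/
lemma slack_eq_one (B : IsBody V F) (h2 : ∀ f ∈ F, ∀ v ∈ V, f.2 - dot f.1 v ≤ 2)
    {f g : Pt × ℤ} (hf : f ∈ F) (hg : g ∈ F) {y : Pt} (hy : dot f.1 y = f.2)
    (hy' : ∀ g ∈ F, g ≠ f → dot g.1 y < g.2) (hc : cross f.1 g.1 ≠ 0) :
    g.2 - dot g.1 y = 1 := by
  have hfg : f ≠ g := by
    rintro rfl
    apply hc
    simp only [cross, Prod.mk_eq_zero]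
    refine ⟨?_, ?_, ?_⟩ <;> ring
  refine ((B.slack_eq h2 hf hg hfg hy hy').resolve_right fun h => hc ?_).1
  have e : ∀ x, dot f.1 x = - dot g.1 x := by
    intro x
    have e₁ := h 0
    have e₂ := h x
    simp only [dot, Prod.fst_zero, Prod.snd_zero] at *
    omega
  have e₁ := e (1, 0, 0)
  have e₂ := e (0, 1, 0)
  have e₃ := e (0, 0, 1)
  simp only [dot, mul_one, mul_zero, zero_add, add_zero] at e₁ e₂ e₃
  simp only [cross, e₁, e₂, e₃, Prod.mk_eq_zero]
  refine ⟨?_, ?_, ?_⟩ <;> ring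

end IsBody

/-- The lattice points of the twelfth polytope, in coordinates adapted to its facets. -/
lemma mem_model_twelve {a b c : ℤ} (ha : -1 ≤ a ∧ a ≤ 1) (hb : -1 ≤ b ∧ b ≤ 1)
    (hc : -1 ≤ c ∧ c ≤ 1) (h : (a + b + c) % 2 = 1) :
    ((b + c - a + 1) / 2, (a + b + c + 3) / 2, c + 1) ∈ (models.getD 11 ([], [])).2 := by
  obtain ⟨ha₁, ha₂⟩ := ha
  obtain ⟨hb₁, hb₂⟩ := hb
  obtain ⟨hc₁, hc₂⟩ := hc
  interval_cases a <;> interval_cases b <;> interval_cases c <;> first | omega | decide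

namespace IsBody

variable {V : Set Pt} {F : Set (Pt × ℤ)}

/-- A body of width two is the parallelepiped. -/
theorem isModel_of_width_two (B : IsBody V F) (h2 : ∀ f ∈ F, ∀ v ∈ V, f.2 - dot f.1 v ≤ 2) :
    IsModel V := by
  obtain ⟨f₁, h₁, f₂, h₂, f₃, h₃, hD, hall⟩ := B.exists_octahedral h2
  have D₃ : dot f₃.1 (cross f₁.1 f₂.1) ≠ 0 := by
    convert hD using 1; simp only [dot, cross]; ring
  have D₂ : dot f₂.1 (cross f₃.1 f₁.1) ≠ 0 := by
    convert hD using 1; simp only [dot, cross]; ring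
  obtain ⟨g₁, k₁, -, o₁⟩ := B.exists_opposite h2 h₂ h₃ h₁ hD
  obtain ⟨g₂, k₂, -, o₂⟩ := B.exists_opposite h2 h₃ h₁ h₂ D₂
  obtain ⟨g₃, k₃, -, o₃⟩ := B.exists_opposite h2 h₁ h₂ h₃ D₃
  obtain ⟨y₁, t₁, t₁'⟩ := B.facet_pt f₁ h₁
  obtain ⟨y₂, t₂, t₂'⟩ := B.facet_pt f₂ h₂
  obtain ⟨y₃, t₃, t₃'⟩ := B.facet_pt f₃ h₃
  obtain ⟨z₁, u₁, u₁'⟩ := B.facet_pt g₁ k₁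
  obtain ⟨z₂, u₂, u₂'⟩ := B.facet_pt g₂ k₂
  obtain ⟨z₃, u₃, u₃'⟩ := B.facet_pt g₃ k₃
  have neg : ∀ {f g : Pt × ℤ}, (∀ x, (f.2 - dot f.1 x) + (g.2 - dot g.1 x) = 2) →
      g.1 = comb (-1) f.1 0 0 := by
    intro f g h
    apply eq_of_dot
    intro w
    rw [dot_comb, dot_comm w, dot_comm w]
    have e₁ := h 0
    have e₂ := h w
    simp only [dot, Prod.fst_zero, Prod.snd_zero] at *
    omega
  have c_self : ∀ {a b x : Pt}, dot x (cross a b) ≠ 0 → cross a b ≠ 0 ∧ cross b a ≠ 0 ∧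
      cross (comb (-1) a 0 0) b ≠ 0 ∧ cross (comb (-1) b 0 0) a ≠ 0 := by
    intro a b x h
    refine ⟨fun h0 => h ?_, fun h0 => h ?_, fun h0 => h ?_, fun h0 => h ?_⟩ <;>
    · simp only [cross, comb, dot, Prod.mk_eq_zero, Prod.fst_zero, Prod.snd_zero] at *
      obtain ⟨i, j, k⟩ := h0
      grind
  obtain ⟨c₁₂, c₂₁, c₁₂', c₂₁'⟩ := c_self D₃
  obtain ⟨c₂₃, c₃₂, c₂₃', c₃₂'⟩ := c_self hD
  obtain ⟨c₃₁, c₁₃, c₃₁', c₁₃'⟩ := c_self D₂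
  rw [← neg o₁] at c₁₂' c₁₃'
  rw [← neg o₂] at c₂₁' c₂₃'
  rw [← neg o₃] at c₃₁' c₃₂'
  have v₁₂ := B.slack_eq_one h2 h₁ h₂ t₁ t₁' c₁₂
  have v₁₃ := B.slack_eq_one h2 h₁ h₃ t₁ t₁' c₁₃
  have v₂₁ := B.slack_eq_one h2 h₂ h₁ t₂ t₂' c₂₁
  have v₂₃ := B.slack_eq_one h2 h₂ h₃ t₂ t₂' c₂₃
  have v₃₁ := B.slack_eq_one h2 h₃ h₁ t₃ t₃' c₃₁
  have v₃₂ := B.slack_eq_one h2 h₃ h₂ t₃ t₃' c₃₂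
  have w₁₂ := B.slack_eq_one h2 k₁ h₂ u₁ u₁' c₁₂'
  have w₁₃ := B.slack_eq_one h2 k₁ h₃ u₁ u₁' c₁₃'
  have w₂₁ := B.slack_eq_one h2 k₂ h₁ u₂ u₂' c₂₁'
  have w₂₃ := B.slack_eq_one h2 k₂ h₃ u₂ u₂' c₂₃'
  have w₃₁ := B.slack_eq_one h2 k₃ h₁ u₃ u₃' c₃₁'
  have w₃₂ := B.slack_eq_one h2 k₃ h₂ u₃ u₃' c₃₂'
  have w₁ := o₁ z₁
  have w₂ := o₂ z₂
  have w₃ := o₃ z₃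
  have key := fun w d => dual_basis (f₁ := f₁.1) (f₂ := f₂.1) (f₃ := f₃.1)
    (a₁ := sub y₁ z₁) (a₂ := sub y₂ z₂) (a₃ := sub y₃ z₃) two_ne_zero
    (by rw [dot_sub]; omega) (by rw [dot_sub]; omega) (by rw [dot_sub]; omega)
    (by rw [dot_sub]; omega) (by rw [dot_sub]; omega) (by rw [dot_sub]; omega)
    (by rw [dot_sub]; omega) (by rw [dot_sub]; omega) (by rw [dot_sub]; omega) w d
  have inj : ∀ a b, dot f₁.1 a = dot f₁.1 b → dot f₂.1 a = dot f₂.1 b →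
      dot f₃.1 a = dot f₃.1 b → a = b := by
    intro a b e₁ e₂ e₃
    apply eq_of_dot
    intro w
    have := key w (sub a b)
    simp only [dot_sub, e₁, e₂, e₃, sub_self, zero_mul, add_zero] at this
    omega
  have mem : ∀ x, x ∈ V ↔ (-1 ≤ 1 - (f₁.2 - dot f₁.1 x) ∧ 1 - (f₁.2 - dot f₁.1 x) ≤ 1) ∧
      (-1 ≤ 1 - (f₂.2 - dot f₂.1 x) ∧ 1 - (f₂.2 - dot f₂.1 x) ≤ 1) ∧
      (-1 ≤ 1 - (f₃.2 - dot f₃.1 x) ∧ 1 - (f₃.2 - dot f₃.1 x) ≤ 1) := by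
    intro x
    have p₁ := o₁ x
    have p₂ := o₂ x
    have p₃ := o₃ x
    rw [B.mem_iff]
    constructor
    · intro h
      have q₁ := h _ h₁
      have q₂ := h _ h₂
      have q₃ := h _ h₃
      have r₁ := h _ k₁
      have r₂ := h _ k₂
      have r₃ := h _ k₃
      omega
    · intro h g hg
      rcases hall g hg with rfl | rfl | rfl | h' | h' | h'
      iterate 3 omega
      all_goals have := h' x; omega
  have odd : ∀ x, ((1 - (f₁.2 - dot f₁.1 x)) + (1 - (f₂.2 - dot f₂.1 x)) +
      (1 - (f₃.2 - dot f₃.1 x))) % 2 = 1 := by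
    intro x
    by_contra hne
    obtain ⟨m, hm⟩ := Int.dvd_of_emod_eq_zero (Int.emod_two_ne_one.1 hne)
    obtain ⟨g, hg, hgc⟩ := B.free (comb 1 (comb 1 x (f₁.2 - dot f₁.1 x - 1) (sub y₁ y₂)) 1
      (comb (f₃.2 - dot f₃.1 x - 1) (sub y₃ y₂) (-m) (sub y₂ z₂)))
    set c := comb 1 (comb 1 x (f₁.2 - dot f₁.1 x - 1) (sub y₁ y₂)) 1
      (comb (f₃.2 - dot f₃.1 x - 1) (sub y₃ y₂) (-m) (sub y₂ z₂)) with hc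
    have e : ∀ w, dot w c = dot w x + (f₁.2 - dot f₁.1 x - 1) * (dot w y₁ - dot w y₂) +
        ((f₃.2 - dot f₃.1 x - 1) * (dot w y₃ - dot w y₂) - m * (dot w y₂ - dot w z₂)) := by
      intro w
      rw [hc]
      simp only [dot_comb, dot_sub]
      ring
    have i₁ : f₁.2 - dot f₁.1 c = 1 := by
      rw [e, (by omega : dot f₁.1 y₁ - dot f₁.1 y₂ = 1), (by omega : dot f₁.1 y₃ - dot f₁.1 y₂ = 0),
        (by omega : dot f₁.1 y₂ - dot f₁.1 z₂ = 0)]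
      omega
    have i₂ : f₂.2 - dot f₂.1 c = 1 := by
      rw [e, (by omega : dot f₂.1 y₁ - dot f₂.1 y₂ = -1),
        (by omega : dot f₂.1 y₃ - dot f₂.1 y₂ = -1), (by omega : dot f₂.1 y₂ - dot f₂.1 z₂ = 2)]
      omega
    have i₃ : f₃.2 - dot f₃.1 c = 1 := by
      rw [e, (by omega : dot f₃.1 y₁ - dot f₃.1 y₂ = 0), (by omega : dot f₃.1 y₃ - dot f₃.1 y₂ = 1),
        (by omega : dot f₃.1 y₂ - dot f₃.1 z₂ = 0)]
      omega
    rcases hall g hg with rfl | rfl | rfl | h' | h' | h'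
    iterate 3 omega
    all_goals have := h' c; omega
  let φ : Frame := ⟨sub z₃ (sub y₁ z₂), sub y₂ y₁, sub y₁ z₂, sub y₃ y₂⟩
  have hφ : ∀ (w : Pt) (p : Pt), dot w (φ.app p) = dot w z₃ - (dot w y₁ - dot w z₂) +
      p.1 * (dot w y₂ - dot w y₁) + p.2.1 * (dot w y₁ - dot w z₂) +
      p.2.2 * (dot w y₃ - dot w y₂) := by
    intro w p
    simp only [dot, φ, Frame.app, sub]; ring
  have n₁ : ∀ p, 1 - (f₁.2 - dot f₁.1 (φ.app p)) = p.2.1 - 1 - p.1 := by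
    intro p
    rw [hφ, (by omega : dot f₁.1 y₂ - dot f₁.1 y₁ = -1), (by omega : dot f₁.1 y₁ - dot f₁.1 z₂ = 1),
      (by omega : dot f₁.1 y₃ - dot f₁.1 y₂ = 0)]
    omega
  have n₂ : ∀ p, 1 - (f₂.2 - dot f₂.1 (φ.app p)) = p.1 + p.2.1 - 1 - p.2.2 := by
    intro p
    rw [hφ, (by omega : dot f₂.1 y₂ - dot f₂.1 y₁ = 1), (by omega : dot f₂.1 y₁ - dot f₂.1 z₂ = 1),
      (by omega : dot f₂.1 y₃ - dot f₂.1 y₂ = -1)]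
    omega
  have n₃ : ∀ p, 1 - (f₃.2 - dot f₃.1 (φ.app p)) = p.2.2 - 1 := by
    intro p
    rw [hφ, (by omega : dot f₃.1 y₂ - dot f₃.1 y₁ = 0), (by omega : dot f₃.1 y₁ - dot f₃.1 z₂ = 0),
      (by omega : dot f₃.1 y₃ - dot f₃.1 y₂ = 1)]
    omega
  have surj : ∀ v, φ.app (((1 - (f₂.2 - dot f₂.1 v)) + (1 - (f₃.2 - dot f₃.1 v)) -
      (1 - (f₁.2 - dot f₁.1 v)) + 1) / 2, ((1 - (f₁.2 - dot f₁.1 v)) + (1 - (f₂.2 - dot f₂.1 v)) +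
      (1 - (f₃.2 - dot f₃.1 v)) + 3) / 2, (1 - (f₃.2 - dot f₃.1 v)) + 1) = v := by
    intro v
    have ho := odd v
    refine inj _ _ ?_ ?_ ?_
    · have := n₁ (((1 - (f₂.2 - dot f₂.1 v)) + (1 - (f₃.2 - dot f₃.1 v)) -
        (1 - (f₁.2 - dot f₁.1 v)) + 1) / 2, ((1 - (f₁.2 - dot f₁.1 v)) +
        (1 - (f₂.2 - dot f₂.1 v)) + (1 - (f₃.2 - dot f₃.1 v)) + 3) / 2,
        (1 - (f₃.2 - dot f₃.1 v)) + 1)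
      dsimp only at this
      omega
    · have := n₂ (((1 - (f₂.2 - dot f₂.1 v)) + (1 - (f₃.2 - dot f₃.1 v)) -
        (1 - (f₁.2 - dot f₁.1 v)) + 1) / 2, ((1 - (f₁.2 - dot f₁.1 v)) +
        (1 - (f₂.2 - dot f₂.1 v)) + (1 - (f₃.2 - dot f₃.1 v)) + 3) / 2,
        (1 - (f₃.2 - dot f₃.1 v)) + 1)
      dsimp only at this
      omega
    · have := n₃ (((1 - (f₂.2 - dot f₂.1 v)) + (1 - (f₃.2 - dot f₃.1 v)) -
        (1 - (f₁.2 - dot f₁.1 v)) + 1) / 2, ((1 - (f₁.2 - dot f₁.1 v)) +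
        (1 - (f₂.2 - dot f₂.1 v)) + (1 - (f₃.2 - dot f₃.1 v)) + 3) / 2,
        (1 - (f₃.2 - dot f₃.1 v)) + 1)
      dsimp only at this
      omega
  refine ⟨models.getD 11 ([], []), by decide, φ, ?_, fun p hp => ?_, fun v hv => ?_⟩
  · exact Frame.det_mul_self_of_surjective fun v => ⟨_, surj v⟩
  · rw [mem, n₁, n₂, n₃]
    revert p
    decide
  · obtain ⟨b₁, b₂, b₃⟩ := (mem v).1 hv
    exact ⟨_, mem_model_twelve b₁ b₂ b₃ (odd v), surj v⟩

end IsBody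

/-- Convexity of a set of lattice points of the plane. -/
def PlaneConvex (D : ℤ → ℤ → Prop) : Prop :=
  ∀ {a₁ a₂ b₁ b₂ c₁ c₂ : ℤ} (α β γ N x y : ℤ), D a₁ a₂ → D b₁ b₂ → D c₁ c₂ → 0 ≤ α → 0 ≤ β →
    0 ≤ γ → 0 < N → N = α + β + γ → N * x = α * a₁ + β * b₁ + γ * c₁ →
    N * y = α * a₂ + β * b₂ + γ * c₂ → D x y

/-- The vertices of three small polygons with interior point `0`. -/
def polygons : List (List (ℤ × ℤ)) :=
  [[(1, 0), (0, 1), (-1, -1)], [(1, 0), (0, 1), (-1, 0), (0, -1)], [(1, -1), (-1, -1), (0, 1)]]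

/-- The set contains a unimodular copy of one of the small polygons. -/
def HasPolygon (D : ℤ → ℤ → Prop) : Prop :=
  ∃ o₁ o₂ c₁ c₂ d₁ d₂ : ℤ, (c₁ * d₂ - c₂ * d₁) * (c₁ * d₂ - c₂ * d₁) = 1 ∧ D o₁ o₂ ∧
    ∃ B ∈ polygons, ∀ p ∈ B, D (o₁ + p.1 * c₁ + p.2 * d₁) (o₂ + p.1 * c₂ + p.2 * d₂)

lemma HasPolygon.of_translate {D : ℤ → ℤ → Prop} {e₁ e₂ : ℤ}
    (h : HasPolygon fun x y => D (x + e₁) (y + e₂)) : HasPolygon D := by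
  obtain ⟨o₁, o₂, c₁, c₂, d₁, d₂, hd, ho, B, hB, h⟩ := h
  refine ⟨o₁ + e₁, o₂ + e₂, c₁, c₂, d₁, d₂, hd, ho, B, hB, fun p hp => ?_⟩
  convert h p hp using 1 <;> ring

lemma PlaneConvex.translate {D : ℤ → ℤ → Prop} (h : PlaneConvex D) (e₁ e₂ : ℤ) :
    PlaneConvex fun x y => D (x + e₁) (y + e₂) := by
  intro a₁ a₂ b₁ b₂ c₁ c₂ α β γ N x y ha hb hc hα hβ hγ hN hs hx hy
  refine h α β γ N _ _ ha hb hc hα hβ hγ hN hs ?_ ?_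
  · linear_combination hx + e₁ * hs
  · linear_combination hy + e₂ * hs

/-- A nonzero vector is a multiple of a primitive one. -/
lemma exists_primitive {a b : ℤ} (h : a ≠ 0 ∨ b ≠ 0) :
    ∃ k a' b' x y : ℤ, 0 < k ∧ a = k * a' ∧ b = k * b' ∧ x * a' + y * b' = 1 := by
  have hg : 0 < Int.gcd a b := Int.gcd_pos_iff.2 h
  obtain ⟨a', ha⟩ := Int.gcd_dvd_left a b
  obtain ⟨b', hb⟩ := Int.gcd_dvd_right a b
  have hg' : (0 : ℤ) < Int.gcd a b := by exact_mod_cast hg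
  refine ⟨Int.gcd a b, a', b', Int.gcdA a b, Int.gcdB a b, hg', ha, hb, ?_⟩
  have := Int.gcd_eq_gcd_ab a b
  apply mul_left_cancel₀ hg'.ne'
  linear_combination (-1 : ℤ) * this - Int.gcdA a b * ha - Int.gcdB a b * hb

/-- The lattice point next to a primitive vector in the cone of two vectors. -/
lemma exists_neighbour {a₁ a₂ b₁ b₂ x y : ℤ} (h : x * a₁ + y * a₂ = 1)
    (hpos : 0 < a₁ * b₂ - a₂ * b₁) : ∃ e₁ e₂ r : ℤ, 0 ≤ r ∧ r < a₁ * b₂ - a₂ * b₁ ∧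
      (a₁ * b₂ - a₂ * b₁) * e₁ = r * a₁ + b₁ ∧ (a₁ * b₂ - a₂ * b₁) * e₂ = r * a₂ + b₂ := by
  set γ := a₁ * b₂ - a₂ * b₁
  have hγ : γ = a₁ * b₂ - a₂ * b₁ := rfl
  have hdiv := Int.mul_ediv_add_emod (-(x * b₁ + y * b₂)) γ
  refine ⟨-y - (-(x * b₁ + y * b₂)) / γ * a₁, x - (-(x * b₁ + y * b₂)) / γ * a₂,
    (-(x * b₁ + y * b₂)) % γ, Int.emod_nonneg _ hpos.ne', Int.emod_lt_of_pos _ hpos, ?_, ?_⟩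
  · linear_combination (-a₁) * hdiv - y * hγ + b₁ * h
  · linear_combination (-a₂) * hdiv + x * hγ + b₂ * h

set_option maxHeartbeats 1000000 in
/-- A triangle around the origin contains one of the small polygons, or a smaller triangle. -/
lemma hasPolygon_of_two_le {D : ℤ → ℤ → Prop} (hD : PlaneConvex D) (h0 : D 0 0)
    {a₁ a₂ b₁ b₂ c₁ c₂ α β γ : ℤ} (ha : D a₁ a₂) (hb : D b₁ b₂) (hc : D c₁ c₂)
    (hα : α = b₁ * c₂ - b₂ * c₁) (hβ : β = c₁ * a₂ - c₂ * a₁) (hγ : γ = a₁ * b₂ - a₂ * b₁)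
    (hα0 : 0 < α) (hβ0 : 0 < β) (hγ0 : 2 ≤ γ)
    (ih : ∀ (E : ℤ → ℤ → Prop) (p₁ p₂ q₁ q₂ r₁ r₂ : ℤ), PlaneConvex E → E 0 0 → E p₁ p₂ → E q₁ q₂ →
      E r₁ r₂ → 0 < p₁ * q₂ - p₂ * q₁ → 0 < q₁ * r₂ - q₂ * r₁ → 0 < r₁ * p₂ - r₂ * p₁ →
      (p₁ * q₂ - p₂ * q₁) + (q₁ * r₂ - q₂ * r₁) + (r₁ * p₂ - r₂ * p₁) < α + β + γ →
      HasPolygon E) : HasPolygon D := by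
  obtain ⟨k, a₁', a₂', x, y, hk, hk₁, hk₂, hxy⟩ := exists_primitive (a := a₁) (b := a₂) (by
    by_contra! h
    rw [h.1, h.2] at hγ
    omega)
  by_cases hk1 : k = 1
  swap
  · have hk2 : 2 ≤ k := by omega
    have e₁ : γ = k * (a₁' * b₂ - a₂' * b₁) := by rw [hγ, hk₁, hk₂]; ring
    have e₂ : β = k * (c₁ * a₂' - c₂ * a₁') := by rw [hβ, hk₁, hk₂]; ring
    refine ih D a₁' a₂' b₁ b₂ c₁ c₂ hD h0
      (hD 1 (k - 1) 0 k _ _ ha h0 h0 (by omega) (by omega) le_rfl hk (by omega) (by linarith)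
        (by linarith)) hb hc ?_ ?_ ?_ ?_
    · by_contra! h; nlinarith
    · omega
    · by_contra! h; nlinarith
    · have p₁ : 0 < a₁' * b₂ - a₂' * b₁ := by by_contra! h; nlinarith
      have p₂ : 0 < c₁ * a₂' - c₂ * a₁' := by by_contra! h; nlinarith
      nlinarith
  rw [hk1, one_mul] at hk₁ hk₂
  subst hk₁ hk₂
  obtain ⟨e₁, e₂, r, hr0, hrγ, he₁, he₂⟩ := exists_neighbour hxy (b₁ := b₁) (b₂ := b₂) (by omega)
  rw [← hγ] at hrγ he₁ he₂
  have heD : D e₁ e₂ := hD r 1 (γ - r - 1) γ _ _ ha hb h0 hr0 (by omega) (by omega) (by omega)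
    (by omega) (by linarith) (by linarith)
  have d₁ : a₁ * e₂ - a₂ * e₁ = 1 := by
    apply mul_left_cancel₀ (by omega : γ ≠ 0)
    linear_combination a₁ * he₂ - a₂ * he₁ - hγ
  have d₂ : e₁ * b₂ - e₂ * b₁ = r := by
    apply mul_left_cancel₀ (by omega : γ ≠ 0)
    linear_combination b₂ * he₁ - b₁ * he₂ - r * hγ
  have d₃ : γ * (e₁ * c₂ - e₂ * c₁) = α - r * β := by
    linear_combination c₂ * he₁ - c₁ * he₂ - hα + r * hβ
  rcases lt_trichotomy (r * β) α with hlt | heq | hgt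
  · have p : 0 < e₁ * c₂ - e₂ * c₁ := by by_contra! h; nlinarith
    refine ih D a₁ a₂ e₁ e₂ c₁ c₂ hD h0 ha heD hc (by omega) p (by omega) ?_
    have : e₁ * c₂ - e₂ * c₁ ≤ α := by nlinarith
    omega
  · by_cases hr : r = γ - 1
    · have f₃ : γ * ((a₁ + b₁ - e₁) * c₂ - (a₂ + b₂ - e₂) * c₁) = r * α - β := by
        rw [hr]
        linear_combination (-c₂) * he₁ + c₁ * he₂ - (γ - 1) * hα + hβ -
          (a₁ * c₂ - a₂ * c₁) * hr
      have f₁ : a₁ * (a₂ + b₂ - e₂) - a₂ * (a₁ + b₁ - e₁) = r := by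
        linear_combination - d₁ - hγ - hr
      have f₂ : (a₁ + b₁ - e₁) * b₂ - (a₂ + b₂ - e₂) * b₁ = 1 := by
        linear_combination - d₂ - hγ - hr
      have hfD : D (a₁ + b₁ - e₁) (a₂ + b₂ - e₂) := by
        refine hD 1 r 0 γ _ _ ha hb h0 (by omega) hr0 le_rfl (by omega) (by omega) ?_ ?_
        · linear_combination - he₁ - a₁ * hr - b₁ * hr
        · linear_combination - he₂ - a₂ * hr - b₂ * hr
      rcases lt_trichotomy (r * α) β with hlt' | heq' | hgt'
      · have p : (a₁ + b₁ - e₁) * c₂ - (a₂ + b₂ - e₂) * c₁ < 0 := by by_contra! h; nlinarith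
        refine ih D (a₁ + b₁ - e₁) (a₂ + b₂ - e₂) b₁ b₂ c₁ c₂ hD h0 hfD hb hc (by omega) (by omega)
          (by linarith) ?_
        nlinarith
      · have hrr : r = 1 := by
          have : r * r = 1 := by
            apply mul_right_cancel₀ hα0.ne'
            linear_combination r * heq' + heq
          nlinarith
        have hγ2 : γ = 2 := by omega
        rw [hrr, one_mul] at heq
        subst heq
        rw [hγ2, hrr] at he₁ he₂
        have c₁' : c₁ = - β * e₁ := by
          apply mul_left_cancel₀ (two_ne_zero (α := ℤ))
          linear_combination β * he₁ + a₁ * hα + b₁ * hβ + c₁ * hγ - c₁ * hγ2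
        have c₂' : c₂ = - β * e₂ := by
          apply mul_left_cancel₀ (two_ne_zero (α := ℤ))
          linear_combination β * he₂ + a₂ * hα + b₂ * hβ + c₂ * hγ - c₂ * hγ2
        by_cases hβ1 : β = 1
        · refine ⟨0, 0, b₁ + c₁, b₂ + c₂, c₁, c₂, ?_, h0, [(1, -1), (-1, -1), (0, 1)],
            by simp [polygons], ?_⟩
          · have : (b₁ + c₁) * c₂ - (b₂ + c₂) * c₁ = 1 := by linear_combination hβ1 - hα
            rw [this]; rfl
          · rw [hβ1] at c₁' c₂'
            have q₁ : a₁ = -b₁ - 2 * c₁ := by linarith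
            have q₂ : a₂ = -b₂ - 2 * c₂ := by linarith
            intro p hp
            simp only [List.mem_cons, List.not_mem_nil, or_false] at hp
            rcases hp with rfl | rfl | rfl
            · convert hb using 1 <;> ring
            · convert ha using 1 <;> linarith
            · convert hc using 1 <;> ring
        · refine ih D a₁ a₂ b₁ b₂ (-e₁) (-e₂) hD h0 ha hb
            (hD 1 (β - 1) 0 β _ _ hc h0 h0 (by omega) (by omega) le_rfl (by omega) (by omega)
              (by linarith) (by linarith)) (by omega) (by linarith) (by linarith) ?_
          have : 2 ≤ β := by omega
          linarith
      · have p : 0 < (a₁ + b₁ - e₁) * c₂ - (a₂ + b₂ - e₂) * c₁ := by by_contra! h; nlinarith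
        refine ih D a₁ a₂ (a₁ + b₁ - e₁) (a₂ + b₂ - e₂) c₁ c₂ hD h0 ha hfD hc
          (by nlinarith) p (by omega) ?_
        nlinarith
    · have hr1 : 0 < r := by by_contra! h; nlinarith
      apply HasPolygon.of_translate (e₁ := e₁) (e₂ := e₂)
      refine ih _ (-e₁) (-e₂) (a₁ - e₁) (a₂ - e₂) (b₁ - e₁) (b₂ - e₂) (hD.translate e₁ e₂)
        (by simpa using heD) (by simpa using h0) (by simpa using ha) (by simpa using hb) ?_ ?_ ?_ ?_
      · linarith
      · have : (a₁ - e₁) * (b₂ - e₂) - (a₂ - e₂) * (b₁ - e₁) = γ - r - 1 := by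
          linear_combination -hγ - d₁ - d₂
        omega
      · linarith
      · linarith
  · have p : e₁ * c₂ - e₂ * c₁ < 0 := by by_contra! h; nlinarith
    have hr1 : 0 < r := by by_contra! h; nlinarith
    refine ih D e₁ e₂ b₁ b₂ c₁ c₂ hD h0 heD hb hc (by omega) (by omega) (by linarith) ?_
    nlinarith

/-- A triangle around the origin contains one of the small polygons. -/
lemma hasPolygon_of_triangle (n : ℕ) {D : ℤ → ℤ → Prop} (hD : PlaneConvex D) (h0 : D 0 0)
    {a₁ a₂ b₁ b₂ c₁ c₂ : ℤ} (ha : D a₁ a₂) (hb : D b₁ b₂) (hc : D c₁ c₂)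
    (hγ : 0 < a₁ * b₂ - a₂ * b₁) (hα : 0 < b₁ * c₂ - b₂ * c₁) (hβ : 0 < c₁ * a₂ - c₂ * a₁)
    (hn : (a₁ * b₂ - a₂ * b₁) + (b₁ * c₂ - b₂ * c₁) + (c₁ * a₂ - c₂ * a₁) ≤ n) :
    HasPolygon D := by
  induction n generalizing D a₁ a₂ b₁ b₂ c₁ c₂ with
  | zero => exfalso; push_cast at hn; omega
  | succ n ih =>
    push_cast at hn
    have step : ∀ (E : ℤ → ℤ → Prop) (p₁ p₂ q₁ q₂ r₁ r₂ : ℤ), PlaneConvex E → E 0 0 → E p₁ p₂ →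
        E q₁ q₂ → E r₁ r₂ → 0 < p₁ * q₂ - p₂ * q₁ → 0 < q₁ * r₂ - q₂ * r₁ → 0 < r₁ * p₂ - r₂ * p₁ →
        (p₁ * q₂ - p₂ * q₁) + (q₁ * r₂ - q₂ * r₁) + (r₁ * p₂ - r₂ * p₁) < n + 1 →
        HasPolygon E :=
      fun E p₁ p₂ q₁ q₂ r₁ r₂ hE e0 ep eq er i₁ i₂ i₃ i => ih hE e0 ep eq er i₁ i₂ i₃ (by omega)
    by_cases h₁ : 2 ≤ a₁ * b₂ - a₂ * b₁
    · exact hasPolygon_of_two_le hD h0 ha hb hc rfl rfl rfl hα hβ h₁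
        fun E p₁ p₂ q₁ q₂ r₁ r₂ hE e0 ep eq er i₁ i₂ i₃ i =>
          step E p₁ p₂ q₁ q₂ r₁ r₂ hE e0 ep eq er i₁ i₂ i₃ (by omega)
    by_cases h₂ : 2 ≤ b₁ * c₂ - b₂ * c₁
    · exact hasPolygon_of_two_le hD h0 hb hc ha rfl rfl rfl hβ hγ h₂
        fun E p₁ p₂ q₁ q₂ r₁ r₂ hE e0 ep eq er i₁ i₂ i₃ i =>
          step E p₁ p₂ q₁ q₂ r₁ r₂ hE e0 ep eq er i₁ i₂ i₃ (by omega)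
    by_cases h₃ : 2 ≤ c₁ * a₂ - c₂ * a₁
    · exact hasPolygon_of_two_le hD h0 hc ha hb rfl rfl rfl hγ hα h₃
        fun E p₁ p₂ q₁ q₂ r₁ r₂ hE e0 ep eq er i₁ i₂ i₃ i =>
          step E p₁ p₂ q₁ q₂ r₁ r₂ hE e0 ep eq er i₁ i₂ i₃ (by omega)
    have e₁ : a₁ * b₂ - a₂ * b₁ = 1 := by omega
    have e₂ : b₁ * c₂ - b₂ * c₁ = 1 := by omega
    have e₃ : c₁ * a₂ - c₂ * a₁ = 1 := by omega
    refine ⟨0, 0, a₁, a₂, b₁, b₂, by rw [e₁]; rfl, h0, [(1, 0), (0, 1), (-1, -1)],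
      by simp [polygons], ?_⟩
    have q₁ : c₁ = -a₁ - b₁ := by linear_combination (-c₁) * e₁ - a₁ * e₂ - b₁ * e₃
    have q₂ : c₂ = -a₂ - b₂ := by linear_combination (-c₂) * e₁ - a₂ * e₂ - b₂ * e₃
    intro p hp
    simp only [List.mem_cons, List.not_mem_nil, or_false] at hp
    rcases hp with rfl | rfl | rfl
    · convert ha using 1 <;> ring
    · convert hb using 1 <;> ring
    · convert hc using 1 <;> linarith

/-- The oriented area of two vectors of the plane. -/
def wedge (a b : ℤ × ℤ) : ℤ := a.1 * b.2 - a.2 * b.1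

lemma wedge_swap (a b : ℤ × ℤ) : wedge b a = -wedge a b := by simp only [wedge]; ring

lemma wedge_pluecker (a b c d : ℤ × ℤ) :
    wedge a b * wedge c d - wedge a c * wedge b d + wedge a d * wedge b c = 0 := by
  simp only [wedge]; ring

lemma exists_least_ratio {α : Type*} {S : Set α} (hS : S.Finite) (hne : S.Nonempty) (p q : α → ℤ)
    (hq : ∀ v ∈ S, 0 < q v) : ∃ b ∈ S, ∀ v ∈ S, p b * q v ≤ p v * q b := by
  obtain ⟨b, hb, h⟩ := Set.exists_min_image S (fun v => (p v : ℚ) / q v) hS hne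
  refine ⟨b, hb, fun v hv => ?_⟩
  have h1 : (0 : ℚ) < q b := by exact_mod_cast hq b hb
  have h2 : (0 : ℚ) < q v := by exact_mod_cast hq v hv
  have := (div_le_div_iff₀ h1 h2).1 (h v hv)
  exact_mod_cast this

namespace PlaneConvex

variable {D : ℤ → ℤ → Prop}

lemma triangle (hD : PlaneConvex D) (h0 : D 0 0) {a b c : ℤ × ℤ} (ha : D a.1 a.2) (hb : D b.1 b.2)
    (hc : D c.1 c.2) (hab : 0 < wedge a b) (hbc : 0 < wedge b c) (hca : 0 < wedge c a) :
    HasPolygon D :=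
  hasPolygon_of_triangle (wedge a b + wedge b c + wedge c a).toNat hD h0 ha hb hc hab hbc hca
    (Int.self_le_toNat _)

lemma of_mul (hD : PlaneConvex D) (h0 : D 0 0) {k a b : ℤ} (hk : 0 < k) (h : D (k * a) (k * b)) :
    D a b :=
  hD 1 (k - 1) 0 k _ _ h h0 h0 (by omega) (by omega) le_rfl hk (by ring) (by ring) (by ring)

/-- Two opposite vectors can be replaced by primitive ones. -/
lemma opposite (hD : PlaneConvex D) (h0 : D 0 0) {u u' q : ℤ × ℤ} (hu : D u.1 u.2)
    (hu' : D u'.1 u'.2) (h : wedge u u' = 0) (hq : wedge u q < 0) (hq' : 0 < wedge u' q) :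
    ∃ k x y : ℤ, ∃ a : ℤ × ℤ, 0 < k ∧ u.1 = k * a.1 ∧ u.2 = k * a.2 ∧ x * a.1 + y * a.2 = 1 ∧
      D a.1 a.2 ∧ D (-a.1) (-a.2) := by
  simp only [wedge] at *
  obtain ⟨k, a₁, a₂, x, y, hk, e₁, e₂, e⟩ := exists_primitive (a := u.1) (b := u.2) (by
    by_contra! hz
    rw [hz.1, hz.2] at hq
    omega)
  have hw : a₁ * u'.2 - a₂ * u'.1 = 0 := by
    apply mul_left_cancel₀ hk.ne'
    rw [e₁, e₂] at h
    linear_combination h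
  have f₁ : u'.1 = (x * u'.1 + y * u'.2) * a₁ := by linear_combination (-u'.1) * e - y * hw
  have f₂ : u'.2 = (x * u'.1 + y * u'.2) * a₂ := by linear_combination (-u'.2) * e + x * hw
  set t := x * u'.1 + y * u'.2
  have ht : t < 0 := by
    rw [e₁, e₂] at hq
    rw [f₁, f₂] at hq'
    have h1 : a₁ * q.2 - a₂ * q.1 < 0 := by by_contra! hc; nlinarith
    by_contra! hc
    nlinarith
  refine ⟨k, x, y, (a₁, a₂), hk, e₁, e₂, e, ?_, ?_⟩
  · exact hD.of_mul h0 hk (by rw [← e₁, ← e₂]; exact hu)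
  · refine hD.of_mul h0 (k := -t) (by omega) ?_
    rw [neg_mul_neg, neg_mul_neg, ← f₁, ← f₂]
    exact hu'

lemma quadruple (hD : PlaneConvex D) (h0 : D 0 0) {u u' p q : ℤ × ℤ} (hu : D u.1 u.2)
    (hu' : D u'.1 u'.2) (hp : D p.1 p.2) (hq : D q.1 q.2) (h : wedge u u' = 0)
    (hup : 0 < wedge u p) (huq : wedge u q < 0) (hup' : wedge u' p < 0) (huq' : 0 < wedge u' q) :
    HasPolygon D := by
  rcases lt_trichotomy (wedge p q) 0 with hlt | heq | hgt
  · exact hD.triangle h0 hq hp hu' (by rw [wedge_swap]; omega) (by rw [wedge_swap]; omega) huq'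
  · obtain ⟨k, x, y, a, hk, a₁, a₂, ha, hDa, hDa'⟩ := hD.opposite h0 hu hu' h huq huq'
    obtain ⟨m, x', y', b, hm, b₁, b₂, hb, hDb, hDb'⟩ := hD.opposite (q := u) h0 hp hq heq
      (by rw [wedge_swap]; omega) (by rw [wedge_swap]; omega)
    have hn : 0 < a.1 * b.2 - a.2 * b.1 := by
      have : wedge u p = (k * m) * (a.1 * b.2 - a.2 * b.1) := by
        simp only [wedge, a₁, a₂, b₁, b₂]; ring
      rw [this] at hup
      exact (mul_pos_iff_of_pos_left (mul_pos hk hm)).1 hup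
    by_cases h1 : a.1 * b.2 - a.2 * b.1 = 1
    · refine ⟨0, 0, a.1, a.2, b.1, b.2, by rw [h1]; rfl, h0, [(1, 0), (0, 1), (-1, 0), (0, -1)],
        by simp [polygons], ?_⟩
      intro v hv
      simp only [List.mem_cons, List.not_mem_nil, or_false] at hv
      rcases hv with rfl | rfl | rfl | rfl
      · convert hDa using 1 <;> ring
      · convert hDb using 1 <;> ring
      · convert hDa' using 1 <;> ring
      · convert hDb' using 1 <;> ring
    · obtain ⟨e₁, e₂, r, hr0, hrn, he₁, he₂⟩ := exists_neighbour ha hn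
      generalize hN : a.1 * b.2 - a.2 * b.1 = n at *
      have hr1 : r ≠ 0 := by
        rintro rfl
        have : n * (x' * e₁ + y' * e₂) = 1 := by linear_combination x' * he₁ + y' * he₂ + hb
        have := Int.eq_one_or_neg_one_of_mul_eq_one this
        omega
      have hDe : D e₁ e₂ := hD r 1 (n - r - 1) n _ _ hDa hDb h0 hr0 (by omega) (by omega) hn
        (by ring) (by linarith) (by linarith)
      refine hD.triangle h0 (a := (e₁, e₂)) (b := (-a.1, -a.2)) (c := (-b.1, -b.2)) hDe hDa' hDb'
        ?_ ?_ ?_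
      · have : wedge (e₁, e₂) (-a.1, -a.2) = 1 := by
          apply mul_left_cancel₀ hn.ne'
          simp only [wedge]
          linear_combination a.1 * he₂ - a.2 * he₁ + hN
        omega
      · simp only [wedge]; linarith
      · have : wedge (-b.1, -b.2) (e₁, e₂) = r := by
          apply mul_left_cancel₀ hn.ne'
          simp only [wedge]
          linear_combination b.2 * he₁ - b.1 * he₂ + r * hN
        omega
  · exact hD.triangle h0 hp hq hu hgt (by rw [wedge_swap]; omega) hup

/-- A lattice polygon with a lattice point in its interior contains one of the small polygons. -/
lemma hasPolygon (hD : PlaneConvex D) (hfin : {p : ℤ × ℤ | D p.1 p.2}.Finite) (h0 : D 0 0)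
    (h : ∀ g₁ g₂ : ℤ, (g₁ ≠ 0 ∨ g₂ ≠ 0) → ∃ v : ℤ × ℤ, D v.1 v.2 ∧ 0 < g₁ * v.1 + g₂ * v.2) :
    HasPolygon D := by
  have h' : ∀ u : ℤ × ℤ, (u.1 ≠ 0 ∨ u.2 ≠ 0) → ∃ v : ℤ × ℤ, D v.1 v.2 ∧ 0 < wedge u v := by
    intro u hu
    obtain ⟨v, hv, hv'⟩ := h (-u.2) u.1 (by omega)
    refine ⟨v, hv, ?_⟩
    simp only [wedge]
    linarith
  have h'' : ∀ u : ℤ × ℤ, (u.1 ≠ 0 ∨ u.2 ≠ 0) → ∃ v : ℤ × ℤ, D v.1 v.2 ∧ wedge u v < 0 := by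
    intro u hu
    obtain ⟨v, hv, hv'⟩ := h u.2 (-u.1) (by omega)
    refine ⟨v, hv, ?_⟩
    simp only [wedge]
    linarith
  obtain ⟨a, ha, ha0⟩ := h 1 0 (by simp)
  have hane : a.1 ≠ 0 ∨ a.2 ≠ 0 := by omega
  have hsq : 0 < a.1 * a.1 + a.2 * a.2 := by nlinarith
  have key : ∀ b v : ℤ × ℤ, (a.1 * a.1 + a.2 * a.2) * wedge b v =
      (a.1 * b.1 + a.2 * b.2) * wedge a v - wedge a b * (a.1 * v.1 + a.2 * v.2) := by
    intro b v
    simp only [wedge]; ring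
  obtain ⟨b, ⟨hb, hab⟩, hbm⟩ := exists_least_ratio (S := {v : ℤ × ℤ | D v.1 v.2 ∧ 0 < wedge a v})
    (hfin.subset fun v hv => hv.1) (h' a hane) (fun v => a.1 * v.1 + a.2 * v.2)
    (fun v => wedge a v) fun v hv => hv.2
  obtain ⟨c, ⟨hc, hac⟩, hcm⟩ := exists_least_ratio (S := {v : ℤ × ℤ | D v.1 v.2 ∧ wedge a v < 0})
    (hfin.subset fun v hv => hv.1) (h'' a hane) (fun v => a.1 * v.1 + a.2 * v.2)
    (fun v => -wedge a v) fun v hv => neg_pos.2 hv.2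
  have hbm' : ∀ v : ℤ × ℤ, D v.1 v.2 → 0 < wedge a v → wedge b v ≤ 0 := by
    intro v hv hav
    have h1 := hbm v ⟨hv, hav⟩
    have h2 := key b v
    by_contra! h3
    nlinarith [mul_pos hsq h3]
  have hcm' : ∀ v : ℤ × ℤ, D v.1 v.2 → wedge a v < 0 → 0 ≤ wedge c v := by
    intro v hv hav
    have h1 := hcm v ⟨hv, hav⟩
    have h2 := key c v
    by_contra! h3
    nlinarith [mul_neg_of_pos_of_neg hsq h3]
  have hne : ∀ u : ℤ × ℤ, wedge a u ≠ 0 → u.1 ≠ 0 ∨ u.2 ≠ 0 := by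
    intro u hu
    by_contra! hz
    simp [wedge, hz] at hu
  rcases lt_trichotomy (wedge b c) 0 with hlt | heq | hgt
  · obtain ⟨v, hv, hbv⟩ := h' b (hne b hab.ne')
    have hp := wedge_pluecker a b c v
    rcases lt_trichotomy (wedge a v) 0 with h1 | h1 | h1
    · have := hcm' v hv h1
      nlinarith [mul_nonneg hab.le this, mul_pos_of_neg_of_neg h1 hlt, mul_neg_of_neg_of_pos hac
        hbv]
    · rw [h1] at hp
      have hvc : 0 < wedge v c := by
        rw [wedge_swap]
        by_contra! h2
        nlinarith [mul_neg_of_neg_of_pos hac hbv, mul_nonneg hab.le (by omega : 0 ≤ wedge c v)]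
      exact hD.quadruple h0 ha hv hb hc h1 hab hac (by rw [wedge_swap]; omega) hvc
    · exact absurd (hbm' v hv h1) (by omega)
  · obtain ⟨d, hd, hbd⟩ := h' b (hne b hab.ne')
    have hp := wedge_pluecker a b c d
    rw [heq] at hp
    have hcd : wedge c d < 0 := by
      by_contra! h2
      nlinarith [mul_neg_of_neg_of_pos hac hbd, mul_nonneg hab.le h2]
    exact hD.quadruple h0 hb hc hd ha heq hbd (by rw [wedge_swap]; omega) hcd
      (by rw [wedge_swap]; omega)
  · exact hD.triangle h0 ha hb hc hab hgt (by rw [wedge_swap]; omega)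

end PlaneConvex

/-- A primitive functional is, up to sign, the third coordinate with respect to some basis. -/
lemma exists_frame {a x : Pt} (h : dot a x = 1) (o : Pt) : ∃ φ : Frame, φ.det * φ.det = 1 ∧
    φ.o = o ∧ dot a φ.c₁ = 0 ∧ dot a φ.c₂ = 0 ∧ dot a φ.c₃ = -1 := by
  obtain ⟨a₁, a₂, a₃⟩ := a
  obtain ⟨x₁, x₂, x₃⟩ := x
  simp only [dot] at h
  by_cases h0 : a₁ ≠ 0 ∨ a₂ ≠ 0
  · obtain ⟨g, a', b', m, n, -, rfl, rfl, hmn⟩ := exists_primitive h0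
    refine ⟨⟨o, (b', -a', 0), (-a₃ * m, -a₃ * n, g), (-x₁, -x₂, -x₃)⟩, ?_, rfl, ?_, ?_, ?_⟩
    · have : Frame.det ⟨o, (b', -a', 0), (-a₃ * m, -a₃ * n, g), (-x₁, -x₂, -x₃)⟩ = 1 := by
        simp only [Frame.det, dot, cross]
        linear_combination h + a₃ * x₃ * hmn
      rw [this]; rfl
    · simp only [dot]; ring
    · simp only [dot]; linear_combination (-a₃ * g) * hmn
    · simp only [dot]; linear_combination -h
  · push Not at h0
    obtain ⟨rfl, rfl⟩ := h0
    refine ⟨⟨o, (1, 0, 0), (0, -a₃, 0), (-x₁, -x₂, -x₃)⟩, ?_, rfl, ?_, ?_, ?_⟩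
    · have : Frame.det ⟨o, (1, 0, 0), (0, -a₃, 0), (-x₁, -x₂, -x₃)⟩ = 1 := by
        simp only [Frame.det, dot, cross]
        linear_combination h
      rw [this]; rfl
    · simp only [dot]; ring
    · simp only [dot]; ring
    · simp only [dot]; linear_combination -h

namespace IsBody

variable {V : Set Pt} {F : Set (Pt × ℤ)}

/-- The facet in the plane of height zero contains one of the small polygons. -/
lemma hasPolygon (B : IsBody V F) (hf : (((0, 0, -1) : Pt), (0 : ℤ)) ∈ F)
    (h0 : ∀ g ∈ F, g ≠ (((0, 0, -1) : Pt), (0 : ℤ)) → 0 < g.2) :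
    HasPolygon fun x y => (x, y, 0) ∈ V := by
  have h0' : ∀ g ∈ F, g ≠ (((0, 0, -1) : Pt), (0 : ℤ)) → dot g.1 0 < g.2 := by
    intro g hg hne
    simpa [dot] using h0 g hg hne
  refine PlaneConvex.hasPolygon ?_ ?_ ?_ ?_
  · intro a₁ a₂ b₁ b₂ c₁ c₂ α β γ N x y ha hb hc hα hβ hγ hN hs hx hy
    rw [B.mem_iff] at *
    intro g hg
    have h1 := mul_le_mul_of_nonneg_left (ha g hg) hα
    have h2 := mul_le_mul_of_nonneg_left (hb g hg) hβ
    have h3 := mul_le_mul_of_nonneg_left (hc g hg) hγ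
    refine le_of_mul_le_mul_left ?_ hN
    have e : N * dot g.1 (x, y, 0) = α * dot g.1 (a₁, a₂, 0) + β * dot g.1 (b₁, b₂, 0) +
        γ * dot g.1 (c₁, c₂, 0) := by
      simp only [dot]
      linear_combination g.1.1 * hx + g.1.2.1 * hy
    rw [e, hs]
    linarith
  · refine B.finite_pts.preimage (f := fun p : ℤ × ℤ => ((p.1, p.2, 0) : Pt)) fun p _ q _ e => ?_
    simp only [Prod.mk.injEq] at e
    exact Prod.ext e.1 e.2.1
  · exact B.facet_pt_mem (f := ((0, 0, -1), 0)) (y := 0) (by simp [dot]) h0'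
  · intro g₁ g₂ hg
    obtain ⟨v, hv, hv0, hgv⟩ := B.exists_tight_gt hf (y := 0) (by simp [dot]) h0'
      (d := (g₁, g₂, 0)) (g := (g₁, g₂, 0)) (by simp [dot])
      (dot_self_pos (by rintro h; simp [Prod.ext_iff] at h; omega))
    have hz : v.2.2 = 0 := by simpa [dot] using hv0
    refine ⟨(v.1, v.2.1), ?_, ?_⟩
    · convert hv using 1
      simp [Prod.ext_iff, hz]
    · simpa [dot] using hgv

/-- Coordinates in which the body lies over a facet that contains one of the small polygons. -/
lemma exists_stack (B : IsBody V F) {K : ℤ} (hK : ∀ f ∈ F, ∀ v ∈ V, f.2 - dot f.1 v ≤ K)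
    {f : Pt × ℤ} (hf : f ∈ F) {v : Pt} (hv : v ∈ V) (hfv : f.2 - dot f.1 v = K) (hK0 : 0 < K) :
    ∃ φ : Frame, φ.det * φ.det = 1 ∧ (∀ x, φ.app x ∈ V → 0 ≤ x.2.2 ∧ x.2.2 ≤ K) ∧
      φ.app 0 ∈ V ∧ (∃ P ∈ polygons, ∀ p ∈ P, φ.app (p.1, p.2, 0) ∈ V) ∧
      ∃ p q, 0 ≤ p ∧ p < K ∧ 0 ≤ q ∧ q < K ∧ φ.app (p, q, K) ∈ V := by
  obtain ⟨y, hy, hy'⟩ := B.facet_pt f hf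
  obtain ⟨x, hx⟩ := B.prim f hf
  obtain ⟨φ, hφ, hφo, h₁, h₂, h₃⟩ := exists_frame hx y
  have B₁ := B.comap hφ
  have hpull : φ.pull f = ((0, 0, -1), 0) := by
    simp only [Frame.pull, h₁, h₂, h₃, hφo, hy, sub_self]
  have hf₁ : (((0, 0, -1) : Pt), (0 : ℤ)) ∈ φ.pull '' F := ⟨f, hf, hpull⟩
  obtain ⟨o₁, o₂, c₁, c₂, d₁, d₂, hd, ho, P, hP, hPV⟩ := B₁.hasPolygon hf₁ (by
    rintro _ ⟨g, hg, rfl⟩ hne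
    have := hy' g hg (by rintro rfl; exact hne hpull)
    simp only [Frame.pull, hφo]
    omega)
  have hheight : ∀ x, φ.app x ∈ V → 0 ≤ x.2.2 ∧ x.2.2 ≤ K := by
    intro x hx
    have e := φ.slack_pull f x
    rw [hpull] at e
    have i₁ := (B.mem_iff _).1 hx f hf
    have i₂ := hK f hf _ hx
    simp only [dot] at e i₁ i₂
    omega
  obtain ⟨w, hw⟩ : ∃ w, φ.app w = v := ⟨_, Frame.app_back hφ v⟩
  have hwK : w.2.2 = K := by
    have e := φ.slack_pull f w
    rw [hpull, hw, hfv] at e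
    simpa [dot] using e
  let D := c₁ * d₂ - c₂ * d₁
  have hD : D * D = 1 := hd
  let p₀ := D * (d₂ * (w.1 - o₁) - d₁ * (w.2.1 - o₂))
  let q₀ := D * (c₁ * (w.2.1 - o₂) - c₂ * (w.1 - o₁))
  let ψ : Frame := ⟨(o₁, o₂, 0), (c₁, c₂, 0), (d₁, d₂, 0),
    ((p₀ / K) * c₁ + (q₀ / K) * d₁, (p₀ / K) * c₂ + (q₀ / K) * d₂, 1)⟩
  have hψ : ∀ x y, ψ.app (x, y, 0) = (o₁ + x * c₁ + y * d₁, o₂ + x * c₂ + y * d₂, 0) := by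
    intro x y
    simp only [ψ, Frame.app, Prod.mk.injEq]
    refine ⟨?_, ?_, ?_⟩ <;> ring
  have hψw : ψ.app (p₀ % K, q₀ % K, K) = w := by
    have e₁ := Int.mul_ediv_add_emod p₀ K
    have e₂ := Int.mul_ediv_add_emod q₀ K
    simp only [ψ, Frame.app, Prod.ext_iff]
    refine ⟨?_, ?_, ?_⟩
    · have hp₀ : p₀ = D * (d₂ * (w.1 - o₁) - d₁ * (w.2.1 - o₂)) := rfl
      have hq₀ : q₀ = D * (c₁ * (w.2.1 - o₂) - c₂ * (w.1 - o₁)) := rfl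
      have hD' : D = c₁ * d₂ - c₂ * d₁ := rfl
      linear_combination c₁ * e₁ + d₁ * e₂ + c₁ * hp₀ + d₁ * hq₀ + (w.1 - o₁) * hD -
        D * (w.1 - o₁) * hD'
    · have hp₀ : p₀ = D * (d₂ * (w.1 - o₁) - d₁ * (w.2.1 - o₂)) := rfl
      have hq₀ : q₀ = D * (c₁ * (w.2.1 - o₂) - c₂ * (w.1 - o₁)) := rfl
      have hD' : D = c₁ * d₂ - c₂ * d₁ := rfl
      linear_combination c₂ * e₁ + d₂ * e₂ + c₂ * hp₀ + d₂ * hq₀ + (w.2.1 - o₂) * hD -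
        D * (w.2.1 - o₂) * hD'
    · rw [hwK]; ring
  refine ⟨φ.comp ψ, ?_, fun x hx => ?_, ?_, ⟨P, hP, fun p hp => ?_⟩, p₀ % K, q₀ % K,
    Int.emod_nonneg _ hK0.ne', Int.emod_lt_of_pos _ hK0, Int.emod_nonneg _ hK0.ne',
    Int.emod_lt_of_pos _ hK0, ?_⟩
  · have : ψ.det = D := by simp only [ψ, Frame.det, dot, cross, D]; ring
    rw [Frame.det_comp, this]
    linear_combination (D * D) * hφ + hD
  · rw [Frame.app_comp] at hx
    have := hheight _ hx
    simpa [ψ, Frame.app] using this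
  · rw [Frame.app_comp, show (0 : Pt) = (0, 0, 0) from rfl, hψ]
    simpa using ho
  · rw [Frame.app_comp, hψ]
    exact hPV p hp
  · rw [Frame.app_comp, hψw, hw]
    exact hv

end IsBody

/-- An affine map that preserves the third coordinate, is given by two vectors on the plane of
height zero, and can only map the point `a` of positive height to `z`. -/
def turn (c d : ℤ × ℤ) (a z : Pt) : Frame :=
  ⟨0, (c.1, c.2, 0), (d.1, d.2, 0), ((z.1 - c.1 * a.1 - d.1 * a.2.1) / a.2.2,
    (z.2.1 - c.2 * a.1 - d.2 * a.2.1) / a.2.2, 1)⟩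

/-- The points of the seed are mapped to points of `P` and to `z`. -/
def turnCheck (P : List (ℤ × ℤ)) (z : Pt) (s : Seed) (φ : Frame) : Bool :=
  decide (s.z.2.2 = z.2.2) && (decide (φ.det * φ.det = 1) && (eqb (φ.app s.z) z &&
    s.base.all fun b => P.any fun p => eqb (φ.app b) (p.1, p.2, 0)))

/-- The point `w` is strictly inside the pyramid with top `z` whose base is given by the
inequalities `n · x ≤ 1`, where `n` is in the list `N`. -/
def strictlyInside (N : List (ℤ × ℤ)) (z w : Pt) : Bool :=
  decide (0 < w.2.2) && (decide (w.2.2 < z.2.2) && N.all fun n =>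
    decide (n.1 * (z.2.2 * w.1 - w.2.2 * z.1) + n.2 * (z.2.2 * w.2.1 - w.2.2 * z.2.1) <
      z.2.2 - w.2.2))

/-- For every top of height between three and nine, one of the points in `W` is strictly inside the
pyramid, or the pyramid is the image of a seed. -/
def covers (P N : List (ℤ × ℤ)) (W : List Pt) (S : List Seed) (T : List ((ℤ × ℤ) × (ℤ × ℤ))) :
    Bool :=
  heights.all fun k => decide (k < 3) || heights.all fun p => decide (k ≤ p) || heights.all fun q =>
    decide (k ≤ q) || (W.any (strictlyInside N (p, q, k)) || S.any fun s => T.any fun t =>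
      turnCheck P (p, q, k) s (turn t.1 t.2 s.z (p, q, k)))

/-- The edge normals of the triangle with vertices `(1, 0)`, `(0, 1)`, `(-1, -1)`. -/
def simplexNormals : List (ℤ × ℤ) := [(1, 1), (-2, 1), (1, -2)]

/-- The edge normals of the square. -/
def squareNormals : List (ℤ × ℤ) := [(1, 1), (-1, 1), (1, -1), (-1, -1)]

/-- The edge normals of the triangle with vertices `(1, -1)`, `(-1, -1)`, `(0, 1)`. -/
def kiteNormals : List (ℤ × ℤ) := [(0, -1), (2, 1), (-2, 1)]

/-- Points close to the base. -/
def lowPoints : List Pt :=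
  [(0, 0, 1), (0, 1, 1), (1, 0, 1), (1, 1, 1), (0, 1, 2), (1, 0, 2), (1, 1, 2), (1, 2, 2),
    (2, 1, 2), (1, 1, 3), (1, 2, 3), (2, 1, 3), (2, 2, 3)]

lemma covers_simplex : covers [(1, 0), (0, 1), (-1, -1)] simplexNormals lowPoints
    [simplex103, simplex123, simplex124, simplex135, simplex136, simplex259]
    [((1, 0), (0, 1)), ((0, 1), (1, 0)), ((1, 0), (-1, -1)), ((-1, -1), (1, 0)),
      ((0, 1), (-1, -1)), ((-1, -1), (0, 1))] = true := by decide +kernel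

lemma covers_square : covers [(1, 0), (0, 1), (-1, 0), (0, -1)] squareNormals lowPoints
    [square113, square124]
    [((1, 0), (0, 1)), ((1, 0), (0, -1)), ((-1, 0), (0, 1)), ((-1, 0), (0, -1)), ((0, 1), (1, 0)),
      ((0, 1), (-1, 0)), ((0, -1), (1, 0)), ((0, -1), (-1, 0))] = true := by decide +kernel

lemma covers_kite : covers [(1, -1), (-1, -1), (0, 1)] kiteNormals lowPoints
    [kite103, kite123, kite134, kite214, kite234, kite245, kite256, kite378]
    [((1, 0), (0, 1)), ((-1, 0), (0, 1))] = true := by decide +kernel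

namespace IsBody

variable {V : Set Pt} {F : Set (Pt × ℤ)}

lemma isModel_of_covers (B : IsBody V F) {z : Pt} (hz : z ∈ V) (h0 : (0 : Pt) ∈ V)
    (hK : ∀ f ∈ F, ∀ v ∈ V, f.2 - dot f.1 v ≤ z.2.2) (hV : ∀ v ∈ V, 0 ≤ v.2.2 ∧ v.2.2 ≤ z.2.2)
    {P N : List (ℤ × ℤ)} {W : List Pt} {S : List Seed} {T : List ((ℤ × ℤ) × (ℤ × ℤ))}
    (hP : ∀ p ∈ P, ((p.1, p.2, 0) : Pt) ∈ V) (hN : ∀ w, strictlyInside N z w = false)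
    (hS : ∀ s ∈ S, s.check = true) (h : covers P N W S T = true)
    (h₁ : 0 ≤ z.1 ∧ z.1 < z.2.2) (h₂ : 0 ≤ z.2.1 ∧ z.2.1 < z.2.2) (h₃ : 3 ≤ z.2.2)
    (h₉ : z.2.2 ≤ 9) : IsModel V := by
  obtain ⟨p, q, k⟩ := z
  simp only at h₁ h₂ h₃ h₉
  simp only [covers, List.all_eq_true, Bool.or_eq_true, decide_eq_true_eq] at h
  have h := ((((h k (mem_heights (by omega) h₉)).resolve_left (by omega)) p
    (mem_heights h₁.1 (by omega))).resolve_left (by omega)) q (mem_heights h₂.1 (by omega))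
  replace h := h.resolve_left (by omega)
  rcases h with h | h
  · obtain ⟨w, -, hw⟩ := List.any_eq_true.1 h
    rw [hN] at hw
    exact absurd hw (by simp)
  · obtain ⟨s, hs, h⟩ := List.any_eq_true.1 h
    obtain ⟨t, -, h⟩ := List.any_eq_true.1 h
    simp only [turnCheck, Bool.and_eq_true, decide_eq_true_eq, eqb_iff, List.all_eq_true,
      List.any_eq_true] at h
    obtain ⟨hk, hdet, hz', hb⟩ := h
    have hφ : ∀ x, ((turn t.1 t.2 s.z (p, q, k)).app x).2.2 = x.2.2 := by
      intro x
      simp [turn, Frame.app]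
    have hφ0 : (turn t.1 t.2 s.z (p, q, k)).app 0 = 0 := by
      simp [turn, Frame.app]
    generalize turn t.1 t.2 s.z (p, q, k) = φ at *
    refine IsModel.of_comap hdet (Seed.isModel (B.comap hdet) (hS s hs) ?_ ?_ ?_)
    · rintro _ ⟨f, hf, rfl⟩ v hv
      rw [Frame.slack_pull, hk]
      exact hK f hf _ hv
    · intro v hv
      have := hV _ hv
      rwa [hφ, ← hk] at this
    · intro a ha
      simp only [Seed.pts, List.mem_append, List.mem_cons, List.not_mem_nil, or_false] at ha
      rcases ha with ha | rfl | rfl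
      · obtain ⟨b, hb, e⟩ := hb a ha
        rw [mem_ofPred_eq, e]
        exact hP b hb
      · rw [mem_ofPred_eq, hφ0]
        exact h0
      · rw [mem_ofPred_eq, hz']
        exact hz

/-- No lattice point is strictly inside a pyramid. -/
lemma strictlyInside_eq_false (B : IsBody V F) {z : Pt} (hz : z ∈ V) {N : List (ℤ × ℤ)}
    (hN : ∀ (a₁ a₂ b X Y m : ℤ), 0 < m → (∀ v ∈ V, v.2.2 = 0 → a₁ * v.1 + a₂ * v.2.1 ≤ b) →
      m * b ≤ a₁ * X + a₂ * Y → (∀ n ∈ N, n.1 * X + n.2 * Y < m) → a₁ = 0 ∧ a₂ = 0 ∧ b = 0)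
    (w : Pt) : strictlyInside N z w = false := by
  rw [Bool.eq_false_iff]
  intro h
  simp only [strictlyInside, Bool.and_eq_true, decide_eq_true_eq, List.all_eq_true] at h
  obtain ⟨hw0, hwz, h⟩ := h
  obtain ⟨f, hf, hfw⟩ := B.free w
  have hfz := (B.mem_iff z).1 hz f hf
  simp only [dot] at hfw hfz
  have i₁ := mul_le_mul_of_nonneg_left hfw (by omega : 0 ≤ z.2.2)
  have i₂ := mul_le_mul_of_nonneg_left hfz hw0.le
  obtain ⟨a₁, a₂, hb⟩ := hN f.1.1 f.1.2.1 f.2 _ _ (z.2.2 - w.2.2) (by omega)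
    (fun v hv h0 => by
      have := (B.mem_iff v).1 hv f hf
      simpa [dot, h0] using this) (by linarith) h
  rw [a₁, a₂, hb] at hfw hfz
  have : f.1.2.2 = 0 := by nlinarith
  exact B.normal_ne hf fun d => by simp [dot, a₁, a₂, this]

lemma strictlyInside_simplex (B : IsBody V F) {z : Pt} (hz : z ∈ V)
    (hP : ∀ p ∈ [((1, 0) : ℤ × ℤ), (0, 1), (-1, -1)], ((p.1, p.2, 0) : Pt) ∈ V) (w : Pt) :
    strictlyInside simplexNormals z w = false := by
  refine B.strictlyInside_eq_false hz (fun a₁ a₂ b X Y m hm h hb hn => ?_) w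
  have h₁ := h _ (hP (1, 0) (by simp)) rfl
  have h₂ := h _ (hP (0, 1) (by simp)) rfl
  have h₃ := h _ (hP (-1, -1) (by simp)) rfl
  have n₁ := hn (1, 1) (by simp [simplexNormals])
  have n₂ := hn (-2, 1) (by simp [simplexNormals])
  have n₃ := hn (1, -2) (by simp [simplexNormals])
  simp only at h₁ h₂ h₃ n₁ n₂ n₃
  have k₁ : 0 ≤ (m - (-2 * X + 1 * Y)) * (b - a₁) := mul_nonneg (by omega) (by omega)
  have k₂ : 0 ≤ (m - (1 * X + -2 * Y)) * (b - a₂) := mul_nonneg (by omega) (by omega)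
  have k₃ : 0 ≤ (m - (1 * X + 1 * Y)) * (b + a₁ + a₂) := mul_nonneg (by omega) (by omega)
  have e₁ : b - a₁ = 0 := (mul_eq_zero.1 (by linarith : (m - (-2 * X + 1 * Y)) * (b - a₁) =
    0)).resolve_left
    (by omega)
  have e₂ : b - a₂ = 0 := (mul_eq_zero.1 (by linarith : (m - (1 * X + -2 * Y)) * (b - a₂) =
    0)).resolve_left
    (by omega)
  have e₃ : b + a₁ + a₂ = 0 := (mul_eq_zero.1 (by linarith : (m - (1 * X + 1 * Y)) * (b + a₁ + a₂) =
    0)).resolve_left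
    (by omega)
  omega

lemma strictlyInside_kite (B : IsBody V F) {z : Pt} (hz : z ∈ V)
    (hP : ∀ p ∈ [((1, -1) : ℤ × ℤ), (-1, -1), (0, 1)], ((p.1, p.2, 0) : Pt) ∈ V) (w : Pt) :
    strictlyInside kiteNormals z w = false := by
  refine B.strictlyInside_eq_false hz (fun a₁ a₂ b X Y m hm h hb hn => ?_) w
  have h₁ := h _ (hP (1, -1) (by simp)) rfl
  have h₂ := h _ (hP (-1, -1) (by simp)) rfl
  have h₃ := h _ (hP (0, 1) (by simp)) rfl
  have n₁ := hn (0, -1) (by simp [kiteNormals])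
  have n₂ := hn (2, 1) (by simp [kiteNormals])
  have n₃ := hn (-2, 1) (by simp [kiteNormals])
  simp only at h₁ h₂ h₃ n₁ n₂ n₃
  have k₁ : 0 ≤ (m - (-2 * X + 1 * Y)) * (b - a₁ + a₂) := mul_nonneg (by omega) (by omega)
  have k₂ : 0 ≤ (m - (2 * X + 1 * Y)) * (b + a₁ + a₂) := mul_nonneg (by omega) (by omega)
  have k₃ : 0 ≤ (m + Y) * (b - a₂) := mul_nonneg (by omega) (by omega)
  have e₁ : b - a₁ + a₂ = 0 := (mul_eq_zero.1 (by linarith :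
    (m - (-2 * X + 1 * Y)) * (b - a₁ + a₂) = 0)).resolve_left (by omega)
  have e₂ : b + a₁ + a₂ = 0 := (mul_eq_zero.1 (by linarith :
    (m - (2 * X + 1 * Y)) * (b + a₁ + a₂) = 0)).resolve_left (by omega)
  have e₃ : b - a₂ = 0 := (mul_eq_zero.1 (by linarith : (m + Y) * (b - a₂) = 0)).resolve_left
    (by omega)
  omega

lemma strictlyInside_square (B : IsBody V F) {z : Pt} (hz : z ∈ V)
    (hP : ∀ p ∈ [((1, 0) : ℤ × ℤ), (0, 1), (-1, 0), (0, -1)], ((p.1, p.2, 0) : Pt) ∈ V) (w : Pt) :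
    strictlyInside squareNormals z w = false := by
  refine B.strictlyInside_eq_false hz (fun a₁ a₂ b X Y m hm h hb hn => ?_) w
  have h₁ := h _ (hP (1, 0) (by simp)) rfl
  have h₂ := h _ (hP (0, 1) (by simp)) rfl
  have h₃ := h _ (hP (-1, 0) (by simp)) rfl
  have h₄ := h _ (hP (0, -1) (by simp)) rfl
  have n₁ := hn (1, 1) (by simp [squareNormals])
  have n₂ := hn (-1, 1) (by simp [squareNormals])
  have n₃ := hn (1, -1) (by simp [squareNormals])
  have n₄ := hn (-1, -1) (by simp [squareNormals])
  simp only at h₁ h₂ h₃ h₄ n₁ n₂ n₃ n₄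
  have hX : a₁ * X ≤ b * |X| := by
    rcases abs_cases X with ⟨e, _⟩ | ⟨e, _⟩ <;> rw [e] <;> nlinarith
  have hY : a₂ * Y ≤ b * |Y| := by
    rcases abs_cases Y with ⟨e, _⟩ | ⟨e, _⟩ <;> rw [e] <;> nlinarith
  have hs : |X| + |Y| < m := by
    rcases abs_cases X with ⟨e, _⟩ | ⟨e, _⟩ <;> rcases abs_cases Y with ⟨e', _⟩ | ⟨e', _⟩ <;> omega
  have : b ≤ 0 := by
    by_contra! hc
    nlinarith
  omega

/-- A body that contains a small polygon at height zero and a point at height at least three. -/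
lemma isModel_of_stack (B : IsBody V F) {z : Pt} (hz : z ∈ V) (h0 : (0 : Pt) ∈ V)
    (hK : ∀ f ∈ F, ∀ v ∈ V, f.2 - dot f.1 v ≤ z.2.2) (hV : ∀ v ∈ V, 0 ≤ v.2.2 ∧ v.2.2 ≤ z.2.2)
    {P : List (ℤ × ℤ)} (hP : P ∈ polygons) (hPV : ∀ p ∈ P, ((p.1, p.2, 0) : Pt) ∈ V)
    (h₁ : 0 ≤ z.1 ∧ z.1 < z.2.2) (h₂ : 0 ≤ z.2.1 ∧ z.2.1 < z.2.2) (h₃ : 3 ≤ z.2.2) :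
    IsModel V := by
  simp only [polygons, List.mem_cons, List.not_mem_nil, or_false] at hP
  have away : ∀ {N : List (ℤ × ℤ)}, (∀ w, strictlyInside N z w = false) → ∀ i j h : ℤ, 0 < h →
      h < z.2.2 → ¬ ∀ n ∈ N, n.1 * (z.2.2 * i - h * z.1) + n.2 * (z.2.2 * j - h * z.2.1) <
        z.2.2 - h := by
    intro N hN i j h hh hh' hn
    have := hN (i, j, h)
    rw [Bool.eq_false_iff] at this
    apply this
    simp only [strictlyInside, Bool.and_eq_true, decide_eq_true_eq, List.all_eq_true]
    exact ⟨hh, hh', hn⟩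
  rcases hP with rfl | rfl | rfl
  · have hN := B.strictlyInside_simplex hz hPV
    refine B.isModel_of_covers hz h0 hK hV hPV hN ?_ covers_simplex h₁ h₂ h₃ ?_
    · simp [simplex103_check, simplex123_check, simplex124_check, simplex135_check,
        simplex136_check, simplex259_check]
    · by_contra! h₉
      have H := away hN
      simp only [simplexNormals, List.forall_mem_cons, List.not_mem_nil, false_imp_iff,
        forall_const, and_true] at H
      have a₁ := H 0 0 1 (by omega) (by omega)
      have a₂ := H 0 1 1 (by omega) (by omega)
      have a₃ := H 1 0 1 (by omega) (by omega)
      have a₄ := H 1 1 1 (by omega) (by omega)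
      have a₅ := H 1 2 3 (by omega) (by omega)
      have a₆ := H 2 1 3 (by omega) (by omega)
      omega
  · have hN := B.strictlyInside_square hz hPV
    refine B.isModel_of_covers hz h0 hK hV hPV hN ?_ covers_square h₁ h₂ h₃ ?_
    · simp [square113_check, square124_check]
    · by_contra! h₉
      have H := away hN
      simp only [squareNormals, List.forall_mem_cons, List.not_mem_nil, false_imp_iff,
        forall_const, and_true] at H
      have a₁ := H 0 0 1 (by omega) (by omega)
      have a₂ := H 0 1 1 (by omega) (by omega)
      have a₃ := H 1 0 1 (by omega) (by omega)
      have a₄ := H 1 1 1 (by omega) (by omega)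
      have a₅ := H 1 1 2 (by omega) (by omega)
      omega
  · have hN := B.strictlyInside_kite hz hPV
    refine B.isModel_of_covers hz h0 hK hV hPV hN ?_ covers_kite h₁ h₂ h₃ ?_
    · simp [kite103_check, kite123_check, kite134_check, kite214_check, kite234_check,
        kite245_check, kite256_check, kite378_check]
    · by_contra! h₉
      have H := away hN
      simp only [kiteNormals, List.forall_mem_cons, List.not_mem_nil, false_imp_iff,
        forall_const, and_true] at H
      have a₁ := H 0 0 1 (by omega) (by omega)
      have a₂ := H 0 1 1 (by omega) (by omega)
      have a₃ := H 1 0 1 (by omega) (by omega)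
      have a₄ := H 1 1 1 (by omega) (by omega)
      have a₅ := H 1 0 2 (by omega) (by omega)
      have a₆ := H 1 2 2 (by omega) (by omega)
      omega

/-- The classification of bodies. -/
theorem isModel (B : IsBody V F) : IsModel V := by
  obtain ⟨⟨f, v⟩, ⟨hf, hv⟩, hm⟩ := Set.exists_max_image (F ×ˢ V) (fun x => x.1.2 - dot x.1.1 x.2)
    (B.finite_facets.prod B.finite_pts) (B.nonempty_facets.prod B.nonempty_pts)
  simp only at hf hv hm
  have hK : ∀ g ∈ F, ∀ w ∈ V, g.2 - dot g.1 w ≤ f.2 - dot f.1 v := fun g hg w hw =>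
    hm (g, w) ⟨hg, hw⟩
  by_cases h3 : f.2 - dot f.1 v ≤ 2
  · exact B.isModel_of_width_two fun g hg w hw => (hK g hg w hw).trans h3
  push Not at h3
  obtain ⟨φ, hφ, hz, h0, ⟨P, hP, hPV⟩, p, q, hp, hp', hq, hq', ht⟩ :=
    B.exists_stack hK hf hv rfl (by omega)
  refine IsModel.of_comap hφ ((B.comap hφ).isModel_of_stack (z := (p, q, f.2 - dot f.1 v)) ht h0 ?_
    hz hP hPV ⟨hp, hp'⟩ ⟨hq, hq'⟩ h3)
  rintro _ ⟨g, hg, rfl⟩ w hw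
  rw [Frame.slack_pull]
  exact hK g hg _ hw

end IsBody

/-- The solution set of a finite system of linear inequalities. -/
def sol (S : Finset ((Fin 3 → ℝ) × ℝ)) : Set (Fin 3 → ℝ) := {x | ∀ c ∈ S, dotProduct c.1 x ≤ c.2}

lemma mem_sol {S : Finset ((Fin 3 → ℝ) × ℝ)} {x : Fin 3 → ℝ} :
    x ∈ sol S ↔ ∀ c ∈ S, dotProduct c.1 x ≤ c.2 := Iff.rfl

lemma convex_sol (S : Finset ((Fin 3 → ℝ) × ℝ)) : Convex ℝ (sol S) := by
  intro x hx y hy a b ha hb hab c hc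
  rw [dotProduct_add, dotProduct_smul, dotProduct_smul, smul_eq_mul, smul_eq_mul]
  have h₁ := mul_le_mul_of_nonneg_left (hx c hc) ha
  have h₂ := mul_le_mul_of_nonneg_left (hy c hc) hb
  have : a * c.2 + b * c.2 = c.2 := by rw [← add_mul, hab, one_mul]
  linarith

lemma exists_irredundant {P : Set (Fin 3 → ℝ)} (h : IsPolyhedron P) :
    ∃ S, P = sol S ∧ ∀ c ∈ S, sol (S.erase c) ≠ P := by
  classical
  have hex : ∃ n, ∃ S : Finset ((Fin 3 → ℝ) × ℝ), S.card = n ∧ P = sol S := by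
    obtain ⟨n, A, b, rfl⟩ := h
    refine ⟨_, Finset.univ.image fun i => (A i, b i), rfl, ?_⟩
    ext x
    simp [sol, dotProduct]
  obtain ⟨S, hS, hP⟩ := Nat.find_spec hex
  refine ⟨S, hP, fun c hc hcon => ?_⟩
  refine Nat.find_min hex (m := (S.erase c).card) ?_ ⟨_, rfl, hcon.symm⟩
  rw [← hS]
  exact Finset.card_erase_lt_of_mem hc

lemma dotProduct_self_pos' {a : Fin 3 → ℝ} (h : a ≠ 0) : 0 < dotProduct a a := by
  have h1 : 0 ≤ dotProduct a a := Finset.sum_nonneg fun i _ => mul_self_nonneg _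
  exact lt_of_le_of_ne h1 fun e => h (dotProduct_self_eq_zero.1 e.symm)

/-- Interior points can be moved a bit in every direction. -/
lemma exists_add_smul_mem {S : Set (Fin 3 → ℝ)} {x : Fin 3 → ℝ} (hx : S ∈ nhds x)
    (d : Fin 3 → ℝ) : ∃ t : ℝ, 0 < t ∧ x + t • d ∈ S := by
  have hc : ContinuousAt (fun t : ℝ => x + t • d) 0 := by fun_prop
  have h0 : x + (0 : ℝ) • d = x := by simp
  have hev : ∀ᶠ t in nhds (0 : ℝ), x + t • d ∈ S := hc (by simpa [h0] using hx)
  obtain ⟨t, ht, ht0⟩ := ((hev.filter_mono nhdsWithin_le_nhds).and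
    (self_mem_nhdsWithin : Ioi (0 : ℝ) ∈ nhdsWithin 0 (Ioi 0))).exists
  exact ⟨t, ht0, ht⟩

lemma isOpen_strict (S : Finset ((Fin 3 → ℝ) × ℝ)) :
    IsOpen {x : Fin 3 → ℝ | ∀ c ∈ S, dotProduct c.1 x < c.2} := by
  simp only [Set.ofPred_forall]
  exact isOpen_biInter_finset fun c _ =>
    isOpen_lt (continuous_const.dotProduct continuous_id) continuous_const

lemma mem_interior_sol {S : Finset ((Fin 3 → ℝ) × ℝ)} (h : ∀ c ∈ S, c.1 ≠ 0) {x : Fin 3 → ℝ} :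
    x ∈ interior (sol S) ↔ ∀ c ∈ S, dotProduct c.1 x < c.2 := by
  constructor
  · intro hx c hc
    obtain ⟨t, ht, hm⟩ := exists_add_smul_mem (mem_interior_iff_mem_nhds.1 hx) c.1
    have := hm c hc
    rw [dotProduct_add, dotProduct_smul, smul_eq_mul] at this
    have := mul_pos ht (dotProduct_self_pos' (h c hc))
    linarith
  · intro hx
    exact interior_maximal (fun y hy c hc => (hy c hc).le) (isOpen_strict S) hx

lemma normal_ne_zero {P : Set (Fin 3 → ℝ)} {S : Finset ((Fin 3 → ℝ) × ℝ)} (hP : P = sol S)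
    (hS : ∀ c ∈ S, sol (S.erase c) ≠ P) (hne : P.Nonempty) : ∀ c ∈ S, c.1 ≠ 0 := by
  intro c hc h0
  apply hS c hc
  obtain ⟨x, hx⟩ := hne
  rw [hP] at hx ⊢
  have := hx c hc
  rw [h0, zero_dotProduct] at this
  refine Subset.antisymm (fun y hy d hd => ?_) fun y hy d hd => hy d (Finset.mem_of_mem_erase hd)
  by_cases e : d = c
  · rw [e, h0, zero_dotProduct]
    exact this
  · exact hy d (Finset.mem_erase.2 ⟨e, hd⟩)

/-- A lattice point as a point of real space. -/
def toR (v : Pt) : Fin 3 → ℝ := ![v.1, v.2.1, v.2.2]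

lemma toR_mem_intPts (v : Pt) : toR v ∈ intPts 3 := by
  intro i
  fin_cases i
  · exact ⟨v.1, rfl⟩
  · exact ⟨v.2.1, rfl⟩
  · exact ⟨v.2.2, rfl⟩

lemma exists_toR {x : Fin 3 → ℝ} (h : x ∈ intPts 3) : ∃ v, toR v = x := by
  choose z hz using h
  refine ⟨(z 0, z 1, z 2), ?_⟩
  ext i
  fin_cases i
  · exact (hz 0).symm
  · exact (hz 1).symm
  · exact (hz 2).symm

lemma toR_dot (u v : Pt) : dotProduct (toR u) (toR v) = (dot u v : ℝ) := by
  simp [dotProduct, Fin.sum_univ_three, toR, dot]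

lemma toR_sub (u v : Pt) : toR (sub u v) = toR u - toR v := by
  ext i
  fin_cases i <;> simp [toR, sub]

lemma finite_of_isBounded {Q : Set (Fin 3 → ℝ)} (h : Bornology.IsBounded Q) :
    {v : Pt | toR v ∈ Q}.Finite := by
  obtain ⟨R, hR⟩ := h.subset_closedBall 0
  have hco : ∀ v ∈ {v : Pt | toR v ∈ Q}, ∀ i, |toR v i| ≤ R := by
    intro v hv i
    have := mem_closedBall_zero_iff.1 (hR hv)
    exact (norm_le_pi_norm (toR v) i).trans this
  have hI : ∀ a : ℤ, |(a : ℝ)| ≤ R → a ∈ Icc (-⌈R⌉) ⌈R⌉ := by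
    intro a ha
    have h1 := (abs_le.1 ha).1
    have h2 := (abs_le.1 ha).2
    have h3 := Int.le_ceil R
    constructor
    · have : (-⌈R⌉ : ℝ) ≤ a := by linarith
      exact_mod_cast this
    · have : (a : ℝ) ≤ ⌈R⌉ := by linarith
      exact_mod_cast this
  refine ((finite_Icc (-⌈R⌉) ⌈R⌉).prod ((finite_Icc (-⌈R⌉) ⌈R⌉).prod
    (finite_Icc (-⌈R⌉) ⌈R⌉))).subset fun v hv => ⟨?_, ?_, ?_⟩
  · exact hI _ (hco v hv 0)
  · exact hI _ (hco v hv 1)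
  · exact hI _ (hco v hv 2)

section

variable {P : Set (Fin 3 → ℝ)} {S : Finset ((Fin 3 → ℝ) × ℝ)}

/-- The system with one relaxed inequality. -/
noncomputable def relax (S : Finset ((Fin 3 → ℝ) × ℝ)) (c : (Fin 3 → ℝ) × ℝ) (ε : ℝ) :
    Finset ((Fin 3 → ℝ) × ℝ) :=
  open Classical in insert (c.1, c.2 + ε) (S.erase c)

lemma mem_sol_relax {c : (Fin 3 → ℝ) × ℝ} {ε : ℝ} {x : Fin 3 → ℝ} : x ∈ sol (relax S c ε) ↔
    dotProduct c.1 x ≤ c.2 + ε ∧ ∀ d ∈ S, d ≠ c → dotProduct d.1 x ≤ d.2 := by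
  simp only [relax, mem_sol, Finset.forall_mem_insert, Finset.mem_erase]
  refine and_congr_right fun _ => ⟨fun h d hd hdc => h d ⟨hdc, hd⟩, fun h d hd => h d hd.2 hd.1⟩

lemma isBounded_relax (hb : Bornology.IsBounded (sol S)) {c : (Fin 3 → ℝ) × ℝ} {x₀ : Fin 3 → ℝ}
    (hx₀ : ∀ c ∈ S, dotProduct c.1 x₀ < c.2) (hc : c ∈ S) :
    Bornology.IsBounded (sol (relax S c 1)) := by
  have hδ : 0 < c.2 - dotProduct c.1 x₀ := sub_pos.2 (hx₀ c hc)
  generalize hD : c.2 - dotProduct c.1 x₀ = δ at hδ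
  obtain ⟨R, hR⟩ := hb.subset_closedBall x₀
  refine (Metric.isBounded_closedBall (x := x₀) (r := (δ + 1) / δ * R)).subset fun x hx => ?_
  rw [mem_sol_relax] at hx
  have ht : 0 < δ / (δ + 1) := by positivity
  have ht1 : δ / (δ + 1) ≤ 1 := by rw [div_le_one (by positivity)]; linarith
  have hm : x₀ + (δ / (δ + 1)) • (x - x₀) ∈ sol S := by
    intro d hd
    rw [dotProduct_add, dotProduct_smul, dotProduct_sub, smul_eq_mul]
    by_cases e : d = c
    · rw [e]
      have : δ / (δ + 1) * (dotProduct c.1 x - dotProduct c.1 x₀) ≤ δ / (δ + 1) * (δ + 1) :=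
        mul_le_mul_of_nonneg_left (by linarith [hx.1]) ht.le
      rw [div_mul_cancel₀ _ (by positivity)] at this
      linarith
    · have h1 := hx.2 d hd e
      have h2 := hx₀ d hd
      nlinarith
  have h1 := hR hm
  rw [mem_closedBall_iff_norm, add_sub_cancel_left, norm_smul, Real.norm_of_nonneg ht.le] at h1
  rw [mem_closedBall_iff_norm]
  have h2 : (δ + 1) / δ * (δ / (δ + 1) * ‖x - x₀‖) ≤ (δ + 1) / δ * R :=
    mul_le_mul_of_nonneg_left h1 (by positivity)
  have h3 : (δ + 1) / δ * (δ / (δ + 1) * ‖x - x₀‖) = ‖x - x₀‖ := by field_simp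
  rwa [h3] at h2

/-- Relaxing an inequality creates interior lattice points. -/
lemma exists_lattice_relax (hS : ∀ c ∈ S, sol (S.erase c) ≠ sol S) (h0 : ∀ c ∈ S, c.1 ≠ 0)
    (hfree : interior (sol S) ∩ intPts 3 = ∅)
    (hmax : ∀ K, Convex ℝ K → interior K ∩ intPts 3 = ∅ → sol S ⊆ K → sol S = K)
    (hne : (sol S).Nonempty) {c : (Fin 3 → ℝ) × ℝ} (hc : c ∈ S) {ε : ℝ} (hε : 0 < ε) :
    ∃ y : Pt, c.2 ≤ dotProduct c.1 (toR y) ∧ dotProduct c.1 (toR y) < c.2 + ε ∧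
      ∀ d ∈ S, d ≠ c → dotProduct d.1 (toR y) < d.2 := by
  classical
  have hsub : sol S ⊆ sol (relax S c ε) := fun x hx => mem_sol_relax.2
    ⟨by linarith [hx c hc], fun d hd _ => hx d hd⟩
  have hne' : sol S ≠ sol (relax S c ε) := by
    intro heq
    apply hS c hc
    refine Subset.antisymm (fun x hx => ?_) fun y hy d hd => hy d (Finset.mem_of_mem_erase hd)
    have hx' : ∀ d ∈ S, d ≠ c → dotProduct d.1 x ≤ d.2 := fun d hd hdc =>
      hx d (Finset.mem_erase.2 ⟨hdc, hd⟩)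
    by_contra hcon
    have hcx : c.2 < dotProduct c.1 x := by
      by_contra! hle
      apply hcon
      intro d hd
      by_cases e : d = c
      · rw [e]; exact hle
      · exact hx' d hd e
    obtain ⟨p, hp⟩ := hne
    have hpc := hp c hc
    set A := dotProduct c.1 x with hA
    set B := dotProduct c.1 p with hB
    have hAB : 0 < A - B := by linarith
    set s := min 1 ((c.2 + ε - B) / (A - B)) with hs
    have hs0 : 0 < s := lt_min one_pos (div_pos (by linarith) hAB)
    have hs1 : s ≤ 1 := min_le_left _ _
    have hval : c.2 < B + s * (A - B) ∧ B + s * (A - B) ≤ c.2 + ε := by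
      constructor
      · rcases min_choice 1 ((c.2 + ε - B) / (A - B)) with h | h
        · rw [hs, h]; linarith
        · rw [hs, h, div_mul_cancel₀ _ hAB.ne']; linarith
      · have : s * (A - B) ≤ (c.2 + ε - B) / (A - B) * (A - B) :=
          mul_le_mul_of_nonneg_right (min_le_right _ _) hAB.le
        rw [div_mul_cancel₀ _ hAB.ne'] at this
        linarith
    have hdot : ∀ d : Fin 3 → ℝ, dotProduct d (p + s • (x - p)) =
        dotProduct d p + s * (dotProduct d x - dotProduct d p) := by
      intro d
      rw [dotProduct_add, dotProduct_smul, dotProduct_sub, smul_eq_mul]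
    have hmem : p + s • (x - p) ∈ sol (relax S c ε) := by
      refine mem_sol_relax.2 ⟨?_, fun d hd hdc => ?_⟩
      · rw [hdot]; exact hval.2
      · rw [hdot]
        have h1 := hx' d hd hdc
        have h2 := hp d hd
        nlinarith
    rw [← heq] at hmem
    have := hmem c hc
    rw [hdot] at this
    linarith [hval.1]
  have h_int : (interior (sol (relax S c ε)) ∩ intPts 3).Nonempty := by
    rw [nonempty_iff_ne_empty]
    exact fun he => hne' (hmax _ (convex_sol _) he hsub)
  obtain ⟨y, hy, hyZ⟩ := h_int
  obtain ⟨v, rfl⟩ := exists_toR hyZ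
  have h0' : ∀ d ∈ relax S c ε, d.1 ≠ 0 := by
    intro d hd
    rcases Finset.mem_insert.1 hd with rfl | hd
    · exact h0 c hc
    · exact h0 d (Finset.mem_of_mem_erase hd)
  rw [mem_interior_sol h0'] at hy
  have hothers : ∀ d ∈ S, d ≠ c → dotProduct d.1 (toR v) < d.2 := fun d hd hdc =>
    hy d (Finset.mem_insert_of_mem (Finset.mem_erase.2 ⟨hdc, hd⟩))
  refine ⟨v, ?_, hy _ (Finset.mem_insert_self _ _), hothers⟩
  by_contra! hlt
  have : toR v ∈ interior (sol S) ∩ intPts 3 := by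
    refine ⟨(mem_interior_sol h0).2 fun d hd => ?_, hyZ⟩
    by_cases e : d = c
    · rw [e]; exact hlt
    · exact hothers d hd e
  rw [hfree] at this
  exact this

/-- Every facet contains a lattice point in its relative interior. -/
lemma exists_lattice_facet (hS : ∀ c ∈ S, sol (S.erase c) ≠ sol S) (h0 : ∀ c ∈ S, c.1 ≠ 0)
    (hb : Bornology.IsBounded (sol S)) (hi : (interior (sol S)).Nonempty)
    (hfree : interior (sol S) ∩ intPts 3 = ∅)
    (hmax : ∀ K, Convex ℝ K → interior K ∩ intPts 3 = ∅ → sol S ⊆ K → sol S = K)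
    {c : (Fin 3 → ℝ) × ℝ} (hc : c ∈ S) :
    ∃ y : Pt, dotProduct c.1 (toR y) = c.2 ∧ ∀ d ∈ S, d ≠ c → dotProduct d.1 (toR y) < d.2 := by
  obtain ⟨x₀, hx₀⟩ := hi
  have hne : (sol S).Nonempty := ⟨x₀, interior_subset hx₀⟩
  rw [mem_interior_sol h0] at hx₀
  have hfin : {y : Pt | c.2 ≤ dotProduct c.1 (toR y) ∧ dotProduct c.1 (toR y) < c.2 + 1 ∧
      ∀ d ∈ S, d ≠ c → dotProduct d.1 (toR y) < d.2}.Finite :=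
    (finite_of_isBounded (isBounded_relax hb hx₀ hc)).subset fun y hy =>
      mem_sol_relax.2 ⟨hy.2.1.le, fun d hd hdc => (hy.2.2 d hd hdc).le⟩
  obtain ⟨y, ⟨hy₁, hy₂, hy₃⟩, hmin⟩ := Set.exists_min_image _ (fun y => dotProduct c.1 (toR y)) hfin
    (exists_lattice_relax hS h0 hfree hmax hne hc one_pos)
  refine ⟨y, ?_, hy₃⟩
  by_contra hcon
  have hlt : c.2 < dotProduct c.1 (toR y) := lt_of_le_of_ne hy₁ (Ne.symm hcon)
  obtain ⟨z, hz₁, hz₂, hz₃⟩ := exists_lattice_relax hS h0 hfree hmax hne hc (sub_pos.2 hlt)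
  have := hmin z ⟨hz₁, by linarith, hz₃⟩
  linarith

end

section

variable {S : Finset ((Fin 3 → ℝ) × ℝ)} {c : (Fin 3 → ℝ) × ℝ} {y : Pt}

/-- From a lattice point in the relative interior of a facet of an integral polytope one can move
to a lattice point of the facet that is further in a given direction. -/
lemma exists_further (hconv : sol S = convexHull ℝ (toR '' {v | toR v ∈ sol S}))
    (hb : Bornology.IsBounded (sol S)) (hyc : dotProduct c.1 (toR y) = c.2)
    (hy : ∀ d ∈ S, d ≠ c → dotProduct d.1 (toR y) < d.2) {w : Fin 3 → ℝ} (hw : w ≠ 0)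
    (hcS : c ∈ S) (hcw : dotProduct c.1 w = 0) :
    ∃ v : Pt, dotProduct c.1 (toR v) = c.2 ∧ dotProduct w (toR y) < dotProduct w (toR v) := by
  classical
  by_contra! hcon
  obtain ⟨M, hM⟩ := ((finite_of_isBounded hb).image fun v =>
    (dotProduct w (toR v) - dotProduct w (toR y)) / (c.2 - dotProduct c.1 (toR v))).bddAbove
  have hsub : sol S ⊆ sol {(w + M • c.1, dotProduct w (toR y) + M * c.2)} := by
    rw [hconv]
    refine convexHull_min ?_ (convex_sol _)
    rintro _ ⟨v, hv, rfl⟩ d hd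
    rw [Finset.mem_singleton.1 hd, add_dotProduct, smul_dotProduct, smul_eq_mul]
    have hvc : dotProduct c.1 (toR v) ≤ c.2 := hv c hcS
    rcases hvc.eq_or_lt with h | h
    · rw [h]
      linarith [hcon v h]
    · have := hM ⟨v, hv, rfl⟩
      rw [div_le_iff₀ (sub_pos.2 h)] at this
      linarith
  obtain ⟨t, ht, hmem⟩ := exists_add_smul_mem ((isOpen_strict (S.erase c)).mem_nhds
    (fun d hd => hy d (Finset.mem_of_mem_erase hd) (Finset.ne_of_mem_erase hd))) w
  have hin : toR y + t • w ∈ sol S := by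
    intro d hd
    by_cases e : d = c
    · rw [e, dotProduct_add, dotProduct_smul, hcw, hyc, smul_zero, add_zero]
    · exact (hmem d (Finset.mem_erase.2 ⟨e, hd⟩)).le
  have := hsub hin _ (Finset.mem_singleton_self _)
  simp only [dotProduct_add, add_dotProduct, smul_dotProduct, dotProduct_smul, smul_eq_mul, hcw,
    hyc] at this
  have := mul_pos ht (dotProduct_self_pos' hw)
  linarith

lemma exists_orthogonal (a : Fin 3 → ℝ) : ∃ w, w ≠ 0 ∧ dotProduct a w = 0 := by
  by_cases h : a 0 = 0
  · refine ⟨![1, 0, 0], fun e => one_ne_zero (congrFun e 0), ?_⟩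
    simp [dotProduct, Fin.sum_univ_three, h]
  · refine ⟨![-a 1, a 0, 0], fun e => h (congrFun e 1), ?_⟩
    simp [dotProduct, Fin.sum_univ_three]
    ring

/-- A nonzero integer vector is a positive multiple of a primitive one. -/
lemma exists_primitive_vector {u : Pt} (h : u ≠ 0) :
    ∃ (g : ℤ) (u' x : Pt), 0 < g ∧ u = comb g u' 0 0 ∧ dot u' x = 1 := by
  obtain ⟨p, q, r⟩ := u
  by_cases hpq : p ≠ 0 ∨ q ≠ 0
  · obtain ⟨k, a, b, x, y, hk, rfl, rfl, hxy⟩ := exists_primitive hpq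
    obtain ⟨g, k', r', x', y', hg, rfl, rfl, hxy'⟩ :=
      exists_primitive (a := k) (b := r) (Or.inl hk.ne')
    refine ⟨g, (k' * a, k' * b, r'), (x' * x, x' * y, y'), hg, ?_, ?_⟩
    · simp [comb, mul_assoc]
    · simp only [dot]
      linear_combination x' * k' * hxy + hxy'
  · push Not at hpq
    obtain ⟨rfl, rfl⟩ := hpq
    have hr : r ≠ 0 := fun e => h (by rw [e]; rfl)
    obtain ⟨g, r', b, x, y, hg, rfl, hb, hxy⟩ := exists_primitive (a := r) (b := 0) (Or.inl hr)
    have hb0 : b = 0 := by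
      rcases mul_eq_zero.1 hb.symm with h | h
      · exact absurd h hg.ne'
      · exact h
    refine ⟨g, (0, 0, r'), (0, 0, x), hg, by simp [comb], ?_⟩
    simp only [dot]
    rw [hb0] at hxy
    linarith

/-- A nonzero vector that is orthogonal to `l` and `m` is a multiple of their cross product. -/
lemma exists_smul_cross {a : Fin 3 → ℝ} {l m : Pt} (hl : dotProduct a (toR l) = 0)
    (hm : dotProduct a (toR m) = 0) (h : 0 < dotProduct a (toR (cross l m))) :
    ∃ t : ℝ, 0 < t ∧ a = t • toR (cross l m) := by
  have hne : toR (cross l m) ≠ 0 := fun e => by rw [e, dotProduct_zero] at h; exact h.false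
  have hpos := dotProduct_self_pos' hne
  refine ⟨_, div_pos h hpos, ?_⟩
  have key : dotProduct (toR (cross l m)) (toR (cross l m)) • a =
      dotProduct a (toR (cross l m)) • toR (cross l m) := by
    simp only [dotProduct, Fin.sum_univ_three, toR, cross, Matrix.cons_val_zero,
      Matrix.cons_val_one, Matrix.cons_val] at hl hm ⊢
    push_cast
    ext i
    fin_cases i
    · simp
      linear_combination -((l.2.1 * (l.1 * m.2.1 - l.2.1 * m.1) -
        l.2.2 * (l.2.2 * m.1 - l.1 * m.2.2) : ℝ)) * hm +
        ((m.2.1 * (l.1 * m.2.1 - l.2.1 * m.1) - m.2.2 * (l.2.2 * m.1 - l.1 * m.2.2) : ℝ)) * hl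
    · simp
      linear_combination -((l.2.2 * (l.2.1 * m.2.2 - l.2.2 * m.2.1) -
        l.1 * (l.1 * m.2.1 - l.2.1 * m.1) : ℝ)) * hm +
        ((m.2.2 * (l.2.1 * m.2.2 - l.2.2 * m.2.1) - m.1 * (l.1 * m.2.1 - l.2.1 * m.1) : ℝ)) * hl
    · simp
      linear_combination -((l.1 * (l.2.2 * m.1 - l.1 * m.2.2) -
        l.2.1 * (l.2.1 * m.2.2 - l.2.2 * m.2.1) : ℝ)) * hm +
        ((m.1 * (l.2.2 * m.1 - l.1 * m.2.2) - m.2.1 * (l.2.1 * m.2.2 - l.2.2 * m.2.1) : ℝ)) * hl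
  rw [div_eq_inv_mul, mul_smul, ← key, smul_smul, inv_mul_cancel₀ hpos.ne', one_smul]

/-- The facets of an integral polytope with lattice points in their relative interiors have
primitive integer normal vectors. -/
lemma exists_integer_normal (hconv : sol S = convexHull ℝ (toR '' {v | toR v ∈ sol S}))
    (hb : Bornology.IsBounded (sol S)) (h0 : c.1 ≠ 0) (hyc : dotProduct c.1 (toR y) = c.2)
    (hy : ∀ d ∈ S, d ≠ c → dotProduct d.1 (toR y) < d.2) (hcS : c ∈ S) :
    ∃ (u x : Pt) (t : ℝ), 0 < t ∧ c.1 = t • toR u ∧ dot u x = 1 := by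
  obtain ⟨w, hw, hcw⟩ := exists_orthogonal c.1
  obtain ⟨v, hv, hvy⟩ := exists_further hconv hb hyc hy hw hcS hcw
  have hl : dotProduct c.1 (toR (sub v y)) = 0 := by rw [toR_sub, dotProduct_sub, hv, hyc, sub_self]
  have hl0 : toR (sub v y) ≠ 0 := fun e => by
    rw [toR_sub, sub_eq_zero] at e
    rw [e] at hvy
    exact hvy.false
  have hmix : ∀ (a : Fin 3 → ℝ) (l m : Pt), dotProduct
      (![a 1 * toR l 2 - a 2 * toR l 1, a 2 * toR l 0 - a 0 * toR l 2,
        a 0 * toR l 1 - a 1 * toR l 0] : Fin 3 → ℝ) (toR m) = dotProduct a (toR (cross l m)) := by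
    intro a l m
    simp [dotProduct, Fin.sum_univ_three, toR, cross]
    ring
  have hnorm : ∀ a l : Fin 3 → ℝ, (a 1 * l 2 - a 2 * l 1) ^ 2 + (a 2 * l 0 - a 0 * l 2) ^ 2 +
      (a 0 * l 1 - a 1 * l 0) ^ 2 = dotProduct a a * dotProduct l l - dotProduct a l ^ 2 := by
    intro a l
    simp only [dotProduct, Fin.sum_univ_three]
    ring
  obtain ⟨v', hv', hvy'⟩ := exists_further hconv hb hyc hy
    (w := ![c.1 1 * toR (sub v y) 2 - c.1 2 * toR (sub v y) 1,
      c.1 2 * toR (sub v y) 0 - c.1 0 * toR (sub v y) 2,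
      c.1 0 * toR (sub v y) 1 - c.1 1 * toR (sub v y) 0])
    (by
      intro e
      have e0 := congrFun e 0
      have e1 := congrFun e 1
      have e2 := congrFun e 2
      simp only [Matrix.cons_val_zero, Matrix.cons_val_one, Matrix.cons_val, Pi.zero_apply]
        at e0 e1 e2
      have := hnorm c.1 (toR (sub v y))
      rw [e0, e1, e2, hl] at this
      have := mul_pos (dotProduct_self_pos' h0) (dotProduct_self_pos' hl0)
      linarith) hcS (by
      simp [dotProduct, Fin.sum_univ_three]
      ring)
  have hm : dotProduct c.1 (toR (sub v' y)) = 0 := by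
    rw [toR_sub, dotProduct_sub, hv', hyc, sub_self]
  have hpos : 0 < dotProduct c.1 (toR (cross (sub v y) (sub v' y))) := by
    rw [← hmix, toR_sub v', dotProduct_sub]
    exact sub_pos.2 hvy'
  obtain ⟨t, ht, hct⟩ := exists_smul_cross hl hm hpos
  have hu0 : cross (sub v y) (sub v' y) ≠ 0 := fun e => by
    rw [e] at hct
    apply h0
    rw [hct]
    ext i
    fin_cases i <;> simp [toR]
  obtain ⟨g, u, x, hg, hgu, hux⟩ := exists_primitive_vector hu0
  refine ⟨u, x, t * g, mul_pos ht (by exact_mod_cast hg), ?_, hux⟩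
  rw [hct, hgu, mul_smul]
  congr 1
  ext i
  fin_cases i <;> simp [toR, comb]

end

/-- A maximal lattice-free integral polytope is described by integer data. -/
theorem exists_isBody {P : Set (Fin 3 → ℝ)} (hP : MemM3 P) :
    ∃ F, IsBody {v | toR v ∈ P} F ∧ P = convexHull ℝ (toR '' {v | toR v ∈ P}) := by
  classical
  obtain ⟨hpoly, hb, h_int, hi, hfree, hmax⟩ := hP
  have hconv : P = convexHull ℝ (toR '' {v | toR v ∈ P}) := by
    refine Subset.antisymm ?_ ?_
    · conv_lhs => rw [h_int]
      refine convexHull_mono fun x hx => ?_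
      obtain ⟨v, rfl⟩ := exists_toR hx.2
      exact ⟨v, hx.1, rfl⟩
    · conv_rhs => rw [h_int]
      refine convexHull_mono ?_
      rintro _ ⟨v, hv, rfl⟩
      exact ⟨hv, toR_mem_intPts v⟩
  obtain ⟨S, rfl, hS⟩ := exists_irredundant hpoly
  have h0 := normal_ne_zero rfl hS (hi.mono interior_subset)
  choose! y hyc hy using fun c hc => exists_lattice_facet hS h0 hb hi hfree hmax (c := c) hc
  choose! u x t ht hu hx using fun c hc =>
    exists_integer_normal hconv hb (h0 c hc) (hyc c hc) (hy c hc) hc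
  have hdot : ∀ c ∈ S, ∀ z, dotProduct c.1 (toR z) = t c * dot (u c) z := fun c hc z => by
    rw [hu c hc, smul_dotProduct, toR_dot, smul_eq_mul]
  have hrhs : ∀ c ∈ S, c.2 = t c * dot (u c) (y c) := fun c hc => by
    rw [← hdot c hc, hyc c hc]
  have hle : ∀ c ∈ S, ∀ z, dotProduct c.1 (toR z) ≤ c.2 ↔ dot (u c) z ≤ dot (u c) (y c) :=
    fun c hc z => by
      rw [hdot c hc, hrhs c hc, mul_le_mul_iff_right₀ (ht c hc), Int.cast_le]
  have hlt : ∀ c ∈ S, ∀ z, dotProduct c.1 (toR z) < c.2 ↔ dot (u c) z < dot (u c) (y c) :=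
    fun c hc z => by
      rw [hdot c hc, hrhs c hc, mul_lt_mul_iff_right₀ (ht c hc), Int.cast_lt]
  refine ⟨(fun c => (u c, dot (u c) (y c))) '' (S : Set ((Fin 3 → ℝ) × ℝ)), ⟨?_, ?_, ?_, ?_, ?_,
    ?_, ?_⟩, hconv⟩
  · exact finite_of_isBounded hb
  · exact S.finite_toSet.image _
  · intro v
    rw [forall_mem_image]
    exact forall₂_congr fun c hc => hle c hc v
  · intro v
    by_contra! hcon
    have : toR v ∈ interior (sol S) ∩ intPts 3 :=
      ⟨(mem_interior_sol h0).2 fun c hc => (hlt c hc v).2 (hcon _ ⟨c, hc, rfl⟩), toR_mem_intPts v⟩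
    rw [hfree] at this
    exact this
  · rintro _ ⟨c, hc, rfl⟩
    refine ⟨y c, rfl, ?_⟩
    rintro _ ⟨d, hd, rfl⟩ hne
    exact (hlt d hd _).1 (hy c hc d hd fun e => hne (by rw [e]))
  · rintro _ ⟨c, hc, rfl⟩
    exact ⟨x c, hx c hc⟩
  · intro w b N X hN hX hV
    have hNR : (0 : ℝ) < N := by exact_mod_cast hN
    have hm : (N : ℝ)⁻¹ • toR X ∈ sol S := by
      intro c hc
      rw [dotProduct_smul, smul_eq_mul, inv_mul_le_iff₀ hNR, hdot c hc, hrhs c hc, mul_left_comm]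
      refine mul_le_mul_of_nonneg_left ?_ (ht c hc).le
      exact_mod_cast hX _ ⟨c, hc, rfl⟩
    have hsub : sol S ⊆ sol {(toR w, (b : ℝ))} := by
      rw [hconv]
      refine convexHull_min ?_ (convex_sol _)
      rintro _ ⟨v, hv, rfl⟩ d hd
      rw [Finset.mem_singleton.1 hd, toR_dot]
      change (dot w v : ℝ) ≤ b
      exact_mod_cast hV v hv
    have := hsub hm _ (Finset.mem_singleton_self _)
    rw [dotProduct_smul, smul_eq_mul, inv_mul_le_iff₀ hNR, toR_dot] at this
    change (dot w X : ℝ) ≤ N * b at this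
    exact_mod_cast this

/-- The point `p` lies in the positively oriented simplex with the vertices `a`, `b`, `c`, `d`. -/
def inSimplex (a b c d p : Pt) : Bool :=
  decide (0 < dot (sub b a) (cross (sub c a) (sub d a)) ∧
    0 ≤ dot (sub p a) (cross (sub c a) (sub d a)) ∧
    0 ≤ dot (sub p a) (cross (sub d a) (sub b a)) ∧
    0 ≤ dot (sub p a) (cross (sub b a) (sub c a)) ∧
    dot (sub p a) (cross (sub c a) (sub d a)) + dot (sub p a) (cross (sub d a) (sub b a)) +
      dot (sub p a) (cross (sub b a) (sub c a)) ≤ dot (sub b a) (cross (sub c a) (sub d a)))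

lemma models_inSimplex : (models.all fun m => m.2.all fun p => m.1.any fun a => m.1.any fun b =>
    m.1.any fun c => m.1.any fun d => inSimplex a b c d p) = true := by
  decide +kernel

lemma toR_mem_of_inSimplex {K : Set (Fin 3 → ℝ)} (hK : Convex ℝ K) {a b c d p : Pt}
    (ha : toR a ∈ K) (hb : toR b ∈ K) (hc : toR c ∈ K) (hd : toR d ∈ K)
    (h : inSimplex a b c d p = true) : toR p ∈ K := by
  obtain ⟨hD, h₁, h₂, h₃, hs⟩ := of_decide_eq_true h
  have key := fun u => det_mul_dot u (sub p a) (sub b a) (sub c a) (sub d a)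
  generalize dot (sub b a) (cross (sub c a) (sub d a)) = D at *
  generalize dot (sub p a) (cross (sub c a) (sub d a)) = w₁ at *
  generalize dot (sub p a) (cross (sub d a) (sub b a)) = w₂ at *
  generalize dot (sub p a) (cross (sub b a) (sub c a)) = w₃ at *
  have hDR : (0 : ℝ) < D := by exact_mod_cast hD
  have hw : ∀ i ∈ Finset.univ,
      (0 : ℝ) ≤ (![(D - w₁ - w₂ - w₃) / D, w₁ / D, w₂ / D, w₃ / D] : Fin 4 → ℝ) i := by
    have h₀ : (0 : ℝ) ≤ D - w₁ - w₂ - w₃ := by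
      have : 0 ≤ D - w₁ - w₂ - w₃ := by linarith
      exact_mod_cast this
    intro i _
    fin_cases i
    · exact div_nonneg h₀ hDR.le
    · exact div_nonneg (by exact_mod_cast h₁) hDR.le
    · exact div_nonneg (by exact_mod_cast h₂) hDR.le
    · exact div_nonneg (by exact_mod_cast h₃) hDR.le
  have hz : ∀ i ∈ Finset.univ, (![toR a, toR b, toR c, toR d] : Fin 4 → Fin 3 → ℝ) i ∈ K := by
    intro i _
    fin_cases i
    exacts [ha, hb, hc, hd]
  have hsum : ∑ i, (![(D - w₁ - w₂ - w₃) / D, w₁ / D, w₂ / D, w₃ / D] : Fin 4 → ℝ) i = 1 := by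
    simp only [Fin.sum_univ_four, Matrix.cons_val_zero, Matrix.cons_val_one, Matrix.cons_val]
    field_simp
    ring
  have hmem := hK.sum_mem hw hsum hz
  have he : toR p = ∑ i, (![(D - w₁ - w₂ - w₃) / D, w₁ / D, w₂ / D, w₃ / D] : Fin 4 → ℝ) i •
      (![toR a, toR b, toR c, toR d] : Fin 4 → Fin 3 → ℝ) i := by
    have k₁ := congrArg (Int.cast : ℤ → ℝ) (key (1, 0, 0))
    have k₂ := congrArg (Int.cast : ℤ → ℝ) (key (0, 1, 0))
    have k₃ := congrArg (Int.cast : ℤ → ℝ) (key (0, 0, 1))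
    simp only [dot, sub, one_mul, zero_mul, add_zero, zero_add] at k₁ k₂ k₃
    push_cast at k₁ k₂ k₃
    simp only [Fin.sum_univ_four, Matrix.cons_val_zero, Matrix.cons_val_one, Matrix.cons_val]
    ext i
    fin_cases i
    · simp [toR]
      field_simp
      linear_combination k₁
    · simp [toR]
      field_simp
      linear_combination k₂
    · simp [toR]
      field_simp
      linear_combination k₃
  rwa [he]

/-- The polytope spanned by a list of lattice points. -/
def hull (l : List Pt) : Set (Fin 3 → ℝ) := convexHull ℝ (toR '' {p | p ∈ l})

lemma convex_hull (l : List Pt) : Convex ℝ (hull l) := convex_convexHull ℝ _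

lemma toR_mem_hull {l : List Pt} {p : Pt} (h : p ∈ l) : toR p ∈ hull l :=
  subset_convexHull ℝ _ ⟨p, h, rfl⟩

lemma hull_subset {l : List Pt} {K : Set (Fin 3 → ℝ)} (hK : Convex ℝ K) (h : ∀ p ∈ l, toR p ∈ K) :
    hull l ⊆ K := by
  refine convexHull_min ?_ hK
  rintro _ ⟨p, hp, rfl⟩
  exact h p hp

lemma toR_mem_hull_of_mem_models {m : List Pt × List Pt} (hm : m ∈ models) {p : Pt}
    (hp : p ∈ m.2) : toR p ∈ hull m.1 := by
  have h := List.all_eq_true.1 (List.all_eq_true.1 models_inSimplex m hm) p hp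
  simp only [List.any_eq_true] at h
  obtain ⟨a, ha, b, hb, c, hc, d, hd, h⟩ := h
  exact toR_mem_of_inSimplex (convex_hull _) (toR_mem_hull ha) (toR_mem_hull hb) (toR_mem_hull hc)
    (toR_mem_hull hd) h

namespace Frame

/-- The matrix of the linear part. -/
def matrix (φ : Frame) : Matrix (Fin 3) (Fin 3) ℤ :=
  !![φ.c₁.1, φ.c₂.1, φ.c₃.1; φ.c₁.2.1, φ.c₂.2.1, φ.c₃.2.1; φ.c₁.2.2, φ.c₂.2.2, φ.c₃.2.2]

/-- The translation part. -/
def shift (φ : Frame) : Fin 3 → ℤ := ![φ.o.1, φ.o.2.1, φ.o.2.2]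

lemma det_matrix (φ : Frame) : φ.matrix.det = φ.det := by
  simp [matrix, Matrix.det_fin_three, det, dot, cross]
  ring

lemma affMap_toR (φ : Frame) (p : Pt) :
    affMap φ.matrix (fun i => (φ.shift i : ℝ)) (toR p) = toR (φ.app p) := by
  ext i
  fin_cases i <;> simp [affMap, matrix, shift, toR, app, Fin.sum_univ_three] <;> ring

end Frame

lemma affMap_comb (U : Matrix (Fin 3) (Fin 3) ℤ) (t x y : Fin 3 → ℝ) {a b : ℝ} (h : a + b = 1) :
    affMap U t (a • x + b • y) = a • affMap U t x + b • affMap U t y := by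
  ext i
  simp only [affMap, Fin.sum_univ_three, Pi.add_apply, Pi.smul_apply, smul_eq_mul]
  linear_combination -(t i) * h

lemma IsModel.eq_image {P : Set (Fin 3 → ℝ)} (hP : P = convexHull ℝ (toR '' {v | toR v ∈ P}))
    (h : IsModel {v | toR v ∈ P}) :
    ∃ m ∈ models, ∃ φ : Frame, |φ.matrix.det| = 1 ∧
      P = affMap φ.matrix (fun i => (φ.shift i : ℝ)) '' hull m.1 := by
  obtain ⟨m, hm, φ, hφ, hv, hp⟩ := h
  have hPc : Convex ℝ P := by
    rw [hP]
    exact convex_convexHull ℝ _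
  refine ⟨m, hm, φ, ?_, Subset.antisymm ?_ ?_⟩
  · rw [φ.det_matrix]
    rcases mul_self_eq_one_iff.1 hφ with h | h <;> rw [h] <;> rfl
  · rw [hP]
    refine convexHull_min ?_ ?_
    · rintro _ ⟨v, hvP, rfl⟩
      obtain ⟨p, hpm, rfl⟩ := hp v hvP
      exact ⟨toR p, toR_mem_hull_of_mem_models hm hpm, φ.affMap_toR p⟩
    · rintro _ ⟨x, hx, rfl⟩ _ ⟨y, hy, rfl⟩ a b ha hb hab
      exact ⟨a • x + b • y, convex_hull _ hx hy ha hb hab, affMap_comb _ _ _ _ hab⟩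
  · rw [image_subset_iff]
    refine hull_subset ?_ ?_
    · intro x hx y hy a b ha hb hab
      change affMap _ _ _ ∈ P
      rw [affMap_comb _ _ _ _ hab]
      exact hPc hx hy ha hb hab
    · intro p hpm
      change affMap _ _ _ ∈ P
      rw [φ.affMap_toR]
      exact hv p hpm

lemma hull_nil : toR '' {p | p ∈ ([] : List Pt)} = ∅ := by simp

lemma hull_cons (a : Pt) (l : List Pt) :
    toR '' {p | p ∈ a :: l} = insert (toR a) (toR '' {p | p ∈ l}) := by
  rw [← image_insert_eq]
  congr 1
  ext p
  simp

lemma convexHull_union_translate (A : Set (Fin 3 → ℝ)) (t : Fin 3 → ℝ) :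
    convexHull ℝ (convexHull ℝ A ∪ (fun x => x + t) '' convexHull ℝ A) =
      convexHull ℝ (A ∪ (fun x => x + t) '' A) := by
  refine Subset.antisymm (convexHull_min (union_subset ?_ ?_) (convex_convexHull ℝ _))
    (convexHull_mono (union_subset_union (subset_convexHull ℝ A)
      (image_mono (subset_convexHull ℝ A))))
  · exact convexHull_mono subset_union_left
  · rw [image_subset_iff]
    refine convexHull_min ?_ ((convex_convexHull ℝ _).translate_preimage_left t)
    rw [← image_subset_iff]
    exact subset_union_right.trans (subset_convexHull ℝ _)

lemma convex_M12 : Convex ℝ M12 := by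
  rintro _ ⟨r₁, r₂, r₃, hr₁, hr₂, hr₃, rfl⟩ _ ⟨s₁, s₂, s₃, hs₁, hs₂, hs₃, rfl⟩ a b ha hb hab
  refine ⟨a * r₁ + b * s₁, a * r₂ + b * s₂, a * r₃ + b * s₃, ?_, ?_, ?_, ?_⟩
  · exact convex_Icc 0 1 hr₁ hs₁ ha hb hab
  · exact convex_Icc 0 1 hr₂ hs₂ ha hb hab
  · exact convex_Icc 0 1 hr₃ hs₃ ha hb hab
  · ext i
    fin_cases i <;> simp <;> ring

lemma hull_eq_M12 : hull [(0, 0, 0), (1, 1, 2), (1, 1, 0), (2, 2, 2), (-1, 1, 0), (0, 2, 2),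
    (0, 2, 0), (1, 3, 2)] = M12 := by
  refine Subset.antisymm (hull_subset convex_M12 ?_) ?_
  · have h0 : (0 : ℝ) ∈ Icc (0 : ℝ) 1 := by simp
    have h1 : (1 : ℝ) ∈ Icc (0 : ℝ) 1 := by simp
    simp only [List.forall_mem_cons]
    refine ⟨⟨0, 0, 0, h0, h0, h0, ?_⟩, ⟨0, 0, 1, h0, h0, h1, ?_⟩, ⟨0, 1, 0, h0, h1, h0, ?_⟩,
      ⟨0, 1, 1, h0, h1, h1, ?_⟩, ⟨1, 0, 0, h1, h0, h0, ?_⟩, ⟨1, 0, 1, h1, h0, h1, ?_⟩,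
      ⟨1, 1, 0, h1, h1, h0, ?_⟩, ⟨1, 1, 1, h1, h1, h1, ?_⟩, by simp⟩ <;>
    · ext i
      fin_cases i <;> norm_num [toR]
  · rintro _ ⟨r, s, t, hr, hs, ht, rfl⟩
    have hcomb : ∀ {r : ℝ} {x y : Fin 3 → ℝ} {l : List Pt}, r ∈ Icc (0 : ℝ) 1 → x ∈ hull l →
        y ∈ hull l → (1 - r) • x + r • y ∈ hull l := fun hr hx hy =>
      convex_hull _ hx hy (by linarith [hr.2]) hr.1 (by ring)
    have hv := fun p (hp : p ∈ [(0, 0, 0), (1, 1, 2), (1, 1, 0), (2, 2, 2), (-1, 1, 0), (0, 2, 2),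
      (0, 2, 0), (1, 3, 2)]) => toR_mem_hull hp
    convert hcomb ht
      (hcomb hs (hcomb hr (hv (0, 0, 0) (by simp)) (hv (-1, 1, 0) (by simp)))
        (hcomb hr (hv (1, 1, 0) (by simp)) (hv (0, 2, 0) (by simp))))
      (hcomb hs (hcomb hr (hv (1, 1, 2) (by simp)) (hv (0, 2, 2) (by simp)))
        (hcomb hr (hv (2, 2, 2) (by simp)) (hv (1, 3, 2) (by simp)))) using 1
    ext i
    fin_cases i
    · simp [toR]
      ring
    · simp [toR]
      ring
    · simp only [toR, Fin.reduceFinMk, Pi.add_apply, Pi.smul_apply, smul_eq_mul, Matrix.cons_val]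
      push_cast
      ring

lemma hull_eq {m : List Pt × List Pt} (hm : m ∈ models) :
    hull m.1 = M1 ∨ hull m.1 = M2 ∨ hull m.1 = M3 ∨ hull m.1 = M4 ∨ hull m.1 = M5 ∨
    hull m.1 = M6 ∨ hull m.1 = M7 ∨ hull m.1 = M8 ∨ hull m.1 = M9 ∨ hull m.1 = M10 ∨
    hull m.1 = M11 ∨ hull m.1 = M12 := by
  simp only [models, List.mem_cons, List.not_mem_nil, or_false] at hm
  rcases hm with rfl | rfl | rfl | rfl | rfl | rfl | rfl | rfl | rfl | rfl | rfl | rfl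
  · exact Or.inl (by simp only [hull, hull_cons, hull_nil, M1]; simp [toR])
  · exact Or.inr (Or.inl (by simp only [hull, hull_cons, hull_nil, M2]; simp [toR]))
  · iterate 2 apply Or.inr
    exact Or.inl (by simp only [hull, hull_cons, hull_nil, M3]; simp [toR])
  · iterate 3 apply Or.inr
    exact Or.inl (by simp only [hull, hull_cons, hull_nil, M4]; simp [toR])
  · iterate 4 apply Or.inr
    exact Or.inl (by simp only [hull, hull_cons, hull_nil, M5]; simp [toR])
  · iterate 5 apply Or.inr
    exact Or.inl (by simp only [hull, hull_cons, hull_nil, M6]; simp [toR])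
  · iterate 6 apply Or.inr
    exact Or.inl (by simp only [hull, hull_cons, hull_nil, M7]; simp [toR])
  · iterate 7 apply Or.inr
    exact Or.inl (by simp only [hull, hull_cons, hull_nil, M8]; simp [toR])
  · iterate 8 apply Or.inr
    exact Or.inl (by simp only [hull, hull_cons, hull_nil, M9]; simp [toR])
  · iterate 9 apply Or.inr
    refine Or.inl ?_
    rw [M10, B10, convexHull_union_translate]
    simp only [image_insert_eq, image_singleton, hull, hull_cons, hull_nil, insert_union,
      singleton_union]
    norm_num [toR]
  · iterate 10 apply Or.inr
    refine Or.inl ?_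
    rw [M11, B11, convexHull_union_translate]
    simp only [image_insert_eq, image_singleton, hull, hull_cons, hull_nil, insert_union,
      singleton_union]
    norm_num [toR]
  · iterate 11 apply Or.inr
    exact hull_eq_M12

end LatticeFree

/-- Every maximal lattice-free integral polytope in `ℝ³` is, up to a unimodular
transformation, one of the twelve polytopes `M₁, …, M₁₂`. -/
theorem maximal_latticefree_integral_polytopes_dim3 (P : Set (Fin 3 → ℝ))
    (hP : MemM3 P) :
    ∃ (U : Matrix (Fin 3) (Fin 3) ℤ) (v : Fin 3 → ℤ), |U.det| = 1 ∧
      (P = affMap U (fun i => (v i : ℝ)) '' M1 ∨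
       P = affMap U (fun i => (v i : ℝ)) '' M2 ∨
       P = affMap U (fun i => (v i : ℝ)) '' M3 ∨
       P = affMap U (fun i => (v i : ℝ)) '' M4 ∨
       P = affMap U (fun i => (v i : ℝ)) '' M5 ∨
       P = affMap U (fun i => (v i : ℝ)) '' M6 ∨
       P = affMap U (fun i => (v i : ℝ)) '' M7 ∨
       P = affMap U (fun i => (v i : ℝ)) '' M8 ∨
       P = affMap U (fun i => (v i : ℝ)) '' M9 ∨
       P = affMap U (fun i => (v i : ℝ)) '' M10 ∨
       P = affMap U (fun i => (v i : ℝ)) '' M11 ∨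
       P = affMap U (fun i => (v i : ℝ)) '' M12) := by
  obtain ⟨F, hF, hconv⟩ := LatticeFree.exists_isBody hP
  obtain ⟨m, hm, φ, hdet, hPm⟩ := hF.isModel.eq_image hconv
  refine ⟨φ.matrix, φ.shift, hdet, ?_⟩
  rw [hPm]
  rcases LatticeFree.hull_eq hm with h | h | h | h | h | h | h | h | h | h | h | h <;>
    rw [h] <;> simp only [true_or, or_true]
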